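/- arXiv:2510.23841 — 3 statements merged into one kernel-verified Lean document; each statement's English description precedes it below -/
import Mathlib

section
/- Let G be a finite group with |cs(G)| ≥ 4 such that exactly two elements of cs(G) are composite numbers, and suppose these two composite class sizes are p^a and n, where p is a prime and a ≥ 2 is an integer. Then p divides n. -/
/-- The set of conjugacy class sizes of a group `G`. -/
def csSet (G : Type*) [Group G] : Set ℕ :=
  {n | ∃ g : G, n = (Subgroup.centralizer {g} : Subgroup G).index}

/-- A natural number is composite if it is greater than 1 and not prime. -/
def IsCompositeNat (n : ℕ) : Prop := 1 < n ∧ ¬ n.Prime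

set_option linter.unusedSectionVars false

namespace CS

section
variable {G : Type*} [Group G]

/-- class size -/
noncomputable def s (g : G) : ℕ := (Subgroup.centralizer {g} : Subgroup G).index

theorem mem_cen {g x : G} : x ∈ (Subgroup.centralizer {g} : Subgroup G) ↔ x * g = g * x := by
  rw [Subgroup.mem_centralizer_iff]
  simp [eq_comm]

theorem s_eq_one {g : G} : s g = 1 ↔ ∀ x, x * g = g * x := by
  unfold s
  rw [Subgroup.index_eq_one, Subgroup.eq_top_iff']
  simp only [mem_cen]

theorem s_dvd_of_le {g h : G} (H : ∀ x, x * g = g * x → x * h = h * x) : s h ∣ s g := by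
  apply Subgroup.index_dvd_of_le
  intro x hx
  rw [mem_cen] at *
  exact H x hx

variable [Finite G]

theorem s_pos (g : G) : s g ≠ 0 := Subgroup.index_ne_zero_of_finite

theorem s_dvd_card (g : G) : s g ∣ Nat.card G := Subgroup.index_dvd_card _

/-- coprime-index factorization -/
theorem factor (H K : Subgroup G) (h : H.index.Coprime K.index) (g : G) :
    ∃ x ∈ H, ∃ y ∈ K, g = x * y := by
  have h1 : K.index ∣ K.relIndex H := by
    have e1 : K.relIndex H * H.index = (K ⊓ H).index := by
      rw [← Subgroup.inf_relIndex_right]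
      exact Subgroup.relIndex_mul_index inf_le_right
    have e2 : K.index ∣ (K ⊓ H).index := Subgroup.index_dvd_of_le inf_le_left
    rw [← e1] at e2
    exact h.symm.dvd_of_dvd_mul_right e2
  have h2 : (MulAction.orbit H ((1 : G) : G ⧸ K)).ncard = K.relIndex H := by
    rw [← MulAction.index_stabilizer]
    unfold Subgroup.relIndex
    congr 1
    ext x
    rw [MulAction.mem_stabilizer_iff, Subgroup.mem_subgroupOf]
    change ((x : G) • ((1 : G) : G ⧸ K)) = _ ↔ _
    rw [MulAction.Quotient.smul_coe, QuotientGroup.eq]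
    simp
  have h3 : MulAction.orbit H ((1 : G) : G ⧸ K) = Set.univ := by
    apply Set.eq_of_subset_of_ncard_le (Set.subset_univ _)
    rw [h2, Set.ncard_univ]
    apply Nat.le_of_dvd _ h1
    apply Nat.pos_of_ne_zero
    exact Subgroup.index_ne_zero_of_finite
  have h4 : ((g : G) : G ⧸ K) ∈ MulAction.orbit H ((1 : G) : G ⧸ K) := by rw [h3]; trivial
  obtain ⟨x, hx⟩ := h4
  change ((x : G) • ((1 : G) : G ⧸ K)) = _ at hx
  rw [MulAction.Quotient.smul_coe, QuotientGroup.eq] at hx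
  refine ⟨x, x.2, _, hx, ?_⟩
  simp

/-- Normal subgroup of coprime order is centralized. -/
theorem cent_of_coprime (N : Subgroup G) [N.Normal] (c : G) (h : (s c).Coprime (Nat.card N)) :
    ∀ x ∈ N, x * c = c * x := by
  have h1 : (Subgroup.centralizer {c}).relIndex N ∣ Nat.card N := Subgroup.relIndex_dvd_card _ _
  have h2 : (Subgroup.centralizer {c}).relIndex N ∣ s c := by
    have e1 : ((Subgroup.centralizer {c}) ⊓ N).index =
      (Subgroup.centralizer {c}).relIndex N * N.index := by
      rw [← Subgroup.inf_relIndex_right]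
      exact (Subgroup.relIndex_mul_index inf_le_right).symm
    have e2 : ((Subgroup.centralizer {c}) ⊓ N).index =
      N.relIndex (Subgroup.centralizer {c}) * s c := by
      rw [← Subgroup.inf_relIndex_left]
      exact (Subgroup.relIndex_mul_index inf_le_left).symm
    have e3 : N.relIndex (Subgroup.centralizer {c}) ∣ N.index :=
      Subgroup.relIndex_dvd_index_of_normal _ _
    obtain ⟨k, hk⟩ := e3
    have hN : N.index ≠ 0 := Subgroup.index_ne_zero_of_finite
    have h0 : N.relIndex (Subgroup.centralizer {c}) ≠ 0 := by
      intro h; rw [h] at hk; simp at hk; exact hN hk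
    refine ⟨k, ?_⟩
    rw [e1, hk] at e2
    have : 0 < N.relIndex (Subgroup.centralizer {c}) := Nat.pos_of_ne_zero h0
    apply Nat.eq_of_mul_eq_mul_left this
    rw [← e2]; ring
  have h3 : (Subgroup.centralizer {c}).relIndex N = 1 := Nat.eq_one_of_dvd_coprimes h h2 h1
  rw [Subgroup.relIndex_eq_one] at h3
  intro x hx
  exact mem_cen.1 (h3 hx)

theorem exists_split (g : G) (k m : ℕ) (hkm : k.Coprime m) (hc : Nat.card G = k * m) :
    ∃ a b : G, g = a * b ∧ a ∈ Subgroup.zpowers g ∧ b ∈ Subgroup.zpowers g ∧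
      a ^ k = 1 ∧ b ^ m = 1 := by
  have hz := Nat.isCoprime_iff_coprime.2 hkm
  obtain ⟨u, v, huv⟩ := hz
  have hg : g ^ (k * m) = 1 := by rw [← hc]; exact pow_card_eq_one'
  have hg' : g ^ ((k : ℤ) * m) = 1 := by exact_mod_cast hg
  refine ⟨g ^ (v * m), g ^ (u * k), ?_, ⟨_, rfl⟩, ⟨_, rfl⟩, ?_, ?_⟩
  · rw [← zpow_add, add_comm, huv, zpow_one]
  · rw [← zpow_natCast, ← zpow_mul, show v * m * k = (k * m : ℤ) * v by ring, zpow_mul, hg',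
      one_zpow]
  · rw [← zpow_natCast, ← zpow_mul, show u * k * m = (k * m : ℤ) * u by ring, zpow_mul, hg',
      one_zpow]

theorem comm_of_zpowers {g a x : G} (ha : a ∈ Subgroup.zpowers g) (h : x * g = g * x) :
    x * a = a * x := by
  obtain ⟨i, rfl⟩ := ha
  exact (Commute.zpow_right (h : Commute x g) i)

theorem s_dvd_of_zpowers {g a : G} (ha : a ∈ Subgroup.zpowers g) : s a ∣ s g :=
  s_dvd_of_le fun _ hx => comm_of_zpowers ha hx

theorem left_mem_zpowers {a b : G} (hab : a * b = b * a) {k m : ℕ} (hkm : k.Coprime m)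
    (ha : a ^ k = 1) (hb : b ^ m = 1) : a ∈ Subgroup.zpowers (a * b) := by
  have hz := Nat.isCoprime_iff_coprime.2 hkm
  obtain ⟨u, v, huv⟩ := hz
  refine ⟨v * m, ?_⟩
  have hc : Commute a b := hab
  change (a * b) ^ (v * m) = a
  rw [hc.mul_zpow]
  have h1 : b ^ (v * (m : ℤ)) = 1 := by
    rw [mul_comm, zpow_mul, zpow_natCast, hb, one_zpow]
  have h2 : a ^ (u * (k : ℤ)) = 1 := by
    rw [mul_comm, zpow_mul, zpow_natCast, ha, one_zpow]
  have h3 : a ^ (u * (k : ℤ) + v * m) = a := by rw [huv, zpow_one]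
  rw [zpow_add, h2, one_mul] at h3
  rw [h1, h3, mul_one]

theorem right_mem_zpowers {a b : G} (hab : a * b = b * a) {k m : ℕ} (hkm : k.Coprime m)
    (ha : a ^ k = 1) (hb : b ^ m = 1) : b ∈ Subgroup.zpowers (a * b) := by
  rw [hab]
  exact left_mem_zpowers hab.symm hkm.symm hb ha

/-- A finite group is not covered by the conjugates of a proper subgroup. -/
theorem eq_top_of_conj_cover (H : Subgroup G) (h : ∀ g : G, ∃ x : G, x⁻¹ * g * x ∈ H) :
    H = ⊤ := by
  classical
  have := Fintype.ofFinite G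
  have := Fintype.ofFinite (G ⧸ H)
  have := Fintype.ofFinite (Quotient (MulAction.orbitRel G (G ⧸ H)))
  have B := MulAction.sum_card_fixedBy_eq_card_orbits_mul_card_group G (G ⧸ H)
  have h1 : Fintype.card (Quotient (MulAction.orbitRel G (G ⧸ H))) ≤ 1 := by
    have : Subsingleton (Quotient (MulAction.orbitRel G (G ⧸ H))) :=
      (MulAction.pretransitive_iff_subsingleton_quotient G (G ⧸ H)).1 inferInstance
    exact Fintype.card_le_one_iff_subsingleton.2 this
  have h2 : ∀ g : G, 1 ≤ Fintype.card (MulAction.fixedBy (G ⧸ H) g) := by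
    intro g
    obtain ⟨x, hx⟩ := h g
    apply Fintype.card_pos_iff.2
    refine ⟨⟨(x : G ⧸ H), ?_⟩⟩
    rw [MulAction.mem_fixedBy, MulAction.Quotient.smul_coe, eq_comm, QuotientGroup.eq]
    simpa [mul_assoc] using hx
  have h3 : ∑ g : G, Fintype.card (MulAction.fixedBy (G ⧸ H) g) ≤ ∑ g : G, 1 := by
    rw [B]; simp; nlinarith [Fintype.card_pos (α := G)]
  have h4 : ∀ g : G, Fintype.card (MulAction.fixedBy (G ⧸ H) g) = 1 := by
    by_contra hcon
    push Not at hcon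
    obtain ⟨g, hg⟩ := hcon
    have := Finset.sum_lt_sum (s := Finset.univ) (fun g _ => h2 g)
      ⟨g, Finset.mem_univ _, lt_of_le_of_ne (h2 g) (Ne.symm hg)⟩
    omega
  have h5 := h4 1
  rw [← Subgroup.index_eq_one, Subgroup.index, ← h5, ← Nat.card_eq_fintype_card]
  simp


theorem sylow_comm {q : ℕ} [Fact q.Prime] (Q : Sylow q G) (u : G) (h : ¬ q ∣ s u) :
    ∃ g : G, ∀ x ∈ Q, x * (g * u * g⁻¹) = (g * u * g⁻¹) * x := by
  obtain ⟨P0⟩ : Nonempty (Sylow q (Subgroup.centralizer {u} : Subgroup G)) := inferInstance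
  set C := (Subgroup.centralizer {u} : Subgroup G) with hC
  have h1 : IsPGroup q (P0.map C.subtype : Subgroup G) := P0.2.map _
  have h2 : ¬ q ∣ (P0.map C.subtype : Subgroup G).index := by
    rw [Subgroup.index_map_subtype]
    intro hd
    rcases (Fact.out : q.Prime).dvd_mul.1 hd with h' | h'
    · exact P0.not_dvd_index h'
    · exact h h'
  let P1 : Sylow q G := h1.toSylow h2
  obtain ⟨g, hg⟩ := MulAction.exists_smul_eq G P1 Q
  refine ⟨g, fun x hx => ?_⟩
  rw [← hg] at hx
  have hx' : x ∈ (g • P1 : Sylow q G).toSubgroup := hx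
  rw [Sylow.coe_subgroup_smul, Subgroup.mem_pointwise_smul_iff_inv_smul_mem] at hx'
  have h3 : g⁻¹ * x * g ∈ (P0.map C.subtype : Subgroup G) := by
    simpa [MulAut.smul_def, P1] using hx'
  obtain ⟨y, -, hy⟩ := h3
  have h4 := mem_cen.1 y.2
  have hy' : (y : G) = g⁻¹ * x * g := hy
  rw [hy'] at h4
  have h5 : x * (g * u * g⁻¹) = g * (g⁻¹ * x * g * u) * g⁻¹ := by group
  rw [h5, h4]; group

theorem s_mul_central {g z : G} (hz : ∀ x, x * z = z * x) : s (z * g) = s g := by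
  apply Nat.dvd_antisymm
  · apply s_dvd_of_le
    intro x hx
    rw [← mul_assoc, hz x, mul_assoc, hx, mul_assoc]
  · apply s_dvd_of_le
    intro x hx
    rw [← mul_assoc, hz x, mul_assoc, mul_assoc] at hx
    exact mul_left_cancel hx

theorem final (N : Subgroup G) [N.Normal] (hN : (Nat.card N).Coprime N.index)
    (hT : ∀ g : G, (s g).Coprime (Nat.card N) ∨ (s g).Coprime N.index)
    (H1 : ∀ g : G, g ^ N.index = 1 → (s g).Coprime N.index)
    (hM : ∃ g : G, s g ≠ 1 ∧ (s g).Coprime (Nat.card N)) : (csSet G).ncard ≤ 3 := by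
  have hcard : Nat.card G = Nat.card N * N.index := N.card_mul_index.symm
  have both : ∀ g : G, (s g).Coprime (Nat.card N) → (s g).Coprime N.index → s g = 1 := by
    intro g h1 h2
    have := s_dvd_card g
    rw [hcard] at this
    exact Nat.Coprime.eq_one_of_dvd (h1.mul_right h2) this
  have nocomm : ∀ m d : G, m * d = d * m → m ^ (Nat.card N) = 1 → d ^ N.index = 1 →
      (s m).Coprime (Nat.card N) → (s d).Coprime N.index → s m ≠ 1 → s d = 1 := by
    intro m d hmd hm hd cm cd hm1
    rcases hT (m * d) with h | h
    · exact both d (h.coprime_dvd_left (s_dvd_of_zpowers (right_mem_zpowers hmd hN hm hd))) cd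
    · exact absurd
        (both m cm (h.coprime_dvd_left (s_dvd_of_zpowers (left_mem_zpowers hmd hN hm hd)))) hm1
  have hmemN : ∀ a : G, a ^ (Nat.card N) = 1 → a ∈ N := by
    intro a ha
    rw [← QuotientGroup.eq_one_iff]
    have h1 : ((a : G ⧸ N)) ^ (Nat.card N) = 1 := by
      rw [← QuotientGroup.mk_pow, ha]; rfl
    have h2 : ((a : G ⧸ N)) ^ N.index = 1 := pow_card_eq_one'
    have := pow_gcd_eq_one.2 ⟨h1, h2⟩
    rwa [hN.gcd_eq_one, pow_one] at this
  have hpowN : ∀ a ∈ N, a ^ (Nat.card N) = 1 := by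
    intro a ha
    have : (⟨a, ha⟩ : N) ^ (Nat.card N) = 1 := pow_card_eq_one'
    have h2 := congrArg Subtype.val this
    rwa [Subgroup.coe_pow] at h2
  -- elements of N central in N are M
  have hZN : ∀ a : G, (∀ x ∈ N, x * a = a * x) → (s a).Coprime (Nat.card N) := by
    intro a ha
    have : s a ∣ N.index := Subgroup.index_dvd_of_le (fun x hx => mem_cen.2 (ha x hx))
    exact hN.symm.coprime_dvd_left this
  -- a noncentral y in N, M-type
  obtain ⟨y, hyN, hy1, hyM⟩ : ∃ y ∈ N, s y ≠ 1 ∧ (s y).Coprime (Nat.card N) := by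
    obtain ⟨g, hg1, hg⟩ := hM
    obtain ⟨a, b, hab, ha, hb, hak, hbm⟩ := exists_split g _ _ hN hcard
    have hb1 : s b = 1 :=
      both b (hg.coprime_dvd_left (s_dvd_of_zpowers hb)) (H1 b hbm)
    refine ⟨a, hmemN a hak, ?_, hg.coprime_dvd_left (s_dvd_of_zpowers ha)⟩
    intro ha1
    apply hg1
    rw [hab, s_mul_central (s_eq_one.1 ha1), hb1]
  have hyC := cent_of_coprime N y hyM
  -- prime q with noncentral Sylow
  obtain ⟨q, hq, hqN, hQ⟩ : ∃ q : ℕ, q.Prime ∧ q ∣ N.index ∧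
      ∀ Q : Sylow q G, ∃ x ∈ Q, s x ≠ 1 := by
    by_contra hcon
    push Not at hcon
    have htop : N ⊔ Subgroup.center G = ⊤ := by
      rw [← Subgroup.index_eq_one]
      by_contra h1
      obtain ⟨q, hq, hqd⟩ := Nat.exists_prime_and_dvd h1
      have hqN : q ∣ N.index := hqd.trans (Subgroup.index_dvd_of_le le_sup_left)
      obtain ⟨Q, hQ⟩ := hcon q hq hqN
      have : Fact q.Prime := ⟨hq⟩
      have hle : (Q : Subgroup G) ≤ N ⊔ Subgroup.center G := by
        refine le_trans ?_ le_sup_right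
        intro x hx
        rw [Subgroup.mem_center_iff]
        exact s_eq_one.1 (hQ x hx)
      exact Q.not_dvd_index (hqd.trans (Subgroup.index_dvd_of_le hle))
    apply hy1
    rw [s_eq_one]
    intro x
    have hx : x ∈ N ⊔ Subgroup.center G := by rw [htop]; trivial
    obtain ⟨a, ha, z, hz, rfl⟩ := Subgroup.mem_sup_of_normal_right.1 hx
    rw [mul_assoc, ← Subgroup.mem_center_iff.1 hz y, ← mul_assoc, hyC a ha, mul_assoc]
  have : Fact q.Prime := ⟨hq⟩
  obtain ⟨Q⟩ : Nonempty (Sylow q G) := inferInstance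
  obtain ⟨x, hxQ, hx1⟩ := hQ Q
  have hxpow : x ^ N.index = 1 := by
    obtain ⟨k, hk⟩ := Q.2 ⟨x, hxQ⟩
    have hk' : x ^ (q ^ k) = 1 := by simpa using congrArg Subtype.val hk
    have h1 : x ^ (Nat.card N * N.index) = 1 := by rw [← hcard]; exact pow_card_eq_one'
    have h2 : (q ^ k).Coprime (Nat.card N) :=
      Nat.Coprime.pow_left _ (hN.symm.coprime_dvd_left hqN)
    have h3 : orderOf x ∣ N.index := by
      apply Nat.Coprime.dvd_of_dvd_mul_left _ (orderOf_dvd_of_pow_eq_one h1)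
      exact h2.coprime_dvd_left (orderOf_dvd_of_pow_eq_one hk')
    exact orderOf_dvd_iff_pow_eq_one.1 h3
  have hDN : ∀ u ∈ N, (∃ v ∈ N, v * u ≠ u * v) → (s u).Coprime N.index := by
    rintro u hu ⟨v, hv, hvu⟩
    rcases hT u with h | h
    · exact absurd (cent_of_coprime N u h v hv) hvu
    · exact h
  have hconj : ∀ u ∈ N, (∃ v ∈ N, v * u ≠ u * v) →
      ∃ m ∈ N, ∀ x ∈ Q, x * (m⁻¹ * u * m) = (m⁻¹ * u * m) * x := by
    intro u hu hv
    have hd := hDN u hu hv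
    have hqu : ¬ q ∣ s u := fun h => by
      have := Nat.eq_one_of_dvd_coprimes hd h hqN
      exact hq.one_lt.ne' this
    obtain ⟨g, hg⟩ := sylow_comm Q u hqu
    obtain ⟨c, hc, m, hm, hcm⟩ := factor (Subgroup.centralizer {u}) N hd g⁻¹
    refine ⟨m, hm, ?_⟩
    have hc' := mem_cen.1 hc
    have : g * u * g⁻¹ = m⁻¹ * u * m := by
      have hg' : g = m⁻¹ * c⁻¹ := by rw [← mul_inv_rev, ← hcm, inv_inv]
      rw [hg']
      have : m⁻¹ * c⁻¹ * u * (m⁻¹ * c⁻¹)⁻¹ = m⁻¹ * c⁻¹ * (u * c) * m := by group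
      rw [this, ← hc']; group
    rw [← this]; exact hg
  -- the covering
  have hS : ∀ n ∈ N, ∃ t ∈ N, (∀ x ∈ Q, x * t = t * x) ∧ ∃ z ∈ N, (∀ v ∈ N, v * z = z * v) ∧
      n = t * z := by
    let T : Subgroup N := (Subgroup.centralizer (Q : Set G)).subgroupOf N
    have key : T ⊔ Subgroup.center N = ⊤ := by
      apply eq_top_of_conj_cover
      intro u
      by_cases hu : ∃ v ∈ N, v * (u : G) ≠ u * v
      · obtain ⟨m, hm, hmx⟩ := hconj u u.2 hu
        refine ⟨⟨m, hm⟩, ?_⟩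
        apply Subgroup.mem_sup_left
        rw [Subgroup.mem_subgroupOf, Subgroup.mem_centralizer_iff]
        intro h hh
        exact hmx h hh
      · push Not at hu
        refine ⟨1, Subgroup.mem_sup_right ?_⟩
        rw [Subgroup.mem_center_iff]
        intro v
        apply Subtype.ext
        simpa using hu v v.2
    intro n hn
    have hn' : (⟨n, hn⟩ : N) ∈ T ⊔ Subgroup.center N := by rw [key]; trivial
    obtain ⟨t, ht, z, hz, htz⟩ := Subgroup.mem_sup_of_normal_right.1 hn'
    refine ⟨t, t.2, ?_, z, z.2, ?_, ?_⟩
    · intro x hx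
      rw [Subgroup.mem_subgroupOf, Subgroup.mem_centralizer_iff] at ht
      exact ht x hx
    · intro v hv
      exact congrArg Subtype.val (Subgroup.mem_center_iff.1 hz ⟨v, hv⟩)
    · exact (congrArg Subtype.val htz).symm
  have hab : ∀ u ∈ N, ∀ v ∈ N, v * u = u * v := by
    by_contra hcon
    push Not at hcon
    obtain ⟨u0, hu0, v, hv, hvu⟩ := hcon
    obtain ⟨u, hu, huQ, z, hz, hzc, rfl⟩ := hS u0 hu0
    have hvu' : v * u ≠ u * v := by
      intro h
      apply hvu
      rw [← mul_assoc, h, mul_assoc, hzc v hv, ← mul_assoc]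
    have hvuy : v * (u * y) ≠ u * y * v := by
      intro h
      apply hvu'
      rw [mul_assoc, ← hyC v hv, ← mul_assoc, ← mul_assoc] at h
      exact mul_right_cancel h
    obtain ⟨m, hm, hmQ⟩ := hconj (u * y) (N.mul_mem hu hyN) ⟨v, hv, hvuy⟩
    obtain ⟨t, ht, htQ, w, hw, hwc, rfl⟩ := hS m hm
    have e1 : (t * w)⁻¹ * (u * y) * (t * w) = t⁻¹ * u * t * y := by
      have a1 : (t * w)⁻¹ * (u * y) * (t * w) = w⁻¹ * ((t⁻¹ * u * (y * t)) * w) := by group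
      rw [a1, hwc _ (N.mul_mem (N.mul_mem (N.inv_mem ht) hu) (N.mul_mem hyN ht)),
        ← hyC t ht]
      group
    rw [e1] at hmQ
    have hxt : Commute x t := htQ x hxQ
    have hxu : Commute x u := huQ x hxQ
    have hxa : Commute x (t⁻¹ * u * t) := ((hxt.inv_right).mul_right hxu).mul_right hxt
    have hxy : Commute x y := by
      have h1 : Commute x (t⁻¹ * u * t * y) := hmQ x hxQ
      have := (hxa.inv_right).mul_right h1
      simpa [mul_assoc] using this
    exact hx1 (nocomm y x hxy.symm (hpowN y hyN) hxpow hyM (H1 x hxpow) hy1)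
  -- sizes
  have hNM : ∀ u ∈ N, (s u).Coprime (Nat.card N) := fun u hu => hZN u (fun v hv => hab u hu v hv)
  have hsub : csSet G ⊆ {1, (N ⊔ Subgroup.center G).index, (Subgroup.center G).relIndex N} := by
    rintro _ ⟨g, rfl⟩
    change s g ∈ _
    by_cases hg1 : s g = 1
    · left; exact hg1
    right
    obtain ⟨a, b, hab', ha, hb, hak, hbm⟩ := exists_split g _ _ hN hcard
    have haN := hmemN a hak
    rcases hT g with hg | hg
    · left
      have hb1 : s b = 1 := both b (hg.coprime_dvd_left (s_dvd_of_zpowers hb)) (H1 b hbm)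
      have ha1 : s a ≠ 1 := by
        intro ha1
        apply hg1
        rw [hab', s_mul_central (s_eq_one.1 ha1), hb1]
      unfold s
      congr 1
      apply le_antisymm
      · intro h hh
        have hh' := mem_cen.1 hh
        obtain ⟨c, d, hcd, hc, hd, hck, hdm⟩ := exists_split h _ _ hN hcard
        rw [hcd]
        apply Subgroup.mul_mem_sup (hmemN c hck)
        rw [Subgroup.mem_center_iff]
        apply s_eq_one.1
        apply nocomm a d _ hak hdm (hNM a haN) (H1 d hdm) ha1
        have e1 : h * a = a * h := comm_of_zpowers ha hh'
        exact comm_of_zpowers hd e1.symm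
      · apply sup_le
        · intro v hv
          exact mem_cen.2 (cent_of_coprime N g hg v hv)
        · intro z hz
          exact mem_cen.2 (Subgroup.mem_center_iff.1 hz g).symm
    · right
      have ha1 : s a = 1 := both a (hNM a haN) (hg.coprime_dvd_left (s_dvd_of_zpowers ha))
      have hgb : s g = s b := by rw [hab', s_mul_central (s_eq_one.1 ha1)]
      have e1 : (Subgroup.centralizer {b} ⊓ N) = Subgroup.center G ⊓ N := by
        apply le_antisymm
        · rintro v ⟨hv, hvN⟩
          refine ⟨?_, hvN⟩
          change v ∈ Subgroup.center G
          rw [Subgroup.mem_center_iff]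
          apply s_eq_one.1
          by_contra hv1
          have := nocomm v b (mem_cen.1 hv) (hpowN v hvN) hbm (hNM v hvN) (H1 b hbm) hv1
          exact hg1 (hgb.trans this)
        · rintro v ⟨hv, hvN⟩
          exact ⟨mem_cen.2 (Subgroup.mem_center_iff.1 hv b).symm, hvN⟩
      rw [hgb] at hg ⊢
      change s b = _
      rw [← Subgroup.inf_relIndex_right, ← e1, Subgroup.inf_relIndex_right]
      have e2 : (Subgroup.centralizer {b}).relIndex N * N.index =
          N.relIndex (Subgroup.centralizer {b}) * s b := by
        rw [← Subgroup.inf_relIndex_right, Subgroup.relIndex_mul_index inf_le_right,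
          ← Subgroup.inf_relIndex_left]
        exact (Subgroup.relIndex_mul_index inf_le_left).symm
      have e3 : N.relIndex (Subgroup.centralizer {b}) = N.index := by
        apply Nat.dvd_antisymm
        · exact Subgroup.relIndex_dvd_index_of_normal _ _
        · apply hg.symm.dvd_of_dvd_mul_right
          rw [← e2]; exact Dvd.intro_left _ rfl
      rw [e3, mul_comm] at e2
      exact (Nat.eq_of_mul_eq_mul_left
        (Nat.pos_of_ne_zero Subgroup.index_ne_zero_of_finite) e2).symm
  calc (csSet G).ncard ≤ _ := Set.ncard_le_ncard hsub (by simp)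
    _ ≤ 3 := by
      classical
      refine (Set.ncard_insert_le _ _).trans ?_
      have := Set.ncard_insert_le (N ⊔ Subgroup.center G).index {(Subgroup.center G).relIndex N}
      rw [Set.ncard_singleton] at this
      omega


/-- the conjugacy class -/
def cl (g : G) : Set G := Set.range (fun x : G => x * g * x⁻¹)

theorem ncard_cl (g : G) : (cl g).ncard = s g := by
  have h1 : cl g = MulAction.orbit (ConjAct G) g := by
    ext y
    constructor
    · rintro ⟨x, rfl⟩
      exact ⟨ConjAct.toConjAct x, by simp [ConjAct.smul_def]⟩
    · rintro ⟨x, rfl⟩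
      exact ⟨ConjAct.ofConjAct x, by simp [ConjAct.smul_def]⟩
  rw [h1, ← MulAction.index_stabilizer, s]
  have h2 : (MulAction.stabilizer (ConjAct G) g) =
      (Subgroup.centralizer {g}).comap (ConjAct.ofConjAct (G := G)).toMonoidHom := by
    ext x
    rw [MulAction.mem_stabilizer_iff, Subgroup.mem_comap, mem_cen, ConjAct.smul_def,
      mul_inv_eq_iff_eq_mul]
    rfl
  rw [h2, Subgroup.index_comap_of_surjective _ (ConjAct.ofConjAct (G := G)).surjective]

open scoped Pointwise in
theorem max_lemma (b : G) (hb : s b ≠ 1) (hmax : ∀ g : G, s g ≤ s b) :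
    ∃ R : Subgroup G, R.Normal ∧ Nat.card R ∣ s b ∧
      ∀ c : G, (s b).Coprime (s c) → (∀ x : G, (s x).Coprime (s b) ∨ (s x).Coprime (s c)) →
        ∀ g : G, c⁻¹ * (g * c * g⁻¹) ∈ R := by
  have hclconj : ∀ u x g : G, x ∈ cl u → g * x * g⁻¹ ∈ cl u := by
    rintro u _ g ⟨y, rfl⟩
    exact ⟨g * y, by group⟩
  let R : Subgroup G := MulAction.stabilizer G (cl b)
  have hmemR : ∀ r : G, r ∈ R ↔ ∀ x ∈ cl b, r * x ∈ cl b := by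
    intro r
    exact MulAction.mem_stabilizer_set' (Set.toFinite _)
  have hRn : R.Normal := by
    refine ⟨fun r hr g => ?_⟩
    rw [hmemR] at *
    intro x hx
    have h1 := hclconj b _ g⁻¹ hx
    have h2 := hclconj b _ g (hr _ h1)
    convert h2 using 1
    group
  refine ⟨R, hRn, ?_, ?_⟩
  · have h1 : cl b = QuotientGroup.mk (s := R) ⁻¹' (QuotientGroup.mk (s := R) '' cl b) := by
      apply le_antisymm
      · exact Set.subset_preimage_image _ _
      · rintro x ⟨y, hy, hyx⟩
        rw [QuotientGroup.eq] at hyx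
        have h2 := hRn.conj_mem _ hyx y
        have h3 := (hmemR _).1 h2 y hy
        convert h3 using 1
        group
    rw [← ncard_cl, h1]
    change _ ∣ Nat.card _
    rw [QuotientGroup.card_preimage_mk]
    exact Dvd.intro _ rfl
  · intro c hbc hx g
    have hle : ∀ g : G, (g * c * g⁻¹) • cl b ⊆ cl (c * b) := by
      rintro g _ ⟨_, ⟨x, rfl⟩, rfl⟩
      obtain ⟨h, hh, k, hk, hhk⟩ := factor (Subgroup.centralizer {c}) (Subgroup.centralizer {b})
        hbc.symm (g⁻¹ * x)
      have hh' := mem_cen.1 hh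
      have hk' := mem_cen.1 hk
      refine ⟨g * h, ?_⟩
      have hx : x = g * h * k := by rw [mul_assoc, ← hhk]; group
      change g * h * (c * b) * (g * h)⁻¹ = (g * c * g⁻¹) * (x * b * x⁻¹)
      rw [hx]
      have e1 : g * h * (c * b) * (g * h)⁻¹ = g * (h * c) * b * h⁻¹ * g⁻¹ := by group
      have e2 : (g * c * g⁻¹) * (g * h * k * b * (g * h * k)⁻¹) =
        g * c * h * (k * b) * k⁻¹ * h⁻¹ * g⁻¹ := by group
      rw [e1, e2, hh', hk']; group
    have hcard : ∀ g : G, ((g * c * g⁻¹) • cl b).ncard = s b := by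
      intro g
      rw [Set.ncard_smul_set, ncard_cl]
    have hge : s b ≤ s (c * b) := by
      rw [← hcard 1, ← ncard_cl (c * b)]
      exact Set.ncard_le_ncard (hle 1) (Set.toFinite _)
    have hle' : s (c * b) ≤ s b := hmax _
    have heq : ∀ g : G, (g * c * g⁻¹) • cl b = cl (c * b) := by
      intro g
      apply Set.eq_of_subset_of_ncard_le (hle g) _ (Set.toFinite _)
      rw [hcard, ncard_cl]; exact hle'
    change c⁻¹ * (g * c * g⁻¹) ∈ MulAction.stabilizer G (cl b)
    rw [MulAction.mem_stabilizer_iff, mul_smul, heq g, ← heq 1]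
    simp

theorem central_of {R : Subgroup G} (hR : R.Normal) {c : G} (hc : (s c).Coprime (Nat.card R))
    (h : ∀ g : G, c⁻¹ * (g * c * g⁻¹) ∈ R) {m : ℕ} (hm : c ^ m = 1)
    (hmR : m.Coprime (Nat.card R)) : s c = 1 := by
  rw [s_eq_one]
  intro g
  set r := c⁻¹ * (g * c * g⁻¹) with hr
  have hrR : r ∈ R := h g
  have hcomm : Commute c r := (cent_of_coprime R c hc r hrR).symm
  have h1 : g * c * g⁻¹ = c * r := by rw [hr]; group
  have h2 : (g * c * g⁻¹) ^ m = 1 := by rw [conj_pow, hm]; group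
  rw [h1, hcomm.mul_pow, hm, one_mul] at h2
  have h3 : r ^ (Nat.card R) = 1 := by
    have : (⟨r, hrR⟩ : R) ^ (Nat.card R) = 1 := pow_card_eq_one'
    have h4 := congrArg Subtype.val this
    rwa [Subgroup.coe_pow] at h4
  have h4 := pow_gcd_eq_one.2 ⟨h2, h3⟩
  rw [hmR.gcd_eq_one, pow_one] at h4
  rw [h4, mul_one] at h1
  exact mul_inv_eq_iff_eq_mul.1 h1

theorem main (p : ℕ) (hp : p.Prime)
    (hT : ∀ g : G, (∃ k, s g = p ^ k) ∨ (s g).Coprime p)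
    (hu : ∃ u : G, s u ≠ 1 ∧ ∃ k, s u = p ^ k)
    (hv : ∃ v : G, s v ≠ 1 ∧ (s v).Coprime p) : (csSet G).ncard ≤ 3 := by
  have : Fact p.Prime := ⟨hp⟩
  obtain ⟨b, hmax⟩ := Finite.exists_max (s (G := G))
  have hb : s b ≠ 1 := by
    obtain ⟨u, hu1, -⟩ := hu
    have := hmax u
    have := s_pos u
    omega
  obtain ⟨R, hRn, hRb, hR⟩ := max_lemma b hb hmax
  obtain ⟨P⟩ : Nonempty (Sylow p G) := inferInstance
  obtain ⟨m, hPm⟩ := (IsPGroup.iff_card).1 P.2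
  rcases hT b with ⟨k, hk⟩ | hbp
  · have hgood : ∀ c : G, (s c).Coprime p → ∀ g : G, c⁻¹ * (g * c * g⁻¹) ∈ R := by
      intro c hc
      apply hR c
      · rw [hk]; exact hc.symm.pow_left k
      · intro x
        rcases hT x with ⟨j, hj⟩ | hx
        · right; rw [hj]; exact hc.symm.pow_left j
        · left; rw [hk]; exact hx.pow_right k
    obtain ⟨r, -, hr⟩ := (Nat.dvd_prime_pow hp).1 (hk ▸ hRb)
    have hRp : IsPGroup p R := IsPGroup.of_card hr
    have hRP : R ≤ P := hRp.le_sylow_of_normal P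
    have hPn : (P : Subgroup G).Normal := by
      refine ⟨fun u hu g => ?_⟩
      rcases hT u with ⟨j, hj⟩ | hup
      · have hco : (P : Subgroup G).index.Coprime (s u) := by
          rw [hj]
          exact (Nat.Coprime.pow_right j
            ((Nat.Prime.coprime_iff_not_dvd hp).2 P.not_dvd_index).symm)
        obtain ⟨x, hx, y, hy, rfl⟩ := factor (P : Subgroup G) (Subgroup.centralizer {u}) hco g
        have hy' := mem_cen.1 hy
        have : x * y * u * (x * y)⁻¹ = x * u * x⁻¹ := by
          rw [mul_assoc x y u, hy']; group
        rw [this]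
        exact mul_mem (mul_mem hx hu) (inv_mem hx)
      · have h1 := hRP (hgood u hup g)
        have h2 := mul_mem hu h1
        rwa [mul_inv_cancel_left] at h2
    have hcop : p.Coprime (P : Subgroup G).index :=
      (Nat.Prime.coprime_iff_not_dvd hp).2 P.not_dvd_index
    apply final (P : Subgroup G) P.card_coprime_index
    · intro g
      rcases hT g with ⟨j, hj⟩ | hg
      · right; rw [hj]; exact hcop.pow_left j
      · left; rw [hPm]; exact hg.pow_right m
    · intro g hg
      rcases hT g with ⟨j, hj⟩ | hgp
      · rw [hj]; exact hcop.pow_left j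
      · have : s g = 1 := by
          apply central_of hRn _ (hgood g hgp) hg
          · rw [hr]; exact (hcop.pow_left r).symm
          · rw [hr]; exact hgp.pow_right r
        rw [this]; exact Nat.coprime_one_left _
    · obtain ⟨v, hv1, hvp⟩ := hv
      exact ⟨v, hv1, by rw [hPm]; exact hvp.pow_right m⟩
  · have hgood : ∀ c : G, (∃ k, s c = p ^ k) → ∀ g : G, c⁻¹ * (g * c * g⁻¹) ∈ R := by
      rintro c ⟨k, hk⟩
      apply hR c
      · rw [hk]; exact hbp.pow_right k
      · intro x
        rcases hT x with ⟨j, hj⟩ | hx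
        · left; rw [hj]; exact hbp.symm.pow_left j
        · right; rw [hk]; exact hx.pow_right k
    have hRp : (Nat.card R).Coprime p := hbp.coprime_dvd_left hRb
    let φ : G →* G ⧸ R := QuotientGroup.mk' R
    let T : Subgroup G := (Subgroup.centralizer (φ '' (P : Set G))).comap φ
    have hTtop : T = ⊤ := by
      apply eq_top_of_conj_cover
      intro u
      rcases hT u with hup | hup
      · refine ⟨1, ?_⟩
        rw [inv_one, one_mul, mul_one, Subgroup.mem_comap, Subgroup.mem_centralizer_iff]
        rintro _ ⟨g, hg, rfl⟩
        have h1 : φ u = φ (g * u * g⁻¹) := by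
          have := hgood u hup g
          exact QuotientGroup.eq.2 this
        rw [map_mul, map_mul, map_inv] at h1
        exact (eq_mul_inv_iff_mul_eq.1 h1).symm
      · have hnd : ¬ p ∣ s u := (Nat.Prime.coprime_iff_not_dvd hp).1 hup.symm
        obtain ⟨g, hg⟩ := sylow_comm P u hnd
        refine ⟨g⁻¹, ?_⟩
        rw [inv_inv, Subgroup.mem_comap, Subgroup.mem_centralizer_iff]
        rintro _ ⟨x, hx, rfl⟩
        rw [← map_mul, hg x hx, map_mul]
    have hnc : Subgroup.normalizer (P : Set G) ≤ Subgroup.centralizer (P : Set G) := by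
      intro g hg
      rw [Subgroup.mem_centralizer_iff]
      intro x hx
      have hgT : g ∈ T := by rw [hTtop]; trivial
      rw [Subgroup.mem_comap, Subgroup.mem_centralizer_iff] at hgT
      have h1 := hgT (φ x) ⟨x, hx, rfl⟩
      have h2 : φ x = φ (g * x * g⁻¹) := by
        rw [map_mul, map_mul, map_inv, ← h1]; group
      have h3 : x⁻¹ * (g * x * g⁻¹) ∈ R := QuotientGroup.eq.1 h2
      have h4 : g * x * g⁻¹ ∈ P := (Subgroup.mem_normalizer_iff.1 hg x).1 hx
      have h5 : x⁻¹ * (g * x * g⁻¹) ∈ (P : Subgroup G) := mul_mem (inv_mem hx) h4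
      have h6 : R ⊓ (P : Subgroup G) = ⊥ := by
        apply Disjoint.eq_bot
        apply Subgroup.disjoint_of_coprime_natCard
        rw [hPm]; exact hRp.pow_right m
      have h7 : x⁻¹ * (g * x * g⁻¹) ∈ R ⊓ (P : Subgroup G) := ⟨h3, h5⟩
      rw [h6, Subgroup.mem_bot, inv_mul_eq_one] at h7
      exact eq_mul_inv_iff_mul_eq.1 h7
    let N : Subgroup G := (MonoidHom.transferSylow P hnc).ker
    have hNp : p.Coprime (Nat.card N) := (Nat.Prime.coprime_iff_not_dvd hp).2
      (MonoidHom.not_dvd_card_ker_transferSylow P hnc)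
    have hNi : N.index = p ^ m := by
      rw [(MonoidHom.ker_transferSylow_isComplement' P hnc).symm.index_eq_card, hPm]
    apply final N
    · rw [hNi]; exact (hNp.pow_left m).symm
    · intro g
      rcases hT g with ⟨j, hj⟩ | hg
      · left; rw [hj]; exact hNp.pow_left j
      · right; rw [hNi]; exact hg.pow_right m
    · intro g hg
      rcases hT g with ⟨j, hj⟩ | hgp
      · have : s g = 1 := by
          apply central_of hRn _ (hgood g ⟨j, hj⟩) hg
          · rw [hNi]; exact (hRp.pow_right m).symm
          · rw [hj]; exact (hRp.pow_right j).symm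
        rw [this]; exact Nat.coprime_one_left _
      · rw [hNi]; exact hgp.pow_right m
    · obtain ⟨u, hu1, k, hk⟩ := hu
      exact ⟨u, hu1, by rw [hk]; exact hNp.pow_left k⟩

end
end CS

/-- If a finite group with `|cs(G)| ≥ 4` has exactly two composite conjugacy class sizes,
namely `p^a` (with `p` prime and `a ≥ 2`) and `n`, then `p` divides `n`. -/
theorem stmt_8 (G : Type*) [Group G] [Finite G] (p a n : ℕ)
    (hp : p.Prime) (ha : 2 ≤ a) (hne : p ^ a ≠ n)
    (hcomp : {x ∈ csSet G | IsCompositeNat x} = {p ^ a, n})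
    (hcard : 4 ≤ (csSet G).ncard) :
    p ∣ n := by
  by_contra hpn
  have hcop : n.Coprime p := ((Nat.Prime.coprime_iff_not_dvd hp).2 hpn).symm
  have h1 : p ^ a ∈ {x ∈ csSet G | IsCompositeNat x} := by rw [hcomp]; simp
  have h2 : n ∈ {x ∈ csSet G | IsCompositeNat x} := by rw [hcomp]; simp
  obtain ⟨⟨u, hu⟩, hu1, -⟩ := h1
  obtain ⟨⟨v, hv⟩, hv1, -⟩ := h2
  have := CS.main (G := G) p hp ?_ ⟨u, ?_, a, hu.symm⟩ ⟨v, ?_, ?_⟩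
  · omega
  · intro g
    have hg0 := CS.s_pos g
    by_cases hg1 : CS.s g = 1
    · right; rw [hg1]; exact Nat.coprime_one_left _
    by_cases hgp : (CS.s g).Prime
    · by_cases h : CS.s g = p
      · left; exact ⟨1, by rw [h, pow_one]⟩
      · right; exact (Nat.coprime_primes hgp hp).2 h
    · have : CS.s g ∈ {x ∈ csSet G | IsCompositeNat x} := ⟨⟨g, rfl⟩, by omega, hgp⟩
      rw [hcomp] at this
      rcases this with h | h
      · left; exact ⟨a, h⟩
      · right; rw [h]; exact hcop
  · change (Subgroup.centralizer {u}).index ≠ 1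
    omega
  · change (Subgroup.centralizer {v}).index ≠ 1
    omega
  · change (Subgroup.centralizer {v}).index.Coprime p
    rw [← hv]; exact hcop
end

section
/- Let G be a finite group with cs(G) = {1, q, p^a, n}, where p and q are distinct primes, a ≥ 2 is an integer, and n is a composite number (so p^a and n are the only composite members of cs(G)). Then n = q·p^b for some integer b with 1 ≤ b ≤ a, and G is an internal direct product G = K × A, where K is a {p,q}-group and A is abelian. -/
/-- The centralizer of one element. -/
abbrev Cz {G : Type*} [Group G] (g : G) : Subgroup G := Subgroup.centralizer {g}

/-- `g` is an `s`-element. -/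
def Ise {G : Type*} [Group G] (s : ℕ) (g : G) : Prop := ∃ k : ℕ, g ^ (s ^ k) = 1

section basics

variable {G : Type*} [Group G]

theorem mem_Cz {g h : G} : h ∈ Cz g ↔ h * g = g * h := Subgroup.mem_centralizer_singleton_iff

theorem mem_Cz_comm {g h : G} : h ∈ Cz g ↔ g ∈ Cz h := by
  rw [mem_Cz, mem_Cz]; exact eq_comm

theorem self_mem_Cz (g : G) : g ∈ Cz g := mem_Cz.2 rfl

theorem center_le_Cz (g : G) : Subgroup.center G ≤ Cz g := fun z hz =>
  mem_Cz.2 ((Subgroup.mem_center_iff.1 hz g).symm)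

theorem Cz_mul_left {u v : G} {g : G} (h1 : g ∈ Cz u) (h2 : g ∈ Cz v) : g ∈ Cz (u * v) :=
  mem_Cz_comm.1 ((Cz g).mul_mem (mem_Cz_comm.1 h1) (mem_Cz_comm.1 h2))

theorem mem_of_coprime_pow (K : Subgroup G) {g : G} {a b : ℕ} (h : a.Coprime b)
    (ha : g ^ a ∈ K) (hb : g ^ b ∈ K) : g ∈ K := by
  have h1 : (1 : ℤ) = a * a.gcdA b + b * a.gcdB b := by
    rw [← Nat.gcd_eq_gcd_ab, h]; rfl
  have h2 : g = (g ^ a) ^ (a.gcdA b) * (g ^ b) ^ (a.gcdB b) := by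
    rw [← zpow_natCast, ← zpow_natCast, ← zpow_mul, ← zpow_mul, ← zpow_add, ← h1, zpow_one]
  rw [h2]
  exact K.mul_mem (K.zpow_mem ha _) (K.zpow_mem hb _)

theorem Ise.conj {s : ℕ} {x : G} (h : Ise s x) (g : G) : Ise s (g * x * g⁻¹) := by
  obtain ⟨k, hk⟩ := h
  exact ⟨k, by rw [conj_pow, hk]; simp⟩

theorem Ise.mul {s : ℕ} {x y : G} (hx : Ise s x) (hy : Ise s y) (h : x * y = y * x) :
    Ise s (x * y) := by
  obtain ⟨k, hk⟩ := hx
  obtain ⟨l, hl⟩ := hy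
  refine ⟨k + l, ?_⟩
  rw [Commute.mul_pow h, pow_add, pow_mul, hk, mul_comm (s ^ k), pow_mul y, hl]; simp

theorem Ise.isPGroup {s : ℕ} {x : G} (h : Ise s x) : IsPGroup s (Subgroup.zpowers x) := by
  obtain ⟨k, hk⟩ := h
  rintro ⟨y, hy⟩
  obtain ⟨i, rfl⟩ := Subgroup.mem_zpowers_iff.1 hy
  refine ⟨k, ?_⟩
  ext
  simp only [SubmonoidClass.mk_pow, OneMemClass.coe_one]
  rw [← zpow_natCast, ← zpow_mul, mul_comm, zpow_mul, zpow_natCast, hk, one_zpow]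

theorem Ise.of_mem {s : ℕ} {P : Subgroup G} (hP : IsPGroup s P) {x : G} (h : x ∈ P) : Ise s x := by
  obtain ⟨k, hk⟩ := hP ⟨x, h⟩
  refine ⟨k, ?_⟩
  simpa using congrArg Subtype.val hk

theorem conj_mem_center {x : G} (g : G) :
    g * x * g⁻¹ ∈ Subgroup.center G ↔ x ∈ Subgroup.center G := by
  constructor
  · intro h
    have := (inferInstance : (Subgroup.center G).Normal).conj_mem _ h g⁻¹
    simpa [mul_assoc] using this
  · intro h; exact (inferInstance : (Subgroup.center G).Normal).conj_mem _ h g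

theorem mem_Cz_conj {x y : G} (g : G) : y ∈ Cz x ↔ g * y * g⁻¹ ∈ Cz (g * x * g⁻¹) := by
  rw [mem_Cz, mem_Cz, conj_mul, conj_mul]
  simp

theorem Cz_conj_index (x g : G) : (Cz (g * x * g⁻¹)).index = (Cz x).index := by
  have : Cz (g * x * g⁻¹) = (Cz x).map (MulAut.conj g).toMonoidHom := by
    ext y
    rw [Subgroup.mem_map]
    constructor
    · intro h
      refine ⟨g⁻¹ * y * g, ?_, by simp [mul_assoc]⟩
      rw [mem_Cz_conj g]
      simpa [mul_assoc] using h
    · rintro ⟨z, hz, rfl⟩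
      exact (mem_Cz_conj g).1 hz
  rw [this]
  exact Subgroup.index_map_equiv _ (MulAut.conj g)

theorem Cz_inv (x : G) : Cz x⁻¹ = Cz x := by
  ext y
  rw [mem_Cz_comm, mem_Cz_comm (h := y), inv_mem_iff]

theorem Cz_index_one_iff [Finite G] {x : G} : (Cz x).index = 1 ↔ x ∈ Subgroup.center G := by
  rw [Subgroup.index_eq_one, Subgroup.mem_center_iff, Subgroup.eq_top_iff']
  exact forall_congr' fun y => mem_Cz

theorem Cz_prod {s t : ℕ} (hs : s.Prime) (ht : t.Prime) (hst : s ≠ t) {u v : G} (hu : Ise s u)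
    (hv : Ise t v) (h : v ∈ Cz u) : Cz (u * v) ≤ Cz u ∧ Cz (u * v) ≤ Cz v := by
  have h' : Commute u v := (mem_Cz.1 h).symm
  obtain ⟨k, hk⟩ := hu
  obtain ⟨l, hl⟩ := hv
  have key : Cz (u * v) ≤ Cz u := by
    intro g hg
    rw [mem_Cz_comm] at hg ⊢
    apply mem_of_coprime_pow (Cz g) (a := t ^ l) (b := s ^ k)
      (((Nat.coprime_primes ht hs).2 hst.symm).pow _ _)
    · have := (Cz g).pow_mem hg (t ^ l)
      rwa [h'.mul_pow, hl, mul_one] at this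
    · rw [hk]; exact one_mem _
  refine ⟨key, fun g hg => ?_⟩
  have h1 := key hg
  rw [mem_Cz_comm] at hg h1 ⊢
  have := (Cz g).mul_mem ((Cz g).inv_mem h1) hg
  simpa using this

theorem exists_conj_le [Finite G] {s : ℕ} (hs : s.Prime) (T H : Subgroup G) (hT : IsPGroup s T)
    (hH : ¬ s ∣ H.index) : ∃ g : G, ∀ w ∈ T, g⁻¹ * w * g ∈ H := by
  haveI := Fact.mk hs
  obtain ⟨c, hc⟩ := hT.nonempty_fixed_point_of_prime_not_dvd_card (G ⧸ H) hH
  obtain ⟨g, rfl⟩ := QuotientGroup.mk_surjective c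
  refine ⟨g, fun w hw => ?_⟩
  have := hc ⟨w, hw⟩
  have h2 : (QuotientGroup.mk (w * g) : G ⧸ H) = QuotientGroup.mk g := this
  have h3 := QuotientGroup.eq.1 h2.symm
  simpa [mul_assoc] using h3

theorem exists_conj_mem [Finite G] {s : ℕ} (hs : s.Prime) {y w : G} (hw : Ise s w)
    (hy : ¬ s ∣ (Cz y).index) : ∃ g : G, w ∈ Cz (g * y * g⁻¹) := by
  obtain ⟨g, hg⟩ := exists_conj_le hs _ _ hw.isPGroup hy
  refine ⟨g, ?_⟩
  have := (mem_Cz_conj g).1 (hg w (Subgroup.mem_zpowers w))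
  simpa [mul_assoc] using this

theorem union_conj [Finite G] (H : Subgroup G) (h : ∀ g : G, ∃ k : G, k⁻¹ * g * k ∈ H) :
    H = ⊤ := by
  let f : (G ⧸ H) × H → G := fun c => c.1.out * c.2 * c.1.out⁻¹
  have hf : Function.Surjective f := by
    intro g
    obtain ⟨k, hk⟩ := h g
    have h1 : (QuotientGroup.mk k : G ⧸ H) = QuotientGroup.mk ((QuotientGroup.mk k : G ⧸ H).out) :=
      (QuotientGroup.out_eq' _).symm
    have h2 := QuotientGroup.eq.1 h1
    set o := (QuotientGroup.mk k : G ⧸ H).out with ho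
    refine ⟨(QuotientGroup.mk k, ⟨(k⁻¹ * o)⁻¹ * (k⁻¹ * g * k) * (k⁻¹ * o),
      H.mul_mem (H.mul_mem (H.inv_mem h2) hk) h2⟩), ?_⟩
    simp only [f, ← ho]
    group
  have hc : Nat.card ((G ⧸ H) × H) = Nat.card G := by
    rw [Nat.card_prod, mul_comm]
    exact Subgroup.card_mul_index H
  have hb : Function.Bijective f := by
    rw [Nat.bijective_iff_surjective_and_card]
    exact ⟨hf, hc⟩
  have hsub : Subsingleton (G ⧸ H) := by
    refine ⟨fun c d => ?_⟩
    have : f (c, 1) = f (d, 1) := by simp [f]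
    exact congrArg Prod.fst (hb.1 this)
  exact QuotientGroup.subgroup_eq_top_of_subsingleton H hsub

/-- For a prime dividing the order modulo the centre, there is a noncentral primary part. -/
theorem exists_part [Finite G] {t : ℕ} (ht : t.Prime) (g : G)
    (h : t ∣ orderOf (QuotientGroup.mk g : G ⧸ Subgroup.center G)) :
    ∃ k : ℕ, ¬ t ∣ k ∧ Ise t (g ^ k) ∧ g ^ k ∉ Subgroup.center G := by
  obtain ⟨j, m, hm, hjm⟩ := Nat.exists_eq_pow_mul_and_not_dvd (orderOf_pos g).ne' t ht.ne_one
  refine ⟨m, hm, ⟨j, ?_⟩, ?_⟩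
  · rw [← pow_mul, mul_comm, ← hjm, pow_orderOf_eq_one]
  · intro hc
    apply hm
    refine h.trans (orderOf_dvd_of_pow_eq_one ?_)
    rw [← QuotientGroup.mk_pow]
    exact (QuotientGroup.eq_one_iff _).2 hc

theorem exists_part' [Finite G] (g : G) (h : g ∉ Subgroup.center G) :
    ∃ t k : ℕ, t.Prime ∧ Ise t (g ^ k) ∧ g ^ k ∉ Subgroup.center G := by
  have h1 : orderOf (QuotientGroup.mk g : G ⧸ Subgroup.center G) ≠ 1 := by
    rw [Ne, orderOf_eq_one_iff]
    intro h2
    exact h ((QuotientGroup.eq_one_iff _).1 h2)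
  obtain ⟨t, ht, htd⟩ := Nat.exists_prime_and_dvd h1
  obtain ⟨k, _, hk1, hk2⟩ := exists_part ht g htd
  exact ⟨t, k, ht, hk1, hk2⟩

theorem Cz_le_pow (g : G) (k : ℕ) : Cz g ≤ Cz (g ^ k) := fun h hh =>
  mem_Cz_comm.1 ((Cz h).pow_mem (mem_Cz_comm.1 hh) k)

/-- The valuation lemma. -/
theorem exists_noncentral [Finite G] {t : ℕ} (ht : t.Prime) {H : Subgroup G}
    (hZ : Subgroup.center G ≤ H) (h : H.index * t ∣ (Subgroup.center G).index) :
    ∃ w ∈ H, Ise t w ∧ w ∉ Subgroup.center G := by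
  haveI := Fact.mk ht
  rw [← Subgroup.relIndex_mul_index hZ, mul_comm] at h
  have h1 : t ∣ (Subgroup.center G).relIndex H :=
    Nat.dvd_of_mul_dvd_mul_right (Nat.pos_of_ne_zero Subgroup.FiniteIndex.index_ne_zero) h
  have h2 : t ∣ Nat.card (H ⧸ (Subgroup.center G).subgroupOf H) := h1
  obtain ⟨c, hc⟩ := exists_prime_orderOf_dvd_card' t h2
  obtain ⟨g, rfl⟩ := QuotientGroup.mk_surjective c
  have h3 : t ∣ orderOf (QuotientGroup.mk (g : G) : G ⧸ Subgroup.center G) := by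
    rw [← hc]
    apply orderOf_dvd_of_pow_eq_one
    rw [← QuotientGroup.mk_pow]
    rw [QuotientGroup.eq_one_iff, Subgroup.mem_subgroupOf]
    have := pow_orderOf_eq_one (QuotientGroup.mk (g : G) : G ⧸ Subgroup.center G)
    rw [← QuotientGroup.mk_pow, QuotientGroup.eq_one_iff] at this
    simpa using this
  obtain ⟨k, _, h4, h5⟩ := exists_part ht _ h3
  exact ⟨_, H.pow_mem g.2 k, h4, h5⟩

theorem dvd_of_noncentral [Finite G] {t : ℕ} (ht : t.Prime) {H : Subgroup G}
    (hZ : Subgroup.center G ≤ H) {w : G} (hw : w ∈ H) (hw1 : Ise t w)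
    (hw2 : w ∉ Subgroup.center G) : H.index * t ∣ (Subgroup.center G).index := by
  rw [← Subgroup.relIndex_mul_index hZ, mul_comm]
  apply Nat.mul_dvd_mul_right
  obtain ⟨k, hk⟩ := hw1
  let c : H ⧸ (Subgroup.center G).subgroupOf H := QuotientGroup.mk ⟨w, hw⟩
  have h1 : orderOf c ∣ Nat.card (H ⧸ (Subgroup.center G).subgroupOf H) := orderOf_dvd_natCard c
  have h2 : orderOf c ∣ t ^ k := by
    apply orderOf_dvd_of_pow_eq_one
    have : (⟨w, hw⟩ : H) ^ t ^ k = 1 := by ext; simpa using hk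
    rw [← QuotientGroup.mk_pow, this]; rfl
  have h3 : orderOf c ≠ 1 := by
    rw [Ne, orderOf_eq_one_iff]
    intro h
    apply hw2
    have := (QuotientGroup.eq_one_iff _).1 h
    exact Subgroup.mem_subgroupOf.1 this
  obtain ⟨i, hi, hi2⟩ := (Nat.dvd_prime_pow ht).1 h2
  have h4 : t ∣ orderOf c := by
    rw [hi2]
    apply dvd_pow_self
    rintro rfl
    exact h3 (by rw [hi2]; rfl)
  exact h4.trans h1

theorem index_dvd [Finite G] (x : G) : (Cz x).index ∣ (Subgroup.center G).index :=
  Subgroup.index_dvd_of_le (center_le_Cz x)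

theorem eq_of_le_index [Finite G] {H K : Subgroup G} (h : H ≤ K) (h2 : H.index = K.index) :
    H = K := by
  by_contra hne
  have := Subgroup.index_strictAnti (lt_of_le_of_ne h hne)
  omega

/-- Union argument. -/
theorem union_lemma [Finite G] {s : ℕ} (hs : s.Prime) {x : G} (hx : x ∉ Subgroup.center G)
    (h1 : ∀ t : ℕ, t.Prime → t ≠ s → ∀ w : G, Ise t w → w ∉ Subgroup.center G →
      ∃ g : G, Cz w ≤ Cz (g * x * g⁻¹))
    (h2 : ∀ u : G, Ise s u → u ∉ Subgroup.center G → ∃ t : ℕ, t.Prime ∧ t ≠ s ∧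
      ∃ w ∈ Cz u, Ise t w ∧ w ∉ Subgroup.center G) : False := by
  apply hx
  rw [← Cz_index_one_iff, Subgroup.index_eq_one]
  apply union_conj
  have key : ∀ v : G, (∃ g, v ∈ Cz (g * x * g⁻¹)) → ∃ k : G, k⁻¹ * v * k ∈ Cz x := by
    rintro v ⟨g, hg⟩
    refine ⟨g, ?_⟩
    rw [mem_Cz_conj g]
    simpa [mul_assoc] using hg
  intro v
  apply key
  by_cases hv : v ∈ Subgroup.center G
  · exact ⟨1, center_le_Cz _ hv⟩
  by_cases hpr : ∃ t : ℕ, t.Prime ∧ t ≠ s ∧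
      t ∣ orderOf (QuotientGroup.mk v : G ⧸ Subgroup.center G)
  · obtain ⟨t, ht, hts, htd⟩ := hpr
    obtain ⟨k, _, hk1, hk2⟩ := exists_part ht v htd
    obtain ⟨g, hg⟩ := h1 t ht hts _ hk1 hk2
    exact ⟨g, hg (mem_Cz_comm.1 (Cz_le_pow v k (self_mem_Cz v) |> mem_Cz_comm.1))⟩
  · push Not at hpr
    set o := orderOf (QuotientGroup.mk v : G ⧸ Subgroup.center G) with ho
    have ho0 : o ≠ 0 := (orderOf_pos _).ne'
    have ho1 : o ≠ 1 := by
      rw [Ne, ho, orderOf_eq_one_iff]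
      intro h2
      exact hv ((QuotientGroup.eq_one_iff _).1 h2)
    have hpp : o = s ^ o.primeFactorsList.length :=
      Nat.eq_prime_pow_of_unique_prime_dvd ho0 (fun {d} hd hdo => by
        by_contra hne
        exact hpr d hd hne hdo)
    have hso : s ∣ o := by
      obtain ⟨t, ht, htd⟩ := Nat.exists_prime_and_dvd ho1
      by_cases hts : t = s
      · rwa [← hts]
      · exact absurd htd (hpr t ht hts)
    obtain ⟨k, hk0, hk1, hk2⟩ := exists_part hs v hso
    obtain ⟨t, ht, hts, w, hw, hwt, hwc⟩ := h2 _ hk1 hk2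
    obtain ⟨g, hg⟩ := h1 t ht hts w hwt hwc
    refine ⟨g, hg ?_⟩
    have hvo : v ^ o ∈ Subgroup.center G := by
      have := pow_orderOf_eq_one (QuotientGroup.mk v : G ⧸ Subgroup.center G)
      rwa [← QuotientGroup.mk_pow, QuotientGroup.eq_one_iff] at this
    apply mem_of_coprime_pow (Cz w) (a := o) (b := k) _ (center_le_Cz _ hvo) (mem_Cz_comm.1 hw)
    rw [hpp]
    exact Nat.Coprime.pow_left _ ((Nat.Prime.coprime_iff_not_dvd hs).2 hk0)

end basics


section lemS

variable {G : Type*} [Group G]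

theorem exists_mul_of_coprime [Finite G] {H K : Subgroup G} (h : H.index.Coprime K.index) (g : G) :
    ∃ k ∈ K, ∃ l ∈ H, g = k * l := by
  have h1 : (H ⊓ K).index = H.index * K.index := by
    apply le_antisymm (Subgroup.index_inf_le)
    exact Nat.le_of_dvd (Nat.pos_of_ne_zero Subgroup.FiniteIndex.index_ne_zero)
      (h.mul_dvd_of_dvd_of_dvd (Subgroup.index_dvd_of_le inf_le_left)
        (Subgroup.index_dvd_of_le inf_le_right))
  have h2 : H.relIndex K = H.index := by
    have h3 := Subgroup.relIndex_mul_index (inf_le_right : H ⊓ K ≤ K)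
    rw [Subgroup.inf_relIndex_right, h1] at h3
    exact Nat.eq_of_mul_eq_mul_right (Nat.pos_of_ne_zero Subgroup.FiniteIndex.index_ne_zero) h3
  have h4 : MulAction.stabilizer K ((1 : G) : G ⧸ H) = H.subgroupOf K := by
    ext ⟨k, hk⟩
    rw [MulAction.mem_stabilizer_iff, Subgroup.mem_subgroupOf]
    have : (⟨k, hk⟩ : K) • ((1 : G) : G ⧸ H) = ((k * 1 : G) : G ⧸ H) := rfl
    rw [this, eq_comm, QuotientGroup.eq]
    simp
  have h5 : (MulAction.orbit K ((1 : G) : G ⧸ H)).ncard = Nat.card (G ⧸ H) := by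
    rw [← MulAction.index_stabilizer, h4]
    exact h2
  have h6 : MulAction.orbit K ((1 : G) : G ⧸ H) = Set.univ := by
    rw [Set.eq_univ_iff_ncard]; exact h5
  have h7 : (g : G ⧸ H) ∈ MulAction.orbit K ((1 : G) : G ⧸ H) := by rw [h6]; trivial
  obtain ⟨⟨k, hk⟩, hk2⟩ := h7
  have h8 : ((k * 1 : G) : G ⧸ H) = (g : G ⧸ H) := hk2
  rw [QuotientGroup.eq] at h8
  exact ⟨k, hk, k⁻¹ * g, by simpa using h8, by group⟩

theorem conj_mul_conj [Finite G] {a b : G} (h : (Cz a).index.Coprime (Cz b).index) (k l : G) :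
    ∃ g : G, g * (a * b) * g⁻¹ = (k * a * k⁻¹) * (l * b * l⁻¹) := by
  obtain ⟨d, hd, c, hc, e⟩ := exists_mul_of_coprime h (l⁻¹ * k)
  refine ⟨l * d, ?_⟩
  have e2 : l * d = k * c⁻¹ := by
    rw [eq_mul_inv_iff_mul_eq, mul_assoc, ← e]; group
  rw [mem_Cz] at hc hd
  have e3 : (l * d) * a * (l * d)⁻¹ = k * a * k⁻¹ := by
    rw [e2]
    have : c⁻¹ * a * c = a := by rw [mul_assoc, ← hc]; group
    calc _ = k * (c⁻¹ * a * c) * k⁻¹ := by group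
      _ = _ := by rw [this]
  have e4 : (l * d) * b * (l * d)⁻¹ = l * b * l⁻¹ := by
    calc _ = l * (d * b) * d⁻¹ * l⁻¹ := by group
      _ = _ := by rw [hd]; group
  rw [← e3, ← e4]; group

theorem card_conj [Finite G] (x : G) :
    Nat.card {z : G // ∃ g : G, g * x * g⁻¹ = z} = (Cz x).index := by
  have h1 : (MulAction.stabilizer (ConjAct G) x).index = (Cz x).index := by
    have e1 := Subgroup.nat_card_centralizer_nat_card_stabilizer x
    have e2 := Subgroup.card_mul_index (MulAction.stabilizer (ConjAct G) x)
    have e3 := Subgroup.card_mul_index (Cz x)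
    have e4 : Nat.card (ConjAct G) = Nat.card G := rfl
    rw [← e1, e4, ← e3] at e2
    exact Nat.eq_of_mul_eq_mul_left Nat.card_pos e2
  rw [← h1, MulAction.index_stabilizer]
  rfl

theorem no_shift [Finite G] {s : ℕ} (hs : s.Prime) {x m : G} (hm : Ise s m) (hm1 : m ≠ 1)
    (hx : ¬ s ∣ (Cz x).index)
    (h : ∀ g : G, ∃ k : G, k * x * k⁻¹ = m * (g * x * g⁻¹)) : False := by
  haveI := Fact.mk hs
  have hpow : ∀ (i : ℕ) (z : G), (∃ g : G, g * x * g⁻¹ = z) → ∃ g : G, g * x * g⁻¹ = m ^ i * z := by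
    intro i
    induction i with
    | zero => intro z hz; simpa using hz
    | succ i ih =>
      rintro z ⟨g, rfl⟩
      obtain ⟨k, hk⟩ := h g
      have := ih _ ⟨k, hk⟩
      rwa [← mul_assoc, ← pow_succ] at this
  let X : SubMulAction (Subgroup.zpowers m) G :=
    { carrier := {z | ∃ g : G, g * x * g⁻¹ = z}
      smul_mem' := by
        rintro ⟨c, hc⟩ z hz
        obtain ⟨i, rfl⟩ := mem_powers_iff_mem_zpowers.2 hc
        exact hpow i z hz }
  have hX : Nat.card X = (Cz x).index := card_conj x
  obtain ⟨⟨z, hz⟩, hz2⟩ := hm.isPGroup.nonempty_fixed_point_of_prime_not_dvd_card X (by rwa [hX])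
  have h3 := hz2 ⟨m, Subgroup.mem_zpowers m⟩
  have h4 : m * z = z := congrArg Subtype.val h3
  exact hm1 (by simpa using h4)

theorem exists_sylow_le [Finite G] {s : ℕ} (hs : s.Prime) {u : G} (hu : ¬ s ∣ (Cz u).index) :
    ∃ P : Sylow s G, (P : Subgroup G) ≤ Cz u := by
  haveI := Fact.mk hs
  obtain ⟨P0⟩ : Nonempty (Sylow s G) := inferInstance
  obtain ⟨g, hg⟩ := exists_conj_le hs P0 (Cz u) P0.2 hu
  refine ⟨g⁻¹ • P0, ?_⟩
  intro w hw
  rw [Sylow.coe_subgroup_smul, Subgroup.mem_pointwise_smul_iff_inv_smul_mem] at hw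
  have := hg _ hw
  simpa [MulAut.smul_def, mul_assoc] using this

theorem mem_sylow_of_pow [Finite G] {s : ℕ} (hs : s.Prime) {y : G} (hy : Ise s y) {j : ℕ}
    (hj : (Cz y).index = s ^ j) (P : Sylow s G) : y ∈ P := by
  haveI := Fact.mk hs
  obtain ⟨P1, hP1⟩ := hy.isPGroup.exists_le_sylow
  have hy1 : y ∈ P1 := hP1 (Subgroup.mem_zpowers y)
  obtain ⟨g, rfl⟩ := MulAction.exists_smul_eq G P1 P
  have hco : (P1 : Subgroup G).index.Coprime (Cz y).index := by
    rw [hj]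
    exact (Nat.Coprime.pow_left _ ((Nat.Prime.coprime_iff_not_dvd hs).2 P1.not_dvd_index)).symm
  obtain ⟨k, hk, l, hl, e⟩ := exists_mul_of_coprime hco g
  show y ∈ ((g • P1 : Sylow s G) : Subgroup G)
  rw [Sylow.coe_subgroup_smul, Subgroup.mem_pointwise_smul_iff_inv_smul_mem]
  have : (MulAut.conj g)⁻¹ • y = l⁻¹ * y * l := by
    rw [e]
    simp only [MulAut.smul_def, MulAut.conj_inv_apply]
    rw [mem_Cz] at hk
    calc _ = l⁻¹ * k⁻¹ * (y * k) * l := by group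
      _ = _ := by rw [← hk]; group
  rw [this]
  exact mul_mem (mul_mem (inv_mem hl) hy1) hl

theorem lemS [Finite G] {s t : ℕ} (hs : s.Prime) (ht : t.Prime) (hst : s ≠ t)
    (h1 : ∀ l : ℕ, l.Prime → l ∣ (Subgroup.center G).index → l = s ∨ l = t)
    (h2 : ∀ u : G, Ise s u → (∃ j, (Cz u).index = s ^ j) ∨ ((∃ j, (Cz u).index = t ^ j) ∧
      ∀ l : ℕ, l.Prime → l ≠ s → ¬ (Cz u).index * l ∣ (Subgroup.center G).index))
    (x : G) (hx : Ise s x) (hxc : x ∉ Subgroup.center G) (hxt : ∃ j, (Cz x).index = t ^ j)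
    (y : G) (hy : Ise s y) (hyc : y ∉ Subgroup.center G) (hys : ∃ j, (Cz y).index = s ^ j) :
    False := by
  haveI := Fact.mk hs
  haveI := Fact.mk ht
  have hndt : ∀ j : ℕ, ¬ s ∣ t ^ j := fun j h =>
    hst ((Nat.prime_dvd_prime_iff_eq hs ht).1 (hs.dvd_of_dvd_pow h))
  have hnds : ∀ j : ℕ, ¬ t ∣ s ^ j := fun j h =>
    hst ((Nat.prime_dvd_prime_iff_eq ht hs).1 (ht.dvd_of_dvd_pow h)).symm
  have hcop : ∀ i j : ℕ, (s ^ i).Coprime (t ^ j) := fun i j =>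
    ((Nat.coprime_primes hs ht).2 hst).pow _ _
  -- an element is either of `s`-power class, or special
  have hone : ∀ u : G, u ∉ Subgroup.center G → (∃ j, (Cz u).index = s ^ j) →
      (∃ j, (Cz u).index = t ^ j) → False := by
    rintro u hu ⟨i, hi⟩ ⟨j, hj⟩
    apply hu
    rw [← Cz_index_one_iff]
    have := hcop i j
    rw [← hi, ← hj] at this
    simpa using this
  -- S1
  have S1 : ∀ u : G, Ise s u → u ∉ Subgroup.center G → (∃ j, (Cz u).index = t ^ j) →
      ∃ P : Sylow s G, (P : Subgroup G) ≤ Cz u ∧ ∀ v : G, Ise s v → v ∈ Cz u → v ∈ P := by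
    intro u hu huc hut
    have hsp : ∀ l : ℕ, l.Prime → l ≠ s → ¬ (Cz u).index * l ∣ (Subgroup.center G).index := by
      rcases h2 u hu with h | h
      · exact (hone u huc h hut).elim
      · exact h.2
    obtain ⟨j, hj⟩ := hut
    obtain ⟨P, hP⟩ := exists_sylow_le hs (u := u) (by rw [hj]; exact hndt j)
    refine ⟨P, hP, ?_⟩
    have hK : (P : Subgroup G) ⊔ Subgroup.center G ≤ Cz u := sup_le hP (center_le_Cz u)
    have hKe : (P : Subgroup G) ⊔ Subgroup.center G = Cz u := by
      apply eq_of_le_index hK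
      obtain ⟨k, hk⟩ := Subgroup.index_dvd_of_le hK
      by_cases hk1 : k = 1
      · rw [hk, hk1, mul_one]
      obtain ⟨l, hl, hlk⟩ := Nat.exists_prime_and_dvd hk1
      exfalso
      by_cases hls : l = s
      · subst hls
        exact P.not_dvd_index ((hlk.trans (Dvd.intro_left _ hk.symm)).trans
          (Subgroup.index_dvd_of_le le_sup_left))
      · apply hsp l hl hls
        refine (Nat.mul_dvd_mul_left _ hlk).trans ?_
        rw [← hk]
        exact Subgroup.index_dvd_of_le le_sup_right
    intro v hv hvu
    rw [← hKe] at hvu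
    have hn : (P : Subgroup G) ⊔ Subgroup.center G ≤ Subgroup.normalizer (P : Subgroup G) :=
      sup_le Subgroup.le_normalizer (Subgroup.center_le_normalizer _)
    have h4 := hv.isPGroup.inf_normalizer_sylow P
    have h5 : v ∈ Subgroup.zpowers v ⊓ (P : Subgroup G) := by
      rw [← h4]; exact ⟨Subgroup.mem_zpowers v, hn hvu⟩
    exact h5.2
  have hspow : ∀ u : G, Ise s u → (∃ j, (Cz u).index = s ^ j) → ∀ P : Sylow s G, u ∈ P :=
    fun u hu ⟨j, hj⟩ P => mem_sylow_of_pow hs hu hj P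
  -- S3
  have S4 : ∀ u : G, Ise s u → ∀ P : Sylow s G, u ∈ P := by
    intro u hu
    rcases h2 u hu with h | ⟨hut, -⟩
    · exact hspow u hu h
    by_cases huc : u ∈ Subgroup.center G
    · exact hspow u hu ⟨0, by rw [Cz_index_one_iff.2 huc]; rfl⟩
    obtain ⟨P1, hP1, -⟩ := S1 u hu huc hut
    have hyu : y ∈ Cz u := hP1 (hspow y hy hys P1)
    have hyue : Ise s (y * u) := hy.mul hu (mem_Cz.1 hyu)
    rcases h2 _ hyue with h | ⟨⟨i, hi⟩, -⟩
    · intro P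
      have e1 := hspow _ hyue h P
      have e2 := hspow y hy hys P
      have := mul_mem (inv_mem e2) e1
      simpa using this
    · exfalso
      obtain ⟨g, hg⟩ : ∃ g : G, g * y * g⁻¹ ≠ y := by
        by_contra hcon
        push Not at hcon
        apply hyc
        rw [Subgroup.mem_center_iff]
        intro g
        exact mul_inv_eq_iff_eq_mul.1 (hcon g)
      obtain ⟨jy, hjy⟩ := hys
      obtain ⟨ju, hju⟩ := hut
      have hm : Ise s (y⁻¹ * (g * y * g⁻¹)) := by
        refine Ise.of_mem P1.2 (x := y⁻¹ * (g * y * g⁻¹)) ?_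
        refine mul_mem (inv_mem (hspow y hy ⟨jy, hjy⟩ P1)) (hspow _ (hy.conj g) ⟨jy, ?_⟩ P1)
        rw [Cz_conj_index, hjy]
      refine no_shift hs hm (x := u) ?_ (by rw [hju]; exact hndt _) ?_
      · intro h
        exact hg (inv_mul_eq_one.1 h).symm
      · intro k
        obtain ⟨a, ha⟩ := conj_mul_conj (a := y) (b := u) (by rw [hjy, hju]; exact hcop _ _) g k
        obtain ⟨b, hb⟩ := conj_mul_conj (a := y⁻¹) (b := y * u)
          (by rw [Cz_inv, hjy, hi]; exact hcop _ _) 1 a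
        refine ⟨b, ?_⟩
        rw [ha] at hb
        simp only [inv_mul_cancel_left] at hb
        rw [hb]; group
  obtain ⟨P⟩ : Nonempty (Sylow s G) := inferInstance
  obtain ⟨T⟩ : Nonempty (Sylow t G) := inferInstance
  have hPN : (P : Subgroup G).Normal := ⟨fun v hv g => S4 _ ((Ise.of_mem P.2 hv).conj g) P⟩
  have S5 : ∀ u : G, Ise s u → u ∉ Subgroup.center G → (∃ j, (Cz u).index = t ^ j) →
      (P : Subgroup G) ≤ Cz u := by
    intro u hu huc hut
    obtain ⟨P1, hP1, -⟩ := S1 u hu huc hut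
    exact fun v hv => hP1 (S4 v (Ise.of_mem P.2 hv) P1)
  have hPT : (P : Subgroup G) ⊔ Subgroup.normalizer (T : Subgroup G) = ⊤ := by
    rw [← Subgroup.index_eq_one]
    by_contra hne
    obtain ⟨l, hl, hld⟩ := Nat.exists_prime_and_dvd hne
    rcases h1 l hl (hld.trans (Subgroup.index_dvd_of_le
      (le_sup_of_le_right (Subgroup.center_le_normalizer _)))) with rfl | rfl
    · exact P.not_dvd_index (hld.trans (Subgroup.index_dvd_of_le le_sup_left))
    · exact T.not_dvd_index (hld.trans (Subgroup.index_dvd_of_le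
        (le_sup_of_le_right Subgroup.le_normalizer)))
  have S6 : ∀ u : G, (∃ j, (Cz u).index = s ^ j) → ∃ σ ∈ P, ∀ τ ∈ T, σ * τ * σ⁻¹ ∈ Cz u := by
    rintro u ⟨j, hj⟩
    obtain ⟨g, hg⟩ := exists_conj_le ht T (Cz u) T.2 (by rw [hj]; exact hnds j)
    have hgm : g⁻¹ ∈ (P : Subgroup G) ⊔ Subgroup.normalizer (T : Subgroup G) := by
      rw [hPT]; trivial
    obtain ⟨σ, hσ, ν, hν, e⟩ := Subgroup.mem_sup_of_normal_left.1 hgm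
    refine ⟨σ, hσ, fun τ hτ => ?_⟩
    have h3 : ν⁻¹ * τ * ν ∈ (T : Subgroup G) := by
      have := (Subgroup.mem_normalizer_iff.1 (inv_mem hν) τ).1 hτ
      simpa using this
    have h4 := hg _ h3
    have e2 : g = ν⁻¹ * σ⁻¹ := by rw [← mul_inv_rev, e, inv_inv]
    rw [← e, e2] at h4
    have e3 : σ * τ * σ⁻¹ = σ * ν * (ν⁻¹ * τ * ν) * (ν⁻¹ * σ⁻¹) := by group
    rw [e3]; exact h4
  let A : Subgroup G := P ⊓ Subgroup.centralizer ((P : Subgroup G) : Set G)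
  let B : Subgroup G := P ⊓ Subgroup.centralizer ((T : Subgroup G) : Set G)
  have hcen : ∀ u ∈ P, u ∈ Subgroup.center G → u ∈ A := by
    intro u hu huc
    exact Subgroup.mem_inf.2 ⟨hu, Subgroup.mem_centralizer_iff.2
      fun g _ => Subgroup.mem_center_iff.1 huc g⟩
  have hA : ∀ u ∈ P, (u ∈ A) ∨ (∃ j, (Cz u).index = s ^ j) := by
    intro u hu
    rcases h2 u (Ise.of_mem P.2 hu) with h | ⟨h, -⟩
    · exact Or.inr h
    left
    by_cases huc : u ∈ Subgroup.center G
    · exact hcen u hu huc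
    · exact Subgroup.mem_inf.2 ⟨hu, Subgroup.mem_centralizer_iff.2
        fun g hg => mem_Cz.1 (S5 u (Ise.of_mem P.2 hu) huc h hg)⟩
  have hPAB : ∀ u ∈ P, ∃ z ∈ A, ∃ f ∈ B, u = z * f := by
    have hAB : (A ⊔ B).subgroupOf P = ⊤ := by
      apply union_conj
      rintro ⟨u, hu⟩
      rcases hA u hu with h | h
      · refine ⟨1, ?_⟩
        rw [Subgroup.mem_subgroupOf]
        simpa using (Subgroup.mem_sup_left h : u ∈ A ⊔ B)
      · obtain ⟨σ, hσ, hτ⟩ := S6 u h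
        refine ⟨⟨σ, hσ⟩, ?_⟩
        rw [Subgroup.mem_subgroupOf]
        apply Subgroup.mem_sup_right
        have hm : σ⁻¹ * u * σ ∈ (P : Subgroup G) := mul_mem (mul_mem (inv_mem hσ) hu) hσ
        refine Subgroup.mem_inf.2 ⟨hm, Subgroup.mem_centralizer_iff.2 fun τ hτT => ?_⟩
        have h3 := hτ τ hτT
        rw [mem_Cz_conj σ⁻¹, mem_Cz] at h3
        simpa [mul_assoc] using h3
    intro u hu
    have h3 : u ∈ A ⊔ B := by
      have : (⟨u, hu⟩ : (P : Subgroup G)) ∈ (A ⊔ B).subgroupOf P := by rw [hAB]; trivial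
      exact Subgroup.mem_subgroupOf.1 this
    have hAN : A.Normal := by
      haveI := hPN
      exact Subgroup.normal_inf_normal _ _
    obtain ⟨z, hz, f, hf, e⟩ := Subgroup.mem_sup_of_normal_left.1 h3
    exact ⟨z, hz, f, hf, e.symm⟩
  -- `y` is not in `A`
  have hyA : y ∉ A := by
    intro h
    obtain ⟨j, hj⟩ := hys
    have h3 : (P : Subgroup G) ≤ Cz y := fun g hg => mem_Cz.2 (Subgroup.mem_centralizer_iff.1 h.2 g hg)
    have h4 := Subgroup.index_dvd_of_le h3
    rw [hj] at h4
    rcases Nat.eq_zero_or_pos j with rfl | hj0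
    · exact hyc (Cz_index_one_iff.1 (by rw [hj]; rfl))
    · exact P.not_dvd_index ((dvd_pow_self s hj0.ne').trans h4)
  obtain ⟨z0, hz0, y1, hy1, e1⟩ := hPAB y (S4 y hy P)
  have hy1A : y1 ∉ A := fun h => hyA (by rw [e1]; exact mul_mem hz0 h)
  have hxA : x ∈ A := by
    exact Subgroup.mem_inf.2 ⟨S4 x hx P, Subgroup.mem_centralizer_iff.2
      fun g hg => mem_Cz.1 (S5 x hx hxc hxt hg)⟩
  have hyx : y1 * x ∉ A := fun h => hy1A (by simpa using mul_mem h (inv_mem hxA))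
  have hyxP : y1 * x ∈ P := mul_mem hy1.1 hxA.1
  obtain ⟨σ, hσ, hτ⟩ := S6 _ ((hA _ hyxP).resolve_left hyx)
  obtain ⟨z, hz, f, hf, e⟩ := hPAB σ hσ
  have hTx : (T : Subgroup G) ≤ Cz x := by
    intro τ hτT
    have h3 := hτ τ hτT
    have h4 : σ * τ * σ⁻¹ = z * τ * z⁻¹ := by
      have := Subgroup.mem_centralizer_iff.1 hf.2 τ hτT
      rw [e]
      calc _ = z * (f * τ) * f⁻¹ * z⁻¹ := by group
        _ = _ := by rw [← this]; group
    rw [h4] at h3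
    have hzy : z ∈ Cz y1 := mem_Cz.2 (Subgroup.mem_centralizer_iff.1 hz.2 y1 hy1.1).symm
    have hzx : z ∈ Cz x := mem_Cz.2 (Subgroup.mem_centralizer_iff.1 hz.2 x hxA.1).symm
    have hτy : τ ∈ Cz y1 := mem_Cz.2 (Subgroup.mem_centralizer_iff.1 hy1.2 τ hτT)
    have h5 : z * τ * z⁻¹ ∈ Cz y1 := mul_mem (mul_mem hzy hτy) (inv_mem hzy)
    rw [mem_Cz_comm] at h3 h5
    have h6 := mul_mem (inv_mem h5) h3
    rw [inv_mul_cancel_left, mem_Cz_comm] at h6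
    have h7 := mul_mem (mul_mem (inv_mem hzx) h6) hzx
    simpa [mul_assoc] using h7
  obtain ⟨j, hj⟩ := hxt
  have h4 := Subgroup.index_dvd_of_le hTx
  rw [hj] at h4
  rcases Nat.eq_zero_or_pos j with rfl | hj0
  · exact hxc (Cz_index_one_iff.1 (by rw [hj]; rfl))
  · exact T.not_dvd_index ((dvd_pow_self t hj0.ne').trans h4)

end lemS


section main

/-- The hypotheses of the theorem together with the negation of the first conclusion. -/
structure Hyp (G : Type*) [Group G] (p q a n : ℕ) : Prop where
  hp : p.Prime
  hq : q.Prime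
  hpq : p ≠ q
  ha : 2 ≤ a
  hn1 : 1 < n
  hnp : ¬ n.Prime
  hne : n ≠ p ^ a
  vals : ∀ g : G, (Cz g).index = 1 ∨ (Cz g).index = q ∨ (Cz g).index = p ^ a ∨ (Cz g).index = n
  exq : ∃ g : G, (Cz g).index = q
  exp : ∃ g : G, (Cz g).index = p ^ a
  exn : ∃ g : G, (Cz g).index = n
  bad : ∀ b : ℕ, 1 ≤ b → b ≤ a → n ≠ q * p ^ b

variable {G : Type*} [Group G]

def EX (q s : ℕ) (x : G) : Prop := Ise s x ∧ (Cz x).index = q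
def EY (p s : ℕ) (y : G) : Prop := Ise s y ∧ ∃ e, 1 ≤ e ∧ (Cz y).index = p ^ e
def NC (t : ℕ) (w : G) : Prop := Ise t w ∧ w ∉ Subgroup.center G

theorem EX.conj {q s : ℕ} {x : G} (h : EX q s x) (g : G) : EX q s (g * x * g⁻¹) :=
  ⟨h.1.conj g, by rw [Cz_conj_index]; exact h.2⟩

theorem EY.conj {p s : ℕ} {x : G} (h : EY p s x) (g : G) : EY p s (g * x * g⁻¹) :=
  ⟨h.1.conj g, by rw [Cz_conj_index]; exact h.2⟩

theorem Cz_index_pos [Finite G] (x : G) : 0 < (Cz x).index :=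
  Nat.pos_of_ne_zero Subgroup.FiniteIndex.index_ne_zero

theorem prime_eq_of_dvd_pow {r p e : ℕ} (hr : r.Prime) (hp : p.Prime) (h : r ∣ p ^ e) : r = p :=
  (Nat.prime_dvd_prime_iff_eq hr hp).1 (hr.dvd_of_dvd_pow h)

namespace Hyp

variable [Finite G] {p q a n : ℕ} (H : Hyp G p q a n)
include H

theorem cop (e : ℕ) : q.Coprime (p ^ e) :=
  ((Nat.coprime_primes H.hq H.hp).2 H.hpq.symm).pow_right e

theorem qnd (e : ℕ) : ¬ q ∣ p ^ e := fun h => H.hpq (prime_eq_of_dvd_pow H.hq H.hp h).symm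

theorem EXnc {s : ℕ} {x : G} (h : EX q s x) : x ∉ Subgroup.center G := fun hc => by
  have := Cz_index_one_iff.2 hc
  rw [h.2] at this
  exact H.hq.ne_one this

theorem EYnc {s : ℕ} {x : G} (h : EY p s x) : x ∉ Subgroup.center G := fun hc => by
  have := Cz_index_one_iff.2 hc
  obtain ⟨e, he, h2⟩ := h.2
  rw [h2] at this
  exact (Nat.one_lt_pow (by omega) H.hp.one_lt).ne' this

theorem factA {r s : ℕ} (hr : r.Prime) (hs : s.Prime) (hrs : r ≠ s) {u v : G}
    (hu : EX q r u) (hv : EY p s v) (h : v ∈ Cz u) : False := by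
  obtain ⟨hv1, e, he, hv2⟩ := hv
  obtain ⟨hu1, hu2⟩ := hu
  obtain ⟨h1, h2⟩ := Cz_prod hr hs hrs hu1 hv1 h
  have d1 := Subgroup.index_dvd_of_le h1
  have d2 := Subgroup.index_dvd_of_le h2
  rw [hu2] at d1
  rw [hv2] at d2
  have d3 : q * p ^ e ∣ (Cz (u * v)).index := (H.cop e).mul_dvd_of_dvd_of_dvd d1 d2
  have d4 : (Cz (u * v)).index ≤ q * p ^ e := by
    have l1 : Cz u ⊓ Cz v ≤ Cz (u * v) := fun g hg => Cz_mul_left hg.1 hg.2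
    have l2 : (Cz u ⊓ Cz v).index ≤ (Cz u).index * (Cz v).index := Subgroup.index_inf_le
    rw [hu2, hv2] at l2
    exact (Nat.le_of_dvd (Nat.pos_of_ne_zero Subgroup.FiniteIndex.index_ne_zero)
      (Subgroup.index_dvd_of_le l1)).trans l2
  have d5 : (Cz (u * v)).index = q * p ^ e :=
    le_antisymm d4 (Nat.le_of_dvd (Cz_index_pos _) d3)
  have hq1 := H.hq.one_lt
  have hpe : 1 < p ^ e := Nat.one_lt_pow (by omega) H.hp.one_lt
  have hnn : n = q * p ^ e := by
    rcases H.vals (u * v) with h | h | h | h <;> rw [d5] at h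
    · nlinarith
    · nlinarith
    · exact (H.qnd a (h ▸ Dvd.intro _ rfl)).elim
    · exact h.symm
  rcases H.vals v with h | h | h | h <;> rw [hv2] at h
  · omega
  · exact H.qnd e (h ▸ dvd_rfl)
  · exact H.bad a (by have := H.ha; omega) le_rfl (by rw [← h]; exact hnn)
  · nlinarith

theorem factB {r s : ℕ} (hr : r.Prime) (hs : s.Prime) (hrs : r ≠ s) {x y : G}
    (hx : EX q r x) (hy : EY p s y) : r = p ∧ s = q := by
  constructor
  · by_contra hrp
    obtain ⟨e, he, hy2⟩ := hy.2
    obtain ⟨g, hg⟩ := exists_conj_mem hr (y := y) hx.1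
      (by rw [hy2]; exact fun h => hrp (prime_eq_of_dvd_pow hr H.hp h))
    exact H.factA hr hs hrs hx (hy.conj g) (mem_Cz_comm.1 hg)
  · by_contra hsq
    obtain ⟨g, hg⟩ := exists_conj_mem hs (y := x) hy.1
      (by rw [hx.2]; exact fun h => hsq ((Nat.prime_dvd_prime_iff_eq hs H.hq).1 h))
    exact H.factA hr hs hrs (hx.conj g) hy hg

theorem lemK {s t : ℕ} (hs : s.Prime) (ht : t.Prime) (hst : s ≠ t) {u w : G}
    (hu : Ise s u) (hw : Ise t w) (h : w ∈ Cz u) (cw : (Cz w).index = n)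
    (hqq : q ∣ n ∨ q ∣ (Cz u).index) : q ∣ n ∧ Cz w ≤ Cz u := by
  obtain ⟨h1, h2⟩ := Cz_prod hs ht hst hu hw h
  have d1 := Subgroup.index_dvd_of_le h1
  have d2 := Subgroup.index_dvd_of_le h2
  rw [cw] at d2
  have d3 : q ∣ (Cz (u * w)).index := by
    rcases hqq with h | h
    · exact h.trans d2
    · exact h.trans d1
  have hn1 := H.hn1
  have d4 : (Cz (u * w)).index = n := by
    rcases H.vals (u * w) with h | h | h | h
    · rw [h, Nat.dvd_one] at d2; omega
    · rw [h] at d2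
      rcases (Nat.dvd_prime H.hq).1 d2 with h | h
      · omega
      · exact (H.hnp (h ▸ H.hq)).elim
    · rw [h] at d3; exact (H.qnd a d3).elim
    · exact h
  refine ⟨d4 ▸ d3, ?_⟩
  rw [← eq_of_le_index h2 (by rw [d4, cw])]
  exact h1

theorem exX : ∃ s : ℕ, s.Prime ∧ ∃ x : G, EX q s x := by
  obtain ⟨g, hg⟩ := H.exq
  have hgc : g ∉ Subgroup.center G := fun hc => by
    rw [Cz_index_one_iff.2 hc] at hg; exact H.hq.ne_one hg.symm
  obtain ⟨t, k, ht, h1, h2⟩ := exists_part' g hgc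
  refine ⟨t, ht, g ^ k, h1, ?_⟩
  have := Subgroup.index_dvd_of_le (Cz_le_pow g k)
  rw [hg] at this
  rcases (Nat.dvd_prime H.hq).1 this with h | h
  · exact (h2 (Cz_index_one_iff.1 h)).elim
  · exact h

theorem pow_of_dvd {w : G} {e : ℕ} (h : (Cz w).index ∣ p ^ e) (hw : w ∉ Subgroup.center G) :
    ∃ i, 1 ≤ i ∧ (Cz w).index = p ^ i := by
  obtain ⟨i, hi, h2⟩ := (Nat.dvd_prime_pow H.hp).1 h
  refine ⟨i, ?_, h2⟩
  rcases Nat.eq_zero_or_pos i with rfl | h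
  · exact (hw (Cz_index_one_iff.1 (by rw [h2]; rfl))).elim
  · exact h

theorem exY : ∃ s : ℕ, s.Prime ∧ ∃ y : G, EY p s y := by
  obtain ⟨g, hg⟩ := H.exp
  have hgc : g ∉ Subgroup.center G := fun hc => by
    rw [Cz_index_one_iff.2 hc] at hg
    exact (Nat.one_lt_pow (by have := H.ha; omega) H.hp.one_lt).ne hg
  obtain ⟨t, k, ht, h1, h2⟩ := exists_part' g hgc
  have := Subgroup.index_dvd_of_le (Cz_le_pow g k)
  rw [hg] at this
  exact ⟨t, ht, g ^ k, h1, H.pow_of_dvd this h2⟩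

theorem tri {t : ℕ} {w : G} (h : NC t w) : EX q t w ∨ EY p t w ∨ (Cz w).index = n := by
  rcases H.vals w with h1 | h1 | h1 | h1
  · exact (h.2 (Cz_index_one_iff.1 h1)).elim
  · exact Or.inl ⟨h.1, h1⟩
  · exact Or.inr (Or.inl ⟨h.1, a, by have := H.ha; omega, h1⟩)
  · exact Or.inr (Or.inr h1)

theorem EYa {t : ℕ} {w : G} (h : EY p t w) (hqn : q ∣ n) : (Cz w).index = p ^ a := by
  obtain ⟨_, e, he, h2⟩ := h
  rcases H.vals w with h1 | h1 | h1 | h1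
  · rw [h2] at h1; exact ((Nat.one_lt_pow (by omega) H.hp.one_lt).ne' h1).elim
  · rw [h2] at h1; exact (H.qnd e (h1 ▸ dvd_rfl)).elim
  · exact h1
  · rw [h2] at h1; exact (H.qnd e (h1 ▸ hqn)).elim

omit H in
theorem m_ne : (Subgroup.center G).index ≠ 0 := Subgroup.FiniteIndex.index_ne_zero

omit H in
theorem exists_nc {t : ℕ} (ht : t.Prime) (h : t ∣ (Subgroup.center G).index) :
    ∃ w : G, NC t w := by
  obtain ⟨w, -, hw⟩ := exists_noncentral ht (H := (⊤ : Subgroup G)) le_top (by simpa using h)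
  exact ⟨w, hw⟩

omit H in
theorem exists_ncC {t : ℕ} (ht : t.Prime) {u : G}
    (h : (Cz u).index * t ∣ (Subgroup.center G).index) : ∃ w ∈ Cz u, NC t w :=
  exists_noncentral ht (center_le_Cz u) h

omit H in
theorem dvC {t : ℕ} (ht : t.Prime) {u w : G} (h : w ∈ Cz u) (hw : NC t w) :
    (Cz u).index * t ∣ (Subgroup.center G).index :=
  dvd_of_noncentral ht (center_le_Cz u) h hw.1 hw.2

theorem qdm : q ∣ (Subgroup.center G).index := by
  obtain ⟨g, hg⟩ := H.exq
  exact hg ▸ index_dvd g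

theorem pdm : p ^ a ∣ (Subgroup.center G).index := by
  obtain ⟨g, hg⟩ := H.exp
  exact hg ▸ index_dvd g

theorem pdm' : p ∣ (Subgroup.center G).index :=
  (dvd_pow_self p (by have := H.ha; omega)).trans H.pdm

theorem qpdm : q * p ∣ (Subgroup.center G).index := by
  refine Nat.Coprime.mul_dvd_of_dvd_of_dvd ?_ H.qdm H.pdm'
  simpa using H.cop 1

theorem ndm : n ∣ (Subgroup.center G).index := by
  obtain ⟨g, hg⟩ := H.exn
  exact hg ▸ index_dvd g

theorem padm {t : ℕ} (ht : t.Prime) (htp : t ≠ p) (h : t ∣ (Subgroup.center G).index) :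
    p ^ a * t ∣ (Subgroup.center G).index :=
  (((Nat.coprime_primes H.hp ht).2 htp.symm).pow_left a).mul_dvd_of_dvd_of_dvd H.pdm h

/-- an element `w` commutes with a conjugate of `x`. -/
theorem conjX {t s : ℕ} (ht : t.Prime) (htq : t ≠ q) {x w : G} (hx : EX q s x) (hw : Ise t w) :
    ∃ g : G, w ∈ Cz (g * x * g⁻¹) :=
  exists_conj_mem ht hw (by
    rw [hx.2]; exact fun h => htq ((Nat.prime_dvd_prime_iff_eq ht H.hq).1 h))

theorem conjY {t s : ℕ} (ht : t.Prime) (htp : t ≠ p) {y w : G} (hy : EY p s y) (hw : Ise t w) :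
    ∃ g : G, w ∈ Cz (g * y * g⁻¹) := by
  obtain ⟨e, he, hy2⟩ := hy.2
  exact exists_conj_mem ht hw (by
    rw [hy2]; exact fun h => htp (prime_eq_of_dvd_pow ht H.hp h))

theorem KX {s t : ℕ} (hs : s.Prime) (ht : t.Prime) (hst : s ≠ t) {u w : G}
    (hu : EX q s u) (hw : Ise t w) (h : w ∈ Cz u) (cw : (Cz w).index = n) :
    q ∣ n ∧ Cz w ≤ Cz u :=
  H.lemK hs ht hst hu.1 hw h cw (Or.inr (hu.2 ▸ dvd_rfl))

end Hyp

namespace Hyp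

variable {G : Type*} [Group G] [Finite G] {p q a n : ℕ} (H : Hyp G p q a n)
include H

theorem claim1 (hX : ∀ (s : ℕ) (x : G), s.Prime → EX q s x → s = p) {x : G} (hx : EX q p x)
    {t : ℕ} (ht : t.Prime) (htp : t ≠ p) {w : G} (hwx : w ∈ Cz x) (hw : NC t w) : False := by
  have K0 : ∀ (t' : ℕ) (w' : G), t'.Prime → t' ≠ p → w' ∈ Cz x → NC t' w' →
      q ∣ n ∧ Cz w' ≤ Cz x ∧ (Cz w').index = n := by
    intro t' w' ht' htp' hwx' hw'
    rcases H.tri hw' with h | h | h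
    · exact (htp' (hX _ _ ht' h)).elim
    · exact (H.factA H.hp ht' htp'.symm hx h hwx').elim
    · obtain ⟨h1, h2⟩ := H.KX H.hp ht' htp'.symm hx hw'.1 hwx' h
      exact ⟨h1, h2, h⟩
  obtain ⟨hqn, -, hcw⟩ := K0 t w ht htp hwx hw
  have hqt : q * t ∣ (Subgroup.center G).index := hx.2 ▸ dvC ht hwx hw
  have hnt : n * t ∣ (Subgroup.center G).index := hcw ▸ dvC ht (self_mem_Cz w) hw
  by_cases hb : ∃ (t1 : ℕ) (y : G), t1.Prime ∧ t1 ≠ p ∧ EY p t1 y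
  · obtain ⟨t1, y, ht1, htp1, hy⟩ := hb
    have hya := H.EYa hy hqn
    have hi : (Cz x ⊓ Cz y).index = q * p ^ a := by
      have h1 : (Cz x ⊓ Cz y).index ≤ (Cz x).index * (Cz y).index := Subgroup.index_inf_le
      rw [hx.2, hya] at h1
      refine le_antisymm h1 (Nat.le_of_dvd
        (Nat.pos_of_ne_zero Subgroup.FiniteIndex.index_ne_zero) ?_)
      apply (H.cop a).mul_dvd_of_dvd_of_dvd
      · have := Subgroup.index_dvd_of_le (inf_le_left : Cz x ⊓ Cz y ≤ Cz x)
        rwa [hx.2] at this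
      · have := Subgroup.index_dvd_of_le (inf_le_right : Cz x ⊓ Cz y ≤ Cz y)
        rwa [hya] at this
    have hd : (Cz x ⊓ Cz y).index * t ∣ (Subgroup.center G).index := by
      rw [hi, mul_assoc, mul_comm (p ^ a), ← mul_assoc]
      refine Nat.Coprime.mul_dvd_of_dvd_of_dvd ?_ hqt H.pdm
      exact Nat.Coprime.mul_left (H.cop a) (((Nat.coprime_primes ht H.hp).2 htp).pow_right a)
    obtain ⟨w2, hw2, hw3⟩ := exists_noncentral ht (le_inf (center_le_Cz x) (center_le_Cz y)) hd
    obtain ⟨-, h2, -⟩ := K0 t w2 ht htp hw2.1 hw3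
    exact H.factA H.hp ht1 htp1.symm hx hy (h2 (mem_Cz_comm.1 hw2.2))
  · obtain ⟨s, hs, y, hy⟩ := H.exY
    have hcn : ∀ (t' : ℕ) (w' : G), t'.Prime → t' ≠ p → NC t' w' → (Cz w').index = n := by
      intro t' w' ht' htp' hw'
      rcases H.tri hw' with h | h | h
      · exact (htp' (hX _ _ ht' h)).elim
      · exact (hb ⟨t', w', ht', htp', h⟩).elim
      · exact h
    have hsp : s = p := by
      by_contra h
      exact hb ⟨s, y, hs, h, hy⟩
    subst hsp
    refine union_lemma hs (H.EYnc hy) ?_ ?_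
    · intro t' ht' htp' w' hw' hwc'
      obtain ⟨g, hg⟩ := H.conjY ht' htp' hy hw'
      exact ⟨g, (H.lemK hs ht' htp'.symm (hy.conj g).1 hw' hg (hcn t' w' ht' htp' ⟨hw', hwc'⟩)
        (Or.inl hqn)).2⟩
    · intro u hu huc
      refine ⟨t, ht, htp, exists_ncC ht ?_⟩
      rcases H.tri ⟨hu, huc⟩ with h | h | h
      · rw [h.2]; exact hqt
      · rw [H.EYa h hqn]; exact H.padm ht htp ((Dvd.intro_left _ rfl).trans hqt)
      · rw [h]; exact hnt

theorem case1 (hX : ∀ (s : ℕ) (x : G), s.Prime → EX q s x → s = p) {x : G} (hx : EX q p x) :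
    False := by
  have hpq := H.hpq
  have hp1 := H.hp.one_lt
  have hq1 := H.hq.one_lt
  have c1 : ∀ l : ℕ, l.Prime → l ≠ p → ¬ q * l ∣ (Subgroup.center G).index := by
    intro l hl hlp h
    obtain ⟨w, hwx, hw⟩ := exists_ncC hl (u := x) (by rw [hx.2]; exact h)
    exact H.claim1 hX hx hl hlp hwx hw
  obtain ⟨m', hm'⟩ := H.qdm
  obtain ⟨c, hc⟩ : ∃ c, m' = p ^ c := by
    refine ⟨_, Nat.eq_prime_pow_of_unique_prime_dvd ?_ ?_⟩
    · rintro rfl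
      exact m_ne (by rw [hm', mul_zero])
    · intro d hd hdm
      by_contra hdp
      exact c1 d hd hdp (by rw [hm']; exact Nat.mul_dvd_mul_left _ hdm)
  subst hc
  have hqv : ∀ v w : G, NC q w → w ∈ Cz v → (Cz v).index ∣ p ^ c := by
    intro v w hw hwv
    have := dvC H.hq hwv hw
    rw [hm', mul_comm q] at this
    exact Nat.dvd_of_mul_dvd_mul_right H.hq.pos this
  obtain ⟨w, hw⟩ := exists_nc H.hq H.qdm
  have hcw := hqv w w hw (self_mem_Cz w)
  have hnm := H.ndm
  rw [hm'] at hnm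
  by_cases hqn : q ∣ n
  · have hnn : ∀ v : G, (Cz v).index ∣ p ^ c → v ∉ Subgroup.center G → (Cz v).index = p ^ a := by
      intro v hv hvc
      rcases H.vals v with h | h | h | h
      · exact (hvc (Cz_index_one_iff.1 h)).elim
      · rw [h] at hv; exact (H.qnd c hv).elim
      · exact h
      · rw [h] at hv; exact (H.qnd c (hqn.trans hv)).elim
    have hwa := hnn w hcw hw.2
    have hnd : ¬ p ^ a * p ∣ (Subgroup.center G).index := by
      intro hd
      obtain ⟨u, huw, hu⟩ := exists_ncC H.hp (u := w) (by rw [hwa]; exact hd)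
      obtain ⟨h1, h2⟩ := Cz_prod H.hp H.hq hpq hu.1 hw.1 (mem_Cz_comm.1 huw)
      have huwc : u * w ∉ Subgroup.center G := by
        intro h
        apply hw.2
        rw [← Cz_index_one_iff, Subgroup.index_eq_one] at h ⊢
        exact top_le_iff.1 (h ▸ h2)
      have h3 := hnn (u * w) (hqv _ w hw
        (Cz_mul_left (mem_Cz_comm.1 huw) (self_mem_Cz w))) huwc
      have h4 : Cz (u * w) = Cz w := eq_of_le_index h2 (by rw [h3, hwa])
      have h5 : Cz w ≤ Cz u := h4 ▸ h1
      have h6 : (Cz u).index = p ^ a :=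
        hnn u ((Subgroup.index_dvd_of_le h5).trans hcw) hu.2
      have h7 : Cz w = Cz u := eq_of_le_index h5 (by rw [hwa, h6])
      obtain ⟨g, hg⟩ := H.conjX H.hp hpq hx hu.1
      rw [mem_Cz_comm, ← h7, mem_Cz_comm] at hg
      exact H.claim1 hX (hx.conj g) H.hq hpq.symm hg hw
    obtain ⟨k, hk⟩ := hqn
    rw [hk] at hnm
    obtain ⟨b, hb, hkb⟩ := (Nat.dvd_prime_pow H.hp).1 (Nat.dvd_of_mul_dvd_mul_left H.hq.pos hnm)
    have hca : c ≤ a := by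
      by_contra hcon
      apply hnd
      rw [hm', ← pow_succ]
      exact (pow_dvd_pow p (by omega)).trans (Dvd.intro_left _ rfl)
    refine H.bad b ?_ (hb.trans hca) (by rw [hk, hkb])
    rcases Nat.eq_zero_or_pos b with rfl | h
    · exfalso
      apply H.hnp
      rw [hk, hkb]; simpa using H.hq
    · exact h
  · have hnc : n ∣ p ^ c :=
      Nat.Coprime.dvd_of_dvd_mul_left ((Nat.Prime.coprime_iff_not_dvd H.hq).2 hqn).symm hnm
    obtain ⟨d, hd, hnd⟩ := (Nat.dvd_prime_pow H.hp).1 hnc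
    have hprimes : ∀ l : ℕ, l.Prime → l ∣ (Subgroup.center G).index → l = p ∨ l = q := by
      intro l hl hlm
      rw [hm', hl.dvd_mul] at hlm
      rcases hlm with h | h
      · exact Or.inr ((Nat.prime_dvd_prime_iff_eq hl H.hq).1 h)
      · exact Or.inl (prime_eq_of_dvd_pow hl H.hp h)
    by_cases hy : ∃ y : G, EY p p y
    · obtain ⟨y, hy⟩ := hy
      obtain ⟨e, he, hye⟩ := hy.2
      refine lemS H.hp H.hq hpq hprimes ?_ x hx.1 (H.EXnc hx) ⟨1, by rw [hx.2, pow_one]⟩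
        y hy.1 (H.EYnc hy) ⟨e, hye⟩
      intro u hu
      rcases H.vals u with h | h | h | h
      · exact Or.inl ⟨0, h⟩
      · right
        refine ⟨⟨1, by rw [h, pow_one]⟩, ?_⟩
        rw [h]; exact c1
      · exact Or.inl ⟨a, h⟩
      · exact Or.inl ⟨d, by rw [h, hnd]⟩
    · have hqc : ∀ w : G, NC q w → (Cz w).index = p ^ c := by
        intro w hw
        obtain ⟨i, hi, hwi⟩ := (Nat.dvd_prime_pow H.hp).1 (hqv w w hw (self_mem_Cz w))
        rcases hi.eq_or_lt with rfl | hlt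
        · exact hwi
        exfalso
        have : (Cz w).index * p ∣ (Subgroup.center G).index := by
          rw [hwi, hm', ← pow_succ]
          exact (pow_dvd_pow p (by omega)).trans (Dvd.intro_left _ rfl)
        obtain ⟨u, huw, hu⟩ := exists_ncC H.hp this
        obtain ⟨h1, h2⟩ := Cz_prod H.hp H.hq hpq hu.1 hw.1 (mem_Cz_comm.1 huw)
        have h3 := hqv _ w hw (Cz_mul_left (mem_Cz_comm.1 huw) (self_mem_Cz w))
        exact hy ⟨u, hu.1, H.pow_of_dvd ((Subgroup.index_dvd_of_le h1).trans h3) hu.2⟩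
      have hall : ∀ (v : G) (j : ℕ), 1 < (Cz v).index → (Cz v).index = p ^ j →
          (Cz v).index = p ^ c := by
        intro v j hv1 hvj
        have hvc : v ∉ Subgroup.center G := by
          rw [← Cz_index_one_iff]; omega
        obtain ⟨t, k, ht, h1, h2⟩ := exists_part' v hvc
        have h3 := Subgroup.index_dvd_of_le (Cz_le_pow v k)
        have h4 := dvC ht (self_mem_Cz (v ^ k)) ⟨h1, h2⟩
        rcases hprimes t ht ((Dvd.intro_left _ rfl).trans h4) with rfl | rfl
        · rw [hvj] at h3
          exact (hy ⟨v ^ k, h1, H.pow_of_dvd h3 h2⟩).elim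
        · rw [hqc _ ⟨h1, h2⟩] at h3
          apply Nat.dvd_antisymm _ h3
          have h5 := index_dvd v
          rw [hm'] at h5
          refine Nat.Coprime.dvd_of_dvd_mul_left ?_ h5
          rw [hvj]; exact (H.cop j).symm
      obtain ⟨g1, hg1⟩ := H.exp
      obtain ⟨g2, hg2⟩ := H.exn
      have e1 := hall g1 a (by rw [hg1]; exact Nat.one_lt_pow (by have := H.ha; omega) hp1) hg1
      have e2 := hall g2 d (by rw [hg2]; exact H.hn1) (by rw [hg2, hnd])
      exact H.hne (by rw [← hg1, ← hg2, e1, e2])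

end Hyp

namespace Hyp

variable {G : Type*} [Group G] [Finite G] {p q a n : ℕ} (H : Hyp G p q a n)
include H

theorem case3 (hX : ∀ (s : ℕ) (x : G), EX q s x → s ≠ p ∧ s ≠ q) : False := by
  obtain ⟨s, hs, x, hx⟩ := H.exX
  obtain ⟨hsp, hsq⟩ := hX s x hx
  have hY : ∀ (t : ℕ) (y : G), t.Prime → EY p t y → t = s := by
    intro t y ht hy
    by_contra h
    exact hsp (H.factB hs ht (Ne.symm h) hx hy).1
  obtain ⟨s1, hs1, y, hy⟩ := H.exY
  have := hY s1 y hs1 hy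
  subst this
  have hX2 : ∀ (t : ℕ) (y : G), t.Prime → EX q t y → t = s1 := by
    intro t z ht hz
    by_contra h
    exact (hX t z hz).1 (H.factB ht hs h hz hy).1
  have hcn : ∀ (t' : ℕ) (w' : G), t'.Prime → t' ≠ s1 → NC t' w' → (Cz w').index = n := by
    intro t' w' ht' htp' hw'
    rcases H.tri hw' with h | h | h
    · exact (htp' (hX2 _ _ ht' h)).elim
    · exact (htp' (hY _ _ ht' h)).elim
    · exact h
  have h1 : ∀ (t : ℕ) (w : G), t.Prime → t ≠ s1 → t ≠ q → NC t w →
      q ∣ n ∧ ∃ g : G, Cz w ≤ Cz (g * x * g⁻¹) := by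
    intro t w ht hts htq hw
    obtain ⟨g, hg⟩ := H.conjX ht htq hx hw.1
    obtain ⟨h1, h2⟩ := H.KX hs ht (Ne.symm hts) (hx.conj g) hw.1 hg (hcn t w ht hts hw)
    exact ⟨h1, g, h2⟩
  obtain ⟨w0, hw0⟩ := exists_nc H.hp H.pdm'
  obtain ⟨hqn, -⟩ := h1 p w0 H.hp (Ne.symm hsp) H.hpq hw0
  have hnp : n * p ∣ (Subgroup.center G).index := by
    have := dvC H.hp (self_mem_Cz w0) hw0
    rwa [hcn p w0 H.hp (Ne.symm hsp) hw0] at this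
  refine union_lemma hs (H.EXnc hx) ?_ ?_
  · intro t ht hts w hw hwc
    by_cases htq : t = q
    · subst htq
      have hcw := hcn t w ht hts ⟨hw, hwc⟩
      obtain ⟨w2, hw2, hw3⟩ := exists_ncC H.hp (u := w) (by rw [hcw]; exact hnp)
      obtain ⟨-, h3⟩ := H.lemK H.hp ht H.hpq hw3.1 hw (mem_Cz_comm.1 hw2) hcw (Or.inl hqn)
      obtain ⟨-, g, hg⟩ := h1 p w2 H.hp (Ne.symm hsp) H.hpq hw3
      exact ⟨g, h3.trans hg⟩
    · exact (h1 t w ht hts htq ⟨hw, hwc⟩).2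
  · intro u hu huc
    rcases H.tri ⟨hu, huc⟩ with h | h | h
    · exact ⟨p, H.hp, Ne.symm hsp, exists_ncC H.hp (by rw [h.2]; exact H.qpdm)⟩
    · exact ⟨q, H.hq, Ne.symm hsq, exists_ncC H.hq (by
        rw [H.EYa h hqn]; exact H.padm H.hq H.hpq.symm H.qdm)⟩
    · exact ⟨p, H.hp, Ne.symm hsp, exists_ncC H.hp (by rw [h]; exact hnp)⟩

/-- final step of case 2. -/
theorem case2fin {x y : G} (hx : EX q q x) (hy : EY p q y)
    (hpa : ∀ t : ℕ, t.Prime → t ≠ q → ¬ p ^ a * t ∣ (Subgroup.center G).index)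
    (hqn : q ∣ n)
    (hu : ∀ u : G, Ise q u → (Cz u).index = n → ∃ j, (Cz u).index = q ^ j) : False := by
  have hya := H.EYa hy hqn
  refine lemS H.hq H.hp H.hpq.symm ?_ ?_ y hy.1 (H.EYnc hy) ⟨a, hya⟩ x hx.1 (H.EXnc hx)
    ⟨1, by rw [hx.2, pow_one]⟩
  · intro l hl hlm
    by_contra hcon
    push Not at hcon
    exact hpa l hl hcon.1 (H.padm hl hcon.2 hlm)
  · intro u hu1
    rcases H.vals u with h | h | h | h
    · exact Or.inl ⟨0, h⟩
    · exact Or.inl ⟨1, by rw [h, pow_one]⟩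
    · right
      refine ⟨⟨a, h⟩, ?_⟩
      rw [h]; exact hpa
    · exact Or.inl (hu u hu1 h)

theorem case2a {x y : G} (hx : EX q q x) (hy : EY p q y)
    (hX : ∀ (s : ℕ) (x : G), s.Prime → EX q s x → s = q)
    (hY : ∀ (s : ℕ) (x : G), s.Prime → EY p s x → s = q) : False := by
  have hcn : ∀ (t' : ℕ) (w' : G), t'.Prime → t' ≠ q → NC t' w' → (Cz w').index = n := by
    intro t' w' ht' htp' hw'
    rcases H.tri hw' with h | h | h
    · exact (htp' (hX _ _ ht' h)).elim
    · exact (htp' (hY _ _ ht' h)).elim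
    · exact h
  have h1 : ∀ (t : ℕ) (w : G), t.Prime → t ≠ q → NC t w →
      q ∣ n ∧ ∃ g : G, Cz w ≤ Cz (g * x * g⁻¹) := by
    intro t w ht htq hw
    obtain ⟨g, hg⟩ := H.conjX ht htq hx hw.1
    obtain ⟨h1, h2⟩ := H.KX H.hq ht (Ne.symm htq) (hx.conj g) hw.1 hg (hcn t w ht htq hw)
    exact ⟨h1, g, h2⟩
  obtain ⟨w0, hw0⟩ := exists_nc H.hp H.pdm'
  obtain ⟨hqn, -⟩ := h1 p w0 H.hp H.hpq hw0
  have hnp : n * p ∣ (Subgroup.center G).index := by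
    have := dvC H.hp (self_mem_Cz w0) hw0
    rwa [hcn p w0 H.hp H.hpq hw0] at this
  have hpa : ∀ t : ℕ, t.Prime → t ≠ q → ¬ p ^ a * t ∣ (Subgroup.center G).index := by
    intro t ht htq hd
    refine union_lemma H.hq (H.EXnc hx) ?_ ?_
    · intro l hl hlq w hw hwc
      exact (h1 l w hl hlq ⟨hw, hwc⟩).2
    · intro u hu huc
      rcases H.tri ⟨hu, huc⟩ with h | h | h
      · exact ⟨p, H.hp, H.hpq, exists_ncC H.hp (by rw [h.2]; exact H.qpdm)⟩
      · exact ⟨t, ht, htq, exists_ncC ht (by rw [H.EYa h hqn]; exact hd)⟩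
      · exact ⟨p, H.hp, H.hpq, exists_ncC H.hp (by rw [h]; exact hnp)⟩
  refine H.case2fin hx hy hpa hqn ?_
  intro u hu hun
  exfalso
  obtain ⟨w, hwu, hw⟩ := exists_ncC H.hp (u := u) (by rw [hun]; exact hnp)
  have hwn := hcn p w H.hp H.hpq hw
  have h2 := (H.lemK H.hq H.hp H.hpq.symm hu hw.1 hwu hwn (Or.inl hqn)).2
  have h3 : Cz w = Cz u := eq_of_le_index h2 (by rw [hun, hwn])
  obtain ⟨g, hg⟩ := H.conjY H.hq H.hpq.symm hy hu
  rw [mem_Cz_comm, ← h3, mem_Cz_comm] at hg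
  have h4 := dvC H.hp hg hw
  rw [Cz_conj_index, H.EYa hy hqn] at h4
  exact hpa p H.hp H.hpq h4

theorem case2b {x y x' : G} (hx : EX q q x) (hy : EY p q y) (hx' : EX q p x')
    (hX : ∀ (s : ℕ) (x : G), s.Prime → EX q s x → s = p ∨ s = q)
    (hY : ∀ (s : ℕ) (x : G), s.Prime → EY p s x → s = q) : False := by
  have hpq := H.hpq
  obtain ⟨g, hg⟩ := H.conjX H.hp hpq hx hx'.1
  replace hx := hx.conj g
  generalize g * x * g⁻¹ = x at hg hx
  obtain ⟨h1, h2⟩ := Cz_prod H.hq H.hp hpq.symm hx.1 hx'.1 hg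
  have d1 := Subgroup.index_dvd_of_le h1
  rw [hx.2] at d1
  have hle : (Cz (x * x')).index ≤ q * q := by
    have l1 : Cz x ⊓ Cz x' ≤ Cz (x * x') := fun g hg => Cz_mul_left hg.1 hg.2
    have l2 : (Cz x ⊓ Cz x').index ≤ (Cz x).index * (Cz x').index := Subgroup.index_inf_le
    rw [hx.2, hx'.2] at l2
    exact (Nat.le_of_dvd (Nat.pos_of_ne_zero Subgroup.FiniteIndex.index_ne_zero)
      (Subgroup.index_dvd_of_le l1)).trans l2
  have hxn : (Cz (x * x')).index = n := by
    rcases H.vals (x * x') with h | h | h | h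
    · rw [h, Nat.dvd_one] at d1; exact (H.hq.ne_one d1).elim
    · exfalso
      have e1 := eq_of_le_index h1 (by rw [h, hx.2])
      have e2 := eq_of_le_index h2 (by rw [h, hx'.2])
      obtain ⟨g, hg⟩ := H.conjY H.hq hpq.symm hy hx.1
      rw [mem_Cz_comm, ← e1, e2] at hg
      exact H.factA H.hp H.hq hpq hx' (hy.conj g) hg
    · rw [h] at d1; exact (H.qnd a d1).elim
    · exact h
  rw [hxn] at hle d1
  have hqn := d1
  have alpha : ∀ t : ℕ, t.Prime → t ≠ p → t ≠ q → ∀ w : G, NC t w → False := by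
    intro t ht htp htq w hw
    have hwn : (Cz w).index = n := by
      rcases H.tri hw with h | h | h
      · rcases hX t w ht h with h | h
        · exact (htp h).elim
        · exact (htq h).elim
      · exact (htq (hY _ _ ht h)).elim
      · exact h
    obtain ⟨g, hg⟩ := H.conjX ht htq hx' hw.1
    obtain ⟨k, hk⟩ := H.conjY ht htp hy hw.1
    have i1 := (H.KX H.hp ht (Ne.symm htp) (hx'.conj g) hw.1 hg hwn).2
    exact H.factA H.hp H.hq hpq (hx'.conj g) (hy.conj k) (i1 (mem_Cz_comm.1 hk))
  have hya := H.EYa hy hqn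
  have hpa : ∀ t : ℕ, t.Prime → t ≠ q → ¬ p ^ a * t ∣ (Subgroup.center G).index := by
    intro t ht htq hd
    obtain ⟨w, hwy, hw⟩ := exists_ncC ht (u := y) (by rw [hya]; exact hd)
    by_cases htp : t = p
    · subst htp
      have hwn : (Cz w).index = n := by
        rcases H.tri hw with h | h | h
        · exact (H.factA ht H.hq hpq h hy (mem_Cz_comm.1 hwy)).elim
        · exact (htq (hY _ _ ht h)).elim
        · exact h
      have i1 := (H.lemK H.hq ht hpq.symm hy.1 hw.1 hwy hwn (Or.inl hqn)).2
      obtain ⟨g, hg⟩ := H.conjX ht htq hx' hw.1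
      exact H.factA ht H.hq hpq (hx'.conj g) hy (mem_Cz_comm.1 (i1 (mem_Cz_comm.1 hg)))
    · exact alpha t ht htp htq w hw
  have hprimes : ∀ l : ℕ, l.Prime → l ∣ n → l = p ∨ l = q := by
    intro l hl hln
    by_contra hcon
    push Not at hcon
    exact hpa l hl hcon.2 (H.padm hl hcon.1 (hln.trans H.ndm))
  have hnq : ∃ j, n = q ^ j := by
    obtain ⟨b, k, hk, hnk⟩ := Nat.exists_eq_pow_mul_and_not_dvd
      (show n ≠ 0 by have := H.hn1; omega) p H.hp.ne_one
    obtain ⟨i, hi⟩ : ∃ i, k = q ^ i := by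
      refine ⟨_, Nat.eq_prime_pow_of_unique_prime_dvd ?_ ?_⟩
      · rintro rfl; simp at hk
      · intro d hd hdk
        rcases hprimes d hd (hnk ▸ hdk.mul_left _) with rfl | h
        · exact (hk hdk).elim
        · exact h
    subst hi
    rcases Nat.eq_zero_or_pos b with rfl | hb
    · exact ⟨i, by rw [hnk]; simp⟩
    exfalso
    have hba : b ≤ a := by
      by_contra hcon
      apply hpa p H.hp hpq
      rw [← pow_succ]
      refine (pow_dvd_pow p (by omega : a + 1 ≤ b)).trans ?_
      exact (Dvd.intro _ hnk.symm).trans H.ndm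
    have hi0 : i ≠ 0 := by
      rintro rfl
      rw [pow_zero, mul_one] at hnk
      exact H.qnd b (hnk ▸ hqn)
    by_cases hi1 : i = 1
    · subst hi1
      exact H.bad b hb hba (by rw [hnk]; ring)
    · have hi2 : q ^ 2 ≤ q ^ i := Nat.pow_le_pow_right H.hq.pos (by omega)
      have hpb : 1 < p ^ b := Nat.one_lt_pow (by omega) H.hp.one_lt
      have hq0 := H.hq.pos
      have : 0 < q ^ i := pow_pos hq0 i
      rw [hnk] at hle
      nlinarith
  obtain ⟨j, hj⟩ := hnq
  exact H.case2fin hx hy hpa hqn (fun u _ hu => ⟨j, by rw [hu, hj]⟩)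

theorem contra : False := by
  by_cases hXq : ∃ x : G, EX q q x
  · obtain ⟨x, hx⟩ := hXq
    have hY : ∀ (s : ℕ) (x : G), s.Prime → EY p s x → s = q := by
      intro s y hs hy
      by_contra h
      exact H.hpq (H.factB H.hq hs (Ne.symm h) hx hy).1.symm
    obtain ⟨s, hs, y, hy⟩ := H.exY
    have := hY s y hs hy
    subst this
    have hX : ∀ (t : ℕ) (x : G), t.Prime → EX s t x → t = p ∨ t = s := by
      intro t x ht hx
      by_cases h : t = s
      · exact Or.inr h
      · exact Or.inl (H.factB ht hs h hx hy).1
    by_cases hXp : ∃ x : G, EX s p x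
    · obtain ⟨x', hx'⟩ := hXp
      exact H.case2b hx hy hx' hX hY
    · refine H.case2a hx hy (fun t x ht hx => ?_) hY
      rcases hX t x ht hx with rfl | h
      · exact (hXp ⟨x, hx⟩).elim
      · exact h
  · by_cases hXp : ∃ x : G, EX q p x
    · obtain ⟨x, hx⟩ := hXp
      refine H.case1 (fun s z hs hz => ?_) hx
      by_contra hsp
      obtain ⟨t, ht, y, hy⟩ := H.exY
      have h1 : t = s := by
        by_contra hts
        exact hsp (H.factB hs ht (Ne.symm hts) hz hy).1
      subst h1
      have h2 := (H.factB H.hp ht (Ne.symm hsp) hx hy).2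
      subst h2
      exact hXq ⟨z, hz⟩
    · refine H.case3 (fun s x hx => ⟨?_, ?_⟩)
      · rintro rfl; exact hXp ⟨x, hx⟩
      · rintro rfl; exact hXq ⟨x, hx⟩

end Hyp

end main

section part2

variable {G : Type*} [Group G]

theorem sylow_central [Finite G] {r : ℕ} (hr : r.Prime) (h : ∀ g : G, ¬ r ∣ (Cz g).index)
    (R : Sylow r G) : (R : Subgroup G) ≤ Subgroup.center G := by
  have h1 : Subgroup.centralizer ((R : Subgroup G) : Set G) = ⊤ := by
    apply union_conj
    intro g
    obtain ⟨k, hk⟩ := exists_conj_le hr R (Cz g) R.2 (h g)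
    refine ⟨k⁻¹, Subgroup.mem_centralizer_iff.2 fun w hw => ?_⟩
    have h2 := (mem_Cz_conj k).1 (hk w hw)
    rw [mem_Cz] at h2
    simpa [mul_assoc] using h2
  intro w hw
  rw [Subgroup.mem_center_iff]
  intro g
  have h2 : g ∈ Subgroup.centralizer ((R : Subgroup G) : Set G) := by rw [h1]; trivial
  exact (Subgroup.mem_centralizer_iff.1 h2 w hw).symm

def Acen (G : Type*) [Group G] (N : ℕ) : Subgroup G where
  carrier := {z | z ∈ Subgroup.center G ∧ (orderOf z).Coprime N}
  one_mem' := ⟨one_mem _, by simp⟩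
  mul_mem' := by
    rintro x y ⟨hx, hx2⟩ ⟨hy, hy2⟩
    refine ⟨mul_mem hx hy, ?_⟩
    have hc : Commute x y := Subgroup.mem_center_iff.1 hy x
    exact Nat.Coprime.coprime_dvd_left hc.orderOf_mul_dvd_mul_orderOf (Nat.Coprime.mul_left hx2 hy2)
  inv_mem' := by
    rintro x ⟨hx, hx2⟩
    exact ⟨inv_mem hx, by rwa [orderOf_inv]⟩

theorem split_off [Finite G] {p q : ℕ} (hp : p.Prime) (hq : q.Prime)
    (h : ∀ r : ℕ, r.Prime → r ≠ p → r ≠ q → ∀ g : G, ¬ r ∣ (Cz g).index) :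
    ∃ K A : Subgroup G,
      (∀ r : ℕ, r.Prime → r ∣ Nat.card K → r = p ∨ r = q) ∧
      (∀ x ∈ A, ∀ y ∈ A, x * y = y * x) ∧
      ∃ e : (↥K × ↥A) ≃* G, ∀ (x : K) (y : A), e (x, y) = (x : G) * y := by
  have hAc : Acen G (p * q) ≤ Subgroup.center G := fun z hz => hz.1
  have hidx : ∀ r : ℕ, r.Prime → r ∣ (Acen G (p * q)).index → r = p ∨ r = q := by
    intro r hr hd
    by_contra hcon
    push Not at hcon
    haveI := Fact.mk hr
    obtain ⟨R⟩ : Nonempty (Sylow r G) := inferInstance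
    have h1 := sylow_central hr (h r hr hcon.1 hcon.2) R
    have h2 : (R : Subgroup G) ≤ Acen G (p * q) := by
      intro w hw
      refine ⟨h1 hw, ?_⟩
      obtain ⟨k, hk⟩ := Ise.of_mem R.2 hw
      refine Nat.Coprime.coprime_dvd_left (orderOf_dvd_of_pow_eq_one hk) (Nat.Coprime.pow_left _ ?_)
      exact Nat.Coprime.mul_right ((Nat.coprime_primes hr hp).2 hcon.1)
        ((Nat.coprime_primes hr hq).2 hcon.2)
    exact R.not_dvd_index (hd.trans (Subgroup.index_dvd_of_le h2))
  have hcard : ∀ r : ℕ, r.Prime → r ∣ Nat.card (Acen G (p * q)) → ¬ (r = p ∨ r = q) := by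
    intro r hr hd hcon
    haveI := Fact.mk hr
    obtain ⟨⟨z, hz⟩, ho⟩ := exists_prime_orderOf_dvd_card' r hd
    rw [Subgroup.orderOf_mk] at ho
    have h2 := hz.2
    rw [ho] at h2
    have h3 : r ∣ p * q := by
      rcases hcon with rfl | rfl
      · exact Dvd.intro _ rfl
      · exact Dvd.intro_left _ rfl
    exact (Nat.Prime.coprime_iff_not_dvd hr).1 h2 h3
  haveI hN : (Acen G (p * q)).Normal := ⟨fun z hz g => by
    have : g * z * g⁻¹ = z := by
      rw [Subgroup.mem_center_iff.1 hz.1 g]; group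
    rw [this]; exact hz⟩
  obtain ⟨K, hK⟩ := Subgroup.exists_right_complement'_of_coprime
    (N := Acen G (p * q)) (Nat.coprime_of_dvd fun r hr h1 h2 => hcard r hr h1 (hidx r hr h2))
  refine ⟨K, Acen G (p * q), ?_, ?_, ?_⟩
  · intro r hr hd
    rw [← hK.symm.index_eq_card] at hd
    exact hidx r hr hd
  · intro x _ y hy
    exact Subgroup.mem_center_iff.1 hy.1 x
  · have hb : Function.Bijective (MonoidHom.noncommCoprod K.subtype (Acen G (p * q)).subtype
        (fun x y => Subgroup.mem_center_iff.1 y.2.1 x)) := hK.symm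
    exact ⟨MulEquiv.ofBijective _ hb, fun x y => rfl⟩

end part2

/-- If `cs(G) = {1, q, p^a, n}` with `p ≠ q` primes, `a ≥ 2`, and `n` composite (with
`n ≠ p^a`, so `p^a` and `n` are the only composite members), then `n = q·p^b` for some
`1 ≤ b ≤ a`, and `G` is an internal direct product `G = K × A` with `K` a `{p,q}`-group
and `A` abelian. -/
theorem stmt_10 (G : Type*) [Group G] [Finite G] (p q a n : ℕ)
    (hp : p.Prime) (hq : q.Prime) (hpq : p ≠ q) (ha : 2 ≤ a)
    (hn : IsCompositeNat n) (hne : n ≠ p ^ a)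
    (hcs : csSet G = {1, q, p ^ a, n}) :
    (∃ b : ℕ, 1 ≤ b ∧ b ≤ a ∧ n = q * p ^ b) ∧
    ∃ K A : Subgroup G,
      (∀ r : ℕ, r.Prime → r ∣ Nat.card K → r = p ∨ r = q) ∧
      (∀ x ∈ A, ∀ y ∈ A, x * y = y * x) ∧
      ∃ e : (↥K × ↥A) ≃* G, ∀ (x : K) (y : A), e (x, y) = (x : G) * y := by
  have vals : ∀ g : G, (Cz g).index = 1 ∨ (Cz g).index = q ∨ (Cz g).index = p ^ a ∨
      (Cz g).index = n := by
    intro g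
    have h1 : (Cz g).index ∈ csSet G := ⟨g, rfl⟩
    rw [hcs] at h1
    simpa using h1
  have ex : ∀ k ∈ ({1, q, p ^ a, n} : Set ℕ), ∃ g : G, (Cz g).index = k := by
    intro k hk
    rw [← hcs] at hk
    obtain ⟨g, hg⟩ := hk
    exact ⟨g, hg.symm⟩
  have main : ∃ b : ℕ, 1 ≤ b ∧ b ≤ a ∧ n = q * p ^ b := by
    by_contra hcon
    push Not at hcon
    exact Hyp.contra (G := G) (p := p) (q := q) (a := a) (n := n)
      { hp := hp, hq := hq, hpq := hpq, ha := ha, hn1 := hn.1, hnp := hn.2, hne := hne,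
        vals := vals, exq := ex q (by simp), exp := ex _ (by simp), exn := ex n (by simp),
        bad := hcon }
  refine ⟨main, split_off hp hq ?_⟩
  obtain ⟨b, -, -, hb⟩ := main
  intro r hr hrp hrq g hd
  have h1 : ∀ e : ℕ, ¬ r ∣ p ^ e := fun e h => hrp (prime_eq_of_dvd_pow hr hp h)
  have h2 : ¬ r ∣ q := fun h => hrq ((Nat.prime_dvd_prime_iff_eq hr hq).1 h)
  rcases vals g with h | h | h | h <;> rw [h] at hd
  · exact hr.one_lt.ne' (Nat.dvd_one.1 hd)
  · exact h2 hd
  · exact h1 a hd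
  · rw [hb, hr.dvd_mul] at hd
    rcases hd with hd | hd
    · exact h2 hd
    · exact h1 b hd
end

section
/- Let G be a finite group with |cs(G)| = 5 such that exactly two elements of cs(G) are composite numbers, one of which is p^a for a prime p and an integer a ≥ 2. Then cs(G) = {1, p, q, p^a, n} for some prime q ≠ p, where n is the other composite class size and every prime divisor of n lies in {p, q}; moreover, G is an internal direct product G = K × A, where K is a {p,q}-group and A is abelian. -/
namespace Stmt11
open Subgroup Pointwise
variable {G : Type*} [Group G]

/-- class size -/
noncomputable def ix (g : G) : ℕ := (Subgroup.centralizer {g} : Subgroup G).index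

/-- element of `l`-power order -/
def PE (l : ℕ) (g : G) : Prop := ∃ k : ℕ, g ^ (l ^ k) = 1

lemma memC {g h : G} : h ∈ (Subgroup.centralizer {g} : Subgroup G) ↔ h * g = g * h := by
  rw [Subgroup.mem_centralizer_singleton_iff]

lemma ix_mem (g : G) : ix g ∈ csSet G := ⟨g, rfl⟩

lemma ix_ncard (g : G) : ix g = (MulAction.orbit (ConjAct G) g).ncard := by
  rw [← MulAction.index_stabilizer, ConjAct.stabilizer_eq_centralizer]
  rfl

lemma mem_orb {g h : G} : h ∈ MulAction.orbit (ConjAct G) g ↔ ∃ u : G, u * g * u⁻¹ = h := by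
  constructor
  · rintro ⟨u, rfl⟩
    exact ⟨ConjAct.ofConjAct u, rfl⟩
  · rintro ⟨u, rfl⟩
    exact ⟨ConjAct.toConjAct u, rfl⟩

lemma ix_conj (u g : G) : ix (u * g * u⁻¹) = ix g := by
  rw [ix_ncard, ix_ncard]
  congr 1
  rw [MulAction.orbit_eq_iff]
  exact mem_orb.2 ⟨u, rfl⟩

lemma ix_pos [Finite G] (g : G) : 0 < ix g := Nat.pos_of_ne_zero Subgroup.index_ne_zero_of_finite

lemma ix_dvd {g h : G} (H : (Subgroup.centralizer {g} : Subgroup G) ≤ Subgroup.centralizer {h}) :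
    ix h ∣ ix g := Subgroup.index_dvd_of_le H

lemma ix_one_iff {g : G} : ix g = 1 ↔ ∀ u, u * g = g * u := by
  unfold ix
  rw [Subgroup.index_eq_one, eq_top_iff]
  constructor
  · intro h u
    exact memC.1 (h (Subgroup.mem_top u))
  · intro h u _
    exact memC.2 (h u)

lemma ix_eq_of_le [Finite G] {g h : G} (H : (Subgroup.centralizer {g} : Subgroup G) ≤ Subgroup.centralizer {h})
    (e : ix g = ix h) : (Subgroup.centralizer {h} : Subgroup G) ≤ Subgroup.centralizer {g} := by
  have := Subgroup.relIndex_mul_index H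
  unfold ix at e
  rw [e] at this
  have h0 : (Subgroup.centralizer {h} : Subgroup G).index ≠ 0 := Subgroup.index_ne_zero_of_finite
  exact Subgroup.relIndex_eq_one.1 (Nat.eq_of_mul_eq_mul_right (Nat.pos_of_ne_zero h0) (by rw [this, one_mul]))

lemma PE.conj {l : ℕ} {g : G} (h : PE l g) (u : G) : PE l (u * g * u⁻¹) := by
  obtain ⟨k, hk⟩ := h
  exact ⟨k, by rw [conj_pow, hk]; simp⟩

lemma PE.orderOf {l : ℕ} {g : G} (h : PE l g) : ∃ k, _root_.orderOf g ∣ l ^ k := by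
  obtain ⟨k, hk⟩ := h
  exact ⟨k, orderOf_dvd_of_pow_eq_one hk⟩

lemma PE.coprime {l m : ℕ} (hl : l.Prime) (hm : m.Prime) (hlm : l ≠ m) {g h : G}
    (hg : PE l g) (hh : PE m h) : Nat.Coprime (_root_.orderOf g) (_root_.orderOf h) := by
  obtain ⟨k, hk⟩ := hg.orderOf
  obtain ⟨j, hj⟩ := hh.orderOf
  exact Nat.Coprime.of_dvd hk hj (Nat.Coprime.pow _ _ ((Nat.coprime_primes hl hm).2 hlm))

/-- coprime commuting: centralizer of product -/
lemma cent_mul {g h : G} (hc : Commute g h) (hco : Nat.Coprime (orderOf g) (orderOf h)) :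
    (Subgroup.centralizer {g * h} : Subgroup G) ≤ Subgroup.centralizer {g} ∧
    (Subgroup.centralizer {g * h} : Subgroup G) ≤ Subgroup.centralizer {h} := by
  have key : ∀ {g h : G}, Commute g h → Nat.Coprime (orderOf g) (orderOf h) →
    (Subgroup.centralizer {g * h} : Subgroup G) ≤ Subgroup.centralizer {g} := by
    intro g h hc hco u hu
    obtain ⟨k, hk1, hk2⟩ := Nat.chineseRemainder hco 1 0
    have h1 : (g * h) ^ k = g := by
      rw [hc.mul_pow, pow_eq_pow_iff_modEq.2 hk1, pow_eq_pow_iff_modEq.2 hk2]; simp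
    rw [memC] at hu ⊢
    have : Commute u (g * h) := hu
    have := this.pow_right k
    rw [h1] at this
    exact this
  refine ⟨key hc hco, ?_⟩
  rw [hc.eq]
  exact key hc.symm hco.symm

lemma ix_mul_dvd {g h : G} (hc : Commute g h) (hco : Nat.Coprime (orderOf g) (orderOf h)) :
    ix g ∣ ix (g * h) ∧ ix h ∣ ix (g * h) :=
  ⟨ix_dvd (cent_mul hc hco).1, ix_dvd (cent_mul hc hco).2⟩

/-- p-subgroups conj into subgroups of p'-index -/
lemma conj_into [Finite G] {l : ℕ} (hl : l.Prime) {H C : Subgroup G} (hH : IsPGroup l H)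
    (hC : ¬ l ∣ C.index) : ∃ u : G, ∀ h ∈ H, u⁻¹ * h * u ∈ C := by
  have := Fact.mk hl
  obtain ⟨x, hx⟩ := hH.nonempty_fixed_point_of_prime_not_dvd_card (G ⧸ C) hC
  obtain ⟨u, rfl⟩ := QuotientGroup.mk_surjective x
  refine ⟨u, fun h hh => ?_⟩
  have := hx ⟨h, hh⟩
  have h2 : ((h * u : G) : G ⧸ C) = (u : G ⧸ C) := this
  have := QuotientGroup.eq.1 h2.symm
  rwa [← mul_assoc] at this

lemma conj_comm [Finite G] {l : ℕ} (hl : l.Prime) {g h : G} (hh : PE l h)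
    (hC : ¬ l ∣ ix g) : ∃ u : G, Commute g (u * h * u⁻¹) := by
  obtain ⟨k, hk⟩ := hh
  have hP : IsPGroup l (Subgroup.zpowers h) := by
    rintro ⟨x, hx⟩
    obtain ⟨m, rfl⟩ := Subgroup.mem_zpowers_iff.1 hx
    refine ⟨k, Subtype.ext ?_⟩
    change (h ^ m) ^ (l ^ k) = 1
    rw [← zpow_natCast, ← zpow_mul, mul_comm, zpow_mul, zpow_natCast, hk, one_zpow]
  obtain ⟨u, hu⟩ := conj_into hl hP hC
  refine ⟨u⁻¹, ?_⟩
  have := memC.1 (hu h (Subgroup.mem_zpowers h))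
  rw [inv_inv]
  exact this.symm

lemma exists_PE_notMem [Finite G] {l : ℕ} (hl : l.Prime) {H : Subgroup G} (h : l ∣ H.index) :
    ∃ v, PE l v ∧ v ∉ H := by
  by_contra! hcon
  have := Fact.mk hl
  obtain ⟨P⟩ : Nonempty (Sylow l G) := inferInstance
  have hPH : (P : Subgroup G) ≤ H := by
    intro x hx
    obtain ⟨k, hk⟩ := P.2 ⟨x, hx⟩
    exact hcon x ⟨k, by simpa [Subtype.ext_iff] using hk⟩
  exact P.not_dvd_index (h.trans (Subgroup.index_dvd_of_le hPH))

lemma exists_PE_of_not_le [Finite G] {M H : Subgroup G} (h : ¬ M ≤ H) :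
    ∃ (l : ℕ) (v : G), l.Prime ∧ PE l v ∧ v ∈ M ∧ v ∉ H := by
  have : (H.subgroupOf M).index ≠ 1 := fun h1 => h (Subgroup.relIndex_eq_one.1 h1)
  obtain ⟨l, hl, hd⟩ := Nat.exists_prime_and_dvd this
  obtain ⟨⟨v, hvM⟩, ⟨k, hk⟩, hv2⟩ := exists_PE_notMem hl hd
  exact ⟨l, v, hl, ⟨k, by simpa [Subtype.ext_iff] using hk⟩, hvM, by simpa [Subgroup.mem_subgroupOf] using hv2⟩

lemma exists_primary [Finite G] {g : G} (hg : ix g ≠ 1) :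
    ∃ (l : ℕ) (v : G), l.Prime ∧ PE l v ∧ ix v ≠ 1 ∧ ix v ∣ ix g := by
  have : ¬ Subgroup.zpowers g ≤ Subgroup.center G := by
    intro h
    have := h (Subgroup.mem_zpowers g)
    rw [Subgroup.mem_center_iff] at this
    exact hg (ix_one_iff.2 this)
  obtain ⟨l, v, hl, hv, ⟨m, rfl⟩, hv2⟩ := exists_PE_of_not_le this
  refine ⟨l, _, hl, hv, ?_, ?_⟩
  · intro h
    exact hv2 (Subgroup.mem_center_iff.2 (ix_one_iff.1 h))
  · apply ix_dvd
    intro u hu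
    rw [memC] at *
    exact Commute.zpow_right hu m

lemma inf_ix_dvd {g h : G} : ix (g * h) ∣ (Subgroup.centralizer {g} ⊓ Subgroup.centralizer {h} : Subgroup G).index := by
  apply Subgroup.index_dvd_of_le
  rintro u ⟨h1, h2⟩
  have h1 : Commute u g := memC.1 h1
  have h2 : Commute u h := memC.1 h2
  exact memC.2 (h1.mul_right h2)

lemma inf_index [Finite G] {H K : Subgroup G} (hco : Nat.Coprime H.index K.index) :
    (H ⊓ K).index = H.index * K.index := by
  apply le_antisymm Subgroup.index_inf_le
  apply Nat.le_of_dvd (Nat.pos_of_ne_zero Subgroup.index_ne_zero_of_finite)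
  exact hco.mul_dvd_of_dvd_of_dvd (Subgroup.index_dvd_of_le inf_le_left) (Subgroup.index_dvd_of_le inf_le_right)

lemma mul_cover [Finite G] {H K : Subgroup G} (hco : Nat.Coprime H.index K.index) (x : G) :
    ∃ a ∈ H, ∃ b ∈ K, x = a * b := by
  have h1 : K.relIndex H = K.index := by
    have := Subgroup.relIndex_mul_index (inf_le_left : H ⊓ K ≤ H)
    rw [inf_index hco, Subgroup.inf_relIndex_left, mul_comm] at this
    exact Nat.eq_of_mul_eq_mul_left (Nat.pos_of_ne_zero Subgroup.index_ne_zero_of_finite) this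
  have h2 : MulAction.stabilizer H ((1 : G) : G ⧸ K) = K.subgroupOf H := by
    ext ⟨u, hu⟩
    rw [MulAction.mem_stabilizer_iff, Subgroup.mem_subgroupOf]
    change ((u * 1 : G) : G ⧸ K) = ((1 : G) : G ⧸ K) ↔ u ∈ K
    rw [eq_comm, QuotientGroup.eq]
    simp
  have h3 := MulAction.index_stabilizer H ((1 : G) : G ⧸ K)
  rw [h2] at h3
  have h4 : MulAction.orbit H ((1 : G) : G ⧸ K) = Set.univ := by
    apply Set.eq_of_subset_of_ncard_le (Set.subset_univ _)
    rw [← h3, Set.ncard_univ]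
    exact h1.ge
  have h5 : ((x : G) : G ⧸ K) ∈ MulAction.orbit H ((1 : G) : G ⧸ K) := h4 ▸ Set.mem_univ _
  obtain ⟨⟨a, ha⟩, hax⟩ := h5
  have h6 : ((a * 1 : G) : G ⧸ K) = (x : G ⧸ K) := hax
  refine ⟨a, ha, a⁻¹ * x, ?_, by group⟩
  have := QuotientGroup.eq.1 h6
  simpa using this

lemma simul [Finite G] {g h : G} (hco : Nat.Coprime (ix g) (ix h)) (u v : G) :
    ∃ k : G, k * g * k⁻¹ = u * g * u⁻¹ ∧ k * h * k⁻¹ = v * h * v⁻¹ := by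
  obtain ⟨a, ha, b, hb, e⟩ := mul_cover hco (u⁻¹ * v)
  rw [memC] at ha hb
  refine ⟨u * a, ?_, ?_⟩
  · have : a * g * a⁻¹ = g := by rw [ha]; group
    calc _ = u * (a * g * a⁻¹) * u⁻¹ := by group
      _ = _ := by rw [this]
  · have e2 : u * a = v * b⁻¹ := by
      have : v = u * (a * b) := by rw [← e]; group
      rw [this]; group
    have : b⁻¹ * h * b = h := by rw [mul_assoc, ← hb]; group
    calc _ = v * (b⁻¹ * h * b) * v⁻¹ := by rw [e2]; group
      _ = _ := by rw [this]

lemma stabN [Finite G] {g h : G} (hco : Nat.Coprime (ix g) (ix h)) (hle : ix (g * h) ≤ ix g) :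
    ∃ N : Subgroup G, N.Normal ∧ Nat.card N ∣ ix g ∧ ∀ u : G, (u * h * u⁻¹) * h⁻¹ ∈ N := by
  let A : Set G := MulAction.orbit (ConjAct G) g
  have hAc : ∀ a ∈ A, ∀ u : G, u * a * u⁻¹ ∈ A := by
    intro a ha u
    obtain ⟨w, rfl⟩ := mem_orb.1 ha
    exact mem_orb.2 ⟨u * w, by group⟩
  have hAc' : ∀ a, ∀ u : G, u * a * u⁻¹ ∈ A → a ∈ A := by
    intro a u h
    have := hAc _ h u⁻¹
    have e : u⁻¹ * (u * a * u⁻¹) * u⁻¹⁻¹ = a := by group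
    rwa [e] at this
  let N : Subgroup G :=
    { carrier := {k | ∀ a, a * k ∈ A ↔ a ∈ A}
      mul_mem' := by
        intro x y hx hy a
        rw [← mul_assoc, hy, hx]
      one_mem' := by intro a; simp
      inv_mem' := by
        intro x hx a
        rw [← hx (a * x⁻¹)]; simp }
  have hN : ∀ k, k ∈ N ↔ ∀ a, a * k ∈ A ↔ a ∈ A := fun k => Iff.rfl
  refine ⟨N, ⟨?_⟩, ?_, ?_⟩
  · intro n hn u
    rw [hN] at hn ⊢
    intro a
    have h1 := hn (u⁻¹ * a * u)
    have e1 : a * (u * n * u⁻¹) = u * (u⁻¹ * a * u * n) * u⁻¹ := by group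
    have e2 : u * (u⁻¹ * a * u) * u⁻¹ = a := by group
    rw [e1]
    constructor
    · intro h2
      rw [← e2]
      exact hAc _ (h1.1 (hAc' _ _ h2)) u
    · intro h2
      refine hAc _ (h1.2 ?_) u
      apply hAc' _ u
      rwa [e2]
  · have h1 := Subgroup.card_mul_eq_card_subgroup_mul_card_quotient N A
    have h2 : A * (N : Set G) = A := by
      ext x
      rw [Set.mem_mul]
      constructor
      · rintro ⟨a, ha, n, hn, rfl⟩
        exact ((hN n).1 hn a).2 ha
      · intro hx
        exact ⟨x, hx, 1, N.one_mem, by simp⟩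
    rw [h2] at h1
    rw [ix_ncard, ← Nat.card_coe_set_eq]
    exact ⟨_, h1⟩
  · let D : Set G := MulAction.orbit (ConjAct G) (g * h)
    have hD : ∀ u : G, (fun a => a * (u * h * u⁻¹)) '' A = D := by
      intro u
      apply Set.eq_of_subset_of_ncard_le
      · rintro _ ⟨a, ha, rfl⟩
        obtain ⟨w, rfl⟩ := mem_orb.1 ha
        obtain ⟨k, hk1, hk2⟩ := simul hco w u
        refine mem_orb.2 ⟨k, ?_⟩
        simp only
        rw [← hk1, ← hk2]
        group
      · rw [Set.ncard_image_of_injective _ (mul_left_injective _), ← ix_ncard, ← ix_ncard]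
        exact hle
      · exact Set.toFinite _
    intro u
    rw [hN]
    intro a
    have h1 := (hD u).trans (hD 1).symm
    have e : (1 : G) * h * 1⁻¹ = h := by group
    rw [e] at h1
    have h2 := Set.ext_iff.1 h1 (a * (u * h * u⁻¹))
    rw [(mul_left_injective (u * h * u⁻¹)).mem_set_image] at h2
    rw [h2]
    constructor
    · intro h3
      exact ⟨_, h3, by group⟩
    · rintro ⟨b, hb, hb2⟩
      have : a * (u * h * u⁻¹ * h⁻¹) = b := by
        simp only at hb2
        rw [← mul_assoc, ← hb2]; group
      rw [this]
      exact hb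

lemma N_le_cent [Finite G] {l : ℕ} (hl : l.Prime) {N : Subgroup G} (hn : N.Normal)
    (hN : IsPGroup l N) {h : G} (hh : ¬ l ∣ ix h) : ∀ n ∈ N, Commute n h := by
  obtain ⟨u, hu⟩ := conj_into hl hN hh
  intro n hnN
  have := hu (u * n * u⁻¹) (hn.conj_mem n hnN u)
  have e : u⁻¹ * (u * n * u⁻¹) * u = n := by group
  rw [e] at this
  exact memC.1 this

lemma pgroup_of_card {l i : ℕ} (hl : l.Prime) {N : Subgroup G} (h : Nat.card N ∣ l ^ i) : IsPGroup l N := by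
  have := Fact.mk hl
  obtain ⟨k, _, hk⟩ := (Nat.dvd_prime_pow hl).1 h
  exact IsPGroup.of_card hk

/-- coprime case forces centrality -/
lemma central_of_N [Finite G] {l m : ℕ} (hl : l.Prime) (hm : m.Prime) (hlm : l ≠ m) {N : Subgroup G}
    (hn : N.Normal) (hN : IsPGroup l N) {h : G} (hh : ¬ l ∣ ix h) (hm : PE m h)
    (hc : ∀ u : G, (u * h * u⁻¹) * h⁻¹ ∈ N) : ix h = 1 := by
  rw [ix_one_iff]
  intro u
  have h1 := hc u
  have h2 : Commute (u * h * u⁻¹ * h⁻¹) h := N_le_cent hl hn hN hh _ h1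
  obtain ⟨k, hk⟩ := hN ⟨_, h1⟩
  have hk : (u * h * u⁻¹ * h⁻¹) ^ l ^ k = 1 := by simpa [Subtype.ext_iff] using hk
  obtain ⟨j, hj⟩ := hm
  have h3 : (u * h * u⁻¹ * h⁻¹) ^ m ^ j = 1 := by
    have := h2.mul_pow (m ^ j)
    rw [hj, mul_one, inv_mul_cancel_right, conj_pow, hj] at this
    rw [← this]; group
  have h4 : u * h * u⁻¹ * h⁻¹ = 1 := by
    rw [← orderOf_eq_one_iff]
    exact Nat.eq_one_of_dvd_coprimes (Nat.Coprime.pow _ _ ((Nat.coprime_primes hl ‹_›).2 hlm))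
      (orderOf_dvd_of_pow_eq_one hk) (orderOf_dvd_of_pow_eq_one h3)
  have h5 := mul_inv_eq_one.1 h4
  exact mul_inv_eq_iff_eq_mul.1 h5

/-- main dichotomy for commuting elements -/
lemma lemB [Finite G] {l m p q i j : ℕ} (hl : l.Prime) (hm : m.Prime) (hp : p.Prime) (hq : q.Prime)
    (hpq : p ≠ q) {g h : G} (hg : PE l g) (hh : PE m h) (ig : ix g = p ^ i) (ih : ix h = q ^ j)
    (hi : 1 ≤ i) (hj : 1 ≤ j) (hc : Commute g h) :
    (∃ n ∈ csSet G, p ∣ n ∧ q ∣ n ∧ n ∣ p ^ i * q ^ j) ∨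
    (l = p ∧ m = p ∧ ∃ N : Subgroup G, N.Normal ∧ Nat.card N ∣ p ^ i ∧ ∀ u : G, (u * h * u⁻¹) * h⁻¹ ∈ N) ∨
    (l = q ∧ m = q ∧ ∃ N : Subgroup G, N.Normal ∧ Nat.card N ∣ q ^ j ∧ ∀ u : G, (u * g * u⁻¹) * g⁻¹ ∈ N) := by
  have hcop : Nat.Coprime (ix g) (ix h) := by
    rw [ig, ih]; exact Nat.Coprime.pow _ _ ((Nat.coprime_primes hp hq).2 hpq)
  have hd : ix (g * h) ∣ p ^ i * q ^ j := by
    have := inf_ix_dvd (g := g) (h := h)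
    rw [inf_index hcop] at this
    change _ ∣ ix g * ix h at this
    rwa [ig, ih] at this
  have hpg : p ∣ ix g := by rw [ig]; exact dvd_pow_self _ (by omega)
  have hqh : q ∣ ix h := by rw [ih]; exact dvd_pow_self _ (by omega)
  have hpi : ¬ p ∣ ix h := by
    rw [ih]; exact fun h => hpq ((Nat.prime_dvd_prime_iff_eq hp hq).1 (hp.dvd_of_dvd_pow h))
  have hqi : ¬ q ∣ ix g := by
    rw [ig]; exact fun h => hpq ((Nat.prime_dvd_prime_iff_eq hq hp).1 (hq.dvd_of_dvd_pow h)).symm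
  by_cases hlm : l = m
  swap
  · left
    have := ix_mul_dvd hc (hg.coprime hl hm hlm hh)
    exact ⟨_, ix_mem (g * h), hpg.trans this.1, hqh.trans this.2, hd⟩
  subst hlm
  by_cases h1 : p ∣ ix (g * h)
  · by_cases h2 : q ∣ ix (g * h)
    · left; exact ⟨_, ix_mem (g * h), h1, h2, hd⟩
    · right; left
      have hd2 : ix (g * h) ∣ p ^ i :=
        Nat.Coprime.dvd_of_dvd_mul_right (Nat.Coprime.pow_right _ ((Nat.Prime.coprime_iff_not_dvd hq).2 h2).symm) hd
      obtain ⟨N, hN, hNc, hNu⟩ := stabN hcop (by rw [ig]; exact Nat.le_of_dvd (pow_pos hp.pos _) hd2)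
      rw [ig] at hNc
      have hlp : l = p := by
        by_contra hne
        have := central_of_N hp hl (Ne.symm hne) hN (pgroup_of_card hp hNc) hpi hh hNu
        rw [this] at hqh
        exact hq.one_lt.ne' (Nat.dvd_one.1 hqh)
      exact ⟨hlp, hlp, N, hN, hNc, hNu⟩
  · right; right
    have hd2 : ix (g * h) ∣ q ^ j :=
        Nat.Coprime.dvd_of_dvd_mul_left (Nat.Coprime.pow_right _ ((Nat.Prime.coprime_iff_not_dvd hp).2 h1).symm) hd
    obtain ⟨N, hN, hNc, hNu⟩ := stabN hcop.symm (by rw [ih, ← hc.eq]; exact Nat.le_of_dvd (pow_pos hq.pos _) hd2)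
    rw [ih] at hNc
    have hlp : l = q := by
      by_contra hne
      have := central_of_N hq hl (Ne.symm hne) hN (pgroup_of_card hq hNc) hqi hg hNu
      rw [this] at hpg
      exact hp.one_lt.ne' (Nat.dvd_one.1 hpg)
    exact ⟨hlp, hlp, N, hN, hNc, hNu⟩

/-- dichotomy without commuting hypothesis -/
lemma lemB2 [Finite G] {l m p q i j : ℕ} (hl : l.Prime) (hm : m.Prime) (hp : p.Prime) (hq : q.Prime)
    (hpq : p ≠ q) {g h : G} (hg : PE l g) (hh : PE m h) (ig : ix g = p ^ i) (ih : ix h = q ^ j)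
    (hi : 1 ≤ i) (hj : 1 ≤ j) :
    (l = q ∧ m = p) ∨ (∃ n ∈ csSet G, p ∣ n ∧ q ∣ n ∧ n ∣ p ^ i * q ^ j) ∨
    (l = p ∧ m = p) ∨ (l = q ∧ m = q) := by
  have key : (l = q ∧ m = p) ∨ ∃ u : G, Commute g (u * h * u⁻¹) := by
    by_cases h1 : m = p
    · by_cases h2 : l = q
      · exact Or.inl ⟨h2, h1⟩
      · right
        obtain ⟨u, hu⟩ := conj_comm (g := h) hl hg (by
          rw [ih]; exact fun h => h2 ((Nat.prime_dvd_prime_iff_eq hl hq).1 (hl.dvd_of_dvd_pow h)))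
        refine ⟨u⁻¹, ?_⟩
        have := (Commute.conj_iff u⁻¹).2 hu.symm
        have e : u⁻¹ * (u * g * u⁻¹) * u⁻¹⁻¹ = g := by group
        rwa [e] at this
    · right
      exact conj_comm (g := g) hm hh (by
          rw [ig]; exact fun h => h1 ((Nat.prime_dvd_prime_iff_eq hm hp).1 (hm.dvd_of_dvd_pow h)))
  rcases key with h | ⟨u, hu⟩
  · exact Or.inl h
  · have := lemB hl hm hp hq hpq hg (hh.conj u) ig (by rw [ix_conj, ih]) hi hj hu
    rcases this with h1 | ⟨h1, h2, _⟩ | ⟨h1, h2, _⟩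
    · exact Or.inr (Or.inl h1)
    · exact Or.inr (Or.inr (Or.inl ⟨h1, h2⟩))
    · exact Or.inr (Or.inr (Or.inr ⟨h1, h2⟩))

lemma not_dvd_two {r p q i j n : ℕ} (hr : r.Prime) (hp : p.Prime) (hq : q.Prime) (hrp : r ≠ p)
    (hrq : r ≠ q) (h : n ∣ p ^ i * q ^ j) : ¬ r ∣ n := by
  intro hn
  rcases (Nat.Prime.dvd_mul hr).1 (hn.trans h) with h | h
  · exact hrp ((Nat.prime_dvd_prime_iff_eq hr hp).1 (hr.dvd_of_dvd_pow h))
  · exact hrq ((Nat.prime_dvd_prime_iff_eq hr hq).1 (hr.dvd_of_dvd_pow h))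

lemma ppow {r p i : ℕ} (hr : r.Prime) (hp : p.Prime) (hrp : r ≠ p) : ¬ r ∣ p ^ i :=
  fun h => hrp ((Nat.prime_dvd_prime_iff_eq hr hp).1 (hr.dvd_of_dvd_pow h))

/-- at most one mixed class size -/
def OneMixed (G : Type*) [Group G] : Prop := ∀ m ∈ csSet G, ∀ m' ∈ csSet G,
  ∀ r s r' s' : ℕ, r.Prime → s.Prime → r ≠ s → r'.Prime → s'.Prime → r' ≠ s' →
    r ∣ m → s ∣ m → r' ∣ m' → s' ∣ m' → m = m'

lemma lemE1 [Finite G] (H : OneMixed G) {p1 p2 p3 m i1 i2 i3 : ℕ} (hp1 : p1.Prime) (hp2 : p2.Prime)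
    (hp3 : p3.Prime) (hm : m.Prime) (h12 : p1 ≠ p2) (h13 : p1 ≠ p3) (h23 : p2 ≠ p3) {g1 g2 g3 : G}
    (hg1 : PE p1 g1) (hg2 : PE p1 g2) (hg3 : PE m g3) (e1 : ix g1 = p1 ^ i1) (e2 : ix g2 = p2 ^ i2)
    (e3 : ix g3 = p3 ^ i3) (k1 : 1 ≤ i1) (k2 : 1 ≤ i2) (k3 : 1 ≤ i3) : False := by
  obtain ⟨n, hn, hn2, hn3, hnd⟩ : ∃ n ∈ csSet G, p2 ∣ n ∧ p3 ∣ n ∧ n ∣ p2 ^ i2 * p3 ^ i3 := by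
    rcases lemB2 hp1 hm hp2 hp3 h23 hg2 hg3 e2 e3 k2 k3 with h | h | h | h
    · exact absurd h.1 h13
    · exact h
    · exact absurd h.1 h12
    · exact absurd h.1 h13
  have hn1 : ¬ p1 ∣ n := not_dvd_two hp1 hp2 hp3 h12 h13 hnd
  have hmix : ∀ n' ∈ csSet G, p1 ∣ n' → ∀ r, r.Prime → r ∣ n' → r = p1 := by
    intro n' hn' hd r hr hrn
    by_contra hne
    have := H n' hn' n hn r p1 p2 p3 hr hp1 hne hp2 hp3 h23 hrn hd hn2 hn3
    exact hn1 (this ▸ hd)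
  obtain ⟨w, hw, hwn⟩ := exists_PE_notMem hp2 (H := Subgroup.centralizer {g2}) (by
    change p2 ∣ ix g2
    rw [e2]; exact dvd_pow_self _ (by omega))
  have hw1 : ix w ≠ 1 := by
    intro h
    rw [ix_one_iff] at h
    exact hwn (memC.2 (h g2).symm)
  by_cases hd : p1 ∣ ix w
  · have hpow : ∃ c, ix w = p1 ^ c := by
      refine ⟨_, Nat.eq_prime_pow_of_unique_prime_dvd (ix_pos w).ne' ?_⟩
      intro r hr hrd
      exact hmix _ (ix_mem w) hd r hr hrd
    obtain ⟨c, hc⟩ := hpow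
    have hc1 : 1 ≤ c := by
      rcases Nat.eq_zero_or_pos c with h | h
      · subst h; exact absurd hc hw1
      · exact h
    rcases lemB2 hp2 hm hp1 hp3 h13 hw hg3 hc e3 hc1 k3 with h | ⟨n', hn', h1, h2, _⟩ | h | h
    · exact h23 h.1
    · exact h13 (hmix n' hn' h1 p3 hp3 h2).symm
    · exact h12 h.1.symm
    · exact h23 h.1
  · obtain ⟨u, hu⟩ := conj_comm hp1 hg1 hd
    have hdv := ix_mul_dvd hu (hw.coprime hp2 hp1 h12.symm (hg1.conj u))
    obtain ⟨r, hr, hrd⟩ := Nat.exists_prime_and_dvd hw1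
    have h1 : p1 ∣ ix (w * (u * g1 * u⁻¹)) := by
      refine dvd_trans ?_ hdv.2
      rw [ix_conj, e1]; exact dvd_pow_self _ (by omega)
    have := hmix _ (ix_mem _) h1 r hr (hrd.trans hdv.1)
    exact hd (this ▸ hrd)

lemma lemE [Finite G] (H : OneMixed G) {p1 p2 p3 l1 l2 l3 i1 i2 i3 : ℕ} (hp1 : p1.Prime) (hp2 : p2.Prime)
    (hp3 : p3.Prime) (hl1 : l1.Prime) (hl2 : l2.Prime) (hl3 : l3.Prime)
    (h12 : p1 ≠ p2) (h13 : p1 ≠ p3) (h23 : p2 ≠ p3) {g1 g2 g3 : G}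
    (hg1 : PE l1 g1) (hg2 : PE l2 g2) (hg3 : PE l3 g3) (e1 : ix g1 = p1 ^ i1) (e2 : ix g2 = p2 ^ i2)
    (e3 : ix g3 = p3 ^ i3) (k1 : 1 ≤ i1) (k2 : 1 ≤ i2) (k3 : 1 ≤ i3) : False := by
  rcases lemB2 hl1 hl2 hp1 hp2 h12 hg1 hg2 e1 e2 k1 k2 with a | a | a | a
  rotate_left 2
  · rw [a.1] at hg1; rw [a.2] at hg2
    exact lemE1 H hp1 hp2 hp3 hl3 h12 h13 h23 hg1 hg2 hg3 e1 e2 e3 k1 k2 k3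
  · rw [a.1] at hg1; rw [a.2] at hg2
    exact lemE1 H hp2 hp1 hp3 hl3 h12.symm h23 h13 hg2 hg1 hg3 e2 e1 e3 k2 k1 k3
  all_goals
    rcases lemB2 hl1 hl3 hp1 hp3 h13 hg1 hg3 e1 e3 k1 k3 with b | b | b | b
    rotate_left 2
    · rw [b.1] at hg1; rw [b.2] at hg3
      exact lemE1 H hp1 hp3 hp2 hl2 h13 h12 h23.symm hg1 hg3 hg2 e1 e3 e2 k1 k3 k2
    · rw [b.1] at hg1; rw [b.2] at hg3
      exact lemE1 H hp3 hp1 hp2 hl2 h13.symm h23.symm h12 hg3 hg1 hg2 e3 e1 e2 k3 k1 k2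
  all_goals
    rcases lemB2 hl2 hl3 hp2 hp3 h23 hg2 hg3 e2 e3 k2 k3 with c | c | c | c
    rotate_left 2
    · rw [c.1] at hg2; rw [c.2] at hg3
      exact lemE1 H hp2 hp3 hp1 hl1 h23 h12.symm h13.symm hg2 hg3 hg1 e2 e3 e1 k2 k3 k1
    · rw [c.1] at hg2; rw [c.2] at hg3
      exact lemE1 H hp3 hp2 hp1 hl1 h23.symm h13.symm h12.symm hg3 hg2 hg1 e3 e2 e1 k3 k2 k1
  · exact h23 (a.1.symm.trans b.1)
  · exact h23 (a.1.symm.trans b.1)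
  · exact h13 (a.2.symm.trans c.1)
  · obtain ⟨n, hn, n1, n2, n3⟩ := b
    obtain ⟨n', hn', n1', n2', n3'⟩ := c
    have := H n hn n' hn' p1 p3 p2 p3 hp1 hp3 h13 hp2 hp3 h23 n1 n2 n1' n2'
    exact not_dvd_two hp1 hp2 hp3 h12 h13 n3' (this ▸ n1)
  · exact h12 (b.2.symm.trans c.2)
  · obtain ⟨n, hn, n1, n2, n3⟩ := a
    obtain ⟨n', hn', n1', n2', n3'⟩ := c
    have := H n hn n' hn' p1 p2 p2 p3 hp1 hp2 h12 hp2 hp3 h23 n1 n2 n1' n2'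
    exact not_dvd_two hp1 hp2 hp3 h12 h13 n3' (this ▸ n1)
  · obtain ⟨n, hn, n1, n2, n3⟩ := a
    obtain ⟨n', hn', n1', n2', n3'⟩ := b
    have := H n hn n' hn' p1 p2 p1 p3 hp1 hp2 h12 hp1 hp3 h13 n1 n2 n1' n2'
    exact not_dvd_two hp2 hp1 hp3 h12.symm h23 n3' (this ▸ n2)
  · obtain ⟨n, hn, n1, n2, n3⟩ := a
    obtain ⟨n', hn', n1', n2', n3'⟩ := b
    have := H n hn n' hn' p1 p2 p1 p3 hp1 hp2 h12 hp1 hp3 h13 n1 n2 n1' n2'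
    exact not_dvd_two hp2 hp1 hp3 h12.symm h23 n3' (this ▸ n2)

lemma cent_normal [Finite G] {l : ℕ} (hl : l.Prime) {N : Subgroup G} (hn : N.Normal)
    (hN : Nat.card N ∣ l) {h : G} (hh : ¬ l ∣ ix h) (hc : ∀ u : G, (u * h * u⁻¹) * h⁻¹ ∈ N) :
    (Subgroup.centralizer {h} : Subgroup G).Normal := by
  have hM : Subgroup.centralizer (N : Set G) ≤ Subgroup.centralizer {h} := by
    by_contra hcon
    obtain ⟨r, m, hr, hm, hmM, hmh⟩ := exists_PE_of_not_le hcon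
    have hmc : ∀ n ∈ N, Commute n m := fun n hn => Subgroup.mem_centralizer_iff.1 hmM n hn
    by_cases hrl : r = l
    · subst hrl
      obtain ⟨u, hu⟩ := conj_comm hr hm hh
      have h1 := (Commute.conj_iff u⁻¹).2 hu
      have e : u⁻¹ * (u * m * u⁻¹) * u⁻¹⁻¹ = m := by group
      rw [e] at h1
      have h2 := hmc _ (hc u⁻¹)
      have h3 := h2.inv_left.mul_left h1
      have e : (u⁻¹ * h * u⁻¹⁻¹ * h⁻¹)⁻¹ * (u⁻¹ * h * u⁻¹⁻¹) = h := by group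
      rw [e] at h3
      exact hmh (memC.2 h3.symm)
    · have h1 := hc m
      have h2 : Commute (m * h * m⁻¹ * h⁻¹) m := hmc _ h1
      set n := m * h * m⁻¹ * h⁻¹ with hndef
      have h3 : m * h * m⁻¹ = n * h := by rw [hndef]; group
      have h4 : ∀ k : ℕ, m ^ k * h * (m ^ k)⁻¹ = n ^ k * h := by
        intro k
        induction k with
        | zero => simp
        | succ k ih =>
          calc m ^ (k + 1) * h * (m ^ (k + 1))⁻¹ = m * (m ^ k * h * (m ^ k)⁻¹) * m⁻¹ := by
                rw [pow_succ']; group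
            _ = (m * n ^ k) * h * m⁻¹ := by rw [ih]; group
            _ = n ^ k * (m * h * m⁻¹) := by rw [← (h2.pow_left k).eq]; group
            _ = _ := by rw [h3, pow_succ]; group
      obtain ⟨j, hj⟩ := hm
      have h5 := h4 (r ^ j)
      rw [hj] at h5
      have h6 : n ^ (r ^ j) = 1 := by
        have : n ^ (r ^ j) * h = h := by rw [← h5]; group
        exact mul_eq_right.1 this
      have h7 : orderOf n ∣ l := by
        have := (orderOf_dvd_natCard (⟨n, h1⟩ : N)).trans hN
        rwa [Subgroup.orderOf_mk] at this
      have h8 : n = 1 := by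
        rw [← orderOf_eq_one_iff]
        exact Nat.eq_one_of_dvd_coprimes (Nat.Coprime.pow_left j ((Nat.coprime_primes hr hl).2 hrl))
          (orderOf_dvd_of_pow_eq_one h6) h7
      rw [h8, one_mul] at h3
      exact hmh (memC.2 (mul_inv_eq_iff_eq_mul.1 h3))
  have hcyc : IsCyclic N := by
    rcases (Nat.dvd_prime hl).1 hN with h1 | h1
    · have : Subsingleton N := (Nat.card_eq_one_iff_unique.1 h1).1
      infer_instance
    · have := Fact.mk hl
      exact isCyclic_of_prime_card h1
  refine ⟨fun v hv u => ?_⟩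
  have hcm : u * v * u⁻¹ * v⁻¹ ∈ Subgroup.centralizer (N : Set G) := by
    rw [Subgroup.mem_centralizer_iff]
    have hpow : ∀ x : G, ∃ a : ℤ, ∀ n ∈ N, x * n * x⁻¹ = n ^ a := by
      intro x
      obtain ⟨a, ha⟩ := MonoidHom.map_cyclic (MulAut.conjNormal (H := N) x).toMonoidHom
      refine ⟨a, fun n hn => ?_⟩
      have := congrArg Subtype.val (ha ⟨n, hn⟩)
      simpa using this
    intro n hn
    obtain ⟨a, ha⟩ := hpow u
    obtain ⟨b, hb⟩ := hpow v
    have f2 : ∀ n ∈ N, u * v * u⁻¹ * v⁻¹ * n * (u * v * u⁻¹ * v⁻¹)⁻¹ = n := by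
      intro n hn
      have hmem : u⁻¹ * v⁻¹ * n * v * u ∈ N := by
        have := ‹N.Normal›.conj_mem n hn (u⁻¹ * v⁻¹)
        have e : u⁻¹ * v⁻¹ * n * (u⁻¹ * v⁻¹)⁻¹ = u⁻¹ * v⁻¹ * n * v * u := by group
        rwa [e] at this
      obtain ⟨n', hn', rfl⟩ : ∃ n' ∈ N, v * u * n' * u⁻¹ * v⁻¹ = n := ⟨_, hmem, by group⟩
      have f1 : u * v * n' * v⁻¹ * u⁻¹ = v * u * n' * u⁻¹ * v⁻¹ := by
        calc u * v * n' * v⁻¹ * u⁻¹ = u * (v * n' * v⁻¹) * u⁻¹ := by group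
          _ = (n' ^ b) ^ a := by rw [hb n' hn', ha _ (N.zpow_mem hn' b)]
          _ = (n' ^ a) ^ b := by rw [← zpow_mul, ← zpow_mul, mul_comm]
          _ = v * (u * n' * u⁻¹) * v⁻¹ := by rw [ha n' hn', hb _ (N.zpow_mem hn' a)]
          _ = _ := by group
      refine Eq.trans ?_ f1
      group
    exact (mul_inv_eq_iff_eq_mul.1 (f2 n hn)).symm
  have := (Subgroup.centralizer {h}).mul_mem (hM hcm) hv
  have e : u * v * u⁻¹ * v⁻¹ * v = u * v * u⁻¹ := by group
  rwa [e] at this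

/-- setting for the argument with a third prime -/
structure FH (G : Type*) [Group G] (t n p q : ℕ) : Prop where
  ht : t.Prime
  hp : p.Prime
  hq : q.Prime
  htp : t ≠ p
  htq : t ≠ q
  hpq : p ≠ q
  pmem : p ∈ csSet G
  qmem : q ∈ csSet G
  nmem : n ∈ csSet G
  tn : t ∣ n
  un : ∀ m ∈ csSet G, t ∣ m → m = n
  pp : ∀ m ∈ csSet G, ¬ t ∣ m → ∃ c, m = p ^ c ∨ m = q ^ c

lemma FH.symm {t n p q : ℕ} (h : FH G t n p q) : FH G t n q p :=
  ⟨h.ht, h.hq, h.hp, h.htq, h.htp, h.hpq.symm, h.qmem, h.pmem, h.nmem, h.tn, h.un,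
    fun m hm ht => (h.pp m hm ht).imp fun _ h => h.symm⟩

lemma FH.nomix {t n p q m i j : ℕ} (h : FH G t n p q) (hm : m ∈ csSet G) (hd : m ∣ p ^ i * q ^ j)
    (h1 : p ∣ m) (h2 : q ∣ m) : False := by
  obtain ⟨c, rfl | rfl⟩ := h.pp m hm (not_dvd_two h.ht h.hp h.hq h.htp h.htq hd)
  · exact ppow h.hq h.hp h.hpq.symm h2
  · exact ppow h.hp h.hq h.hpq h1

lemma prim_of_prime [Finite G] {p : ℕ} (hp : p.Prime) (h : p ∈ csSet G) :
    ∃ (l : ℕ) (g : G), l.Prime ∧ PE l g ∧ ix g = p ^ 1 := by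
  obtain ⟨g, hg⟩ := h
  have hg : ix g = p := hg.symm
  obtain ⟨l, v, hl, hv, h1, h2⟩ := exists_primary (g := g) (by rw [hg]; exact hp.one_lt.ne')
  refine ⟨l, v, hl, hv, ?_⟩
  rw [hg] at h2
  rw [pow_one]
  exact ((Nat.dvd_prime hp).1 h2).resolve_left h1

lemma exp_pos {m p c : ℕ} (h : m = p ^ c) (h1 : m ≠ 1) : 1 ≤ c := by
  rcases Nat.eq_zero_or_pos c with h2 | h2
  · subst h2; exact absurd h h1
  · exact h2

lemma FH.tel_aux [Finite G] {t n p q c : ℕ} (H : FH G t n p q) {w : G} (hw : PE t w) (h1 : ix w ≠ 1)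
    (hc : ix w = p ^ c) : False := by
  obtain ⟨l, y, hl, hy, ey⟩ := prim_of_prime H.hq H.qmem
  rcases lemB2 H.ht hl H.hp H.hq H.hpq hw hy hc ey (exp_pos hc h1) le_rfl with h | ⟨m, hm, m1, m2, m3⟩ | h | h
  · exact H.htq h.1
  · exact H.nomix hm m3 m1 m2
  · exact H.htp h.1
  · exact H.htq h.1

lemma FH.tel_dvd [Finite G] {t n p q : ℕ} (H : FH G t n p q) {w : G} (hw : PE t w) (h1 : ix w ≠ 1) :
    t ∣ ix w := by
  by_contra hd
  obtain ⟨c, hc | hc⟩ := H.pp _ (ix_mem w) hd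
  · exact H.tel_aux hw h1 hc
  · exact H.symm.tel_aux hw h1 hc

lemma FH.tel [Finite G] {t n p q : ℕ} (H : FH G t n p q) {w : G} (hw : PE t w) (h1 : ix w ≠ 1) :
    ix w = n := H.un _ (ix_mem w) (H.tel_dvd hw h1)

lemma FH.exw [Finite G] {t n p q : ℕ} (H : FH G t n p q) : ∃ w : G, PE t w ∧ ix w ≠ 1 := by
  obtain ⟨u, hu⟩ := H.nmem
  obtain ⟨w, hw, hw2⟩ := exists_PE_notMem H.ht (H := Subgroup.centralizer {u}) (hu ▸ H.tn)
  refine ⟨w, hw, fun h => hw2 (memC.2 ?_)⟩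
  exact (ix_one_iff.1 h u).symm

lemma FH.cent_le [Finite G] {t n p q m : ℕ} (H : FH G t n p q) {w g : G} (hw : PE t w) (h1 : ix w ≠ 1)
    (hm : m.Prime) (hmt : m ≠ t) (hg : PE m g) (hc : Commute g w) :
    (Subgroup.centralizer {w} : Subgroup G) ≤ Subgroup.centralizer {g} := by
  have := cent_mul hc (hg.coprime hm H.ht hmt hw)
  have e : ix (g * w) = n := H.un _ (ix_mem _) ((H.tel_dvd hw h1).trans (ix_dvd this.2))
  exact (ix_eq_of_le this.2 (e.trans (H.tel hw h1).symm)).trans this.1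

lemma FH.comm [Finite G] {t n p q l m : ℕ} (H : FH G t n p q) {g h : G} (hl : l.Prime) (hm : m.Prime)
    (hg : PE l g) (hh : PE m h) (g1 : ix g ≠ 1) (h1 : ix h ≠ 1) (gt : ¬ t ∣ ix g) (ht : ¬ t ∣ ix h) :
    ∃ u : G, Commute g (u * h * u⁻¹) := by
  have hlt : l ≠ t := by rintro rfl; exact gt (H.tel_dvd hg g1)
  have hmt : m ≠ t := by rintro rfl; exact ht (H.tel_dvd hh h1)
  obtain ⟨w, hw, w1⟩ := H.exw
  obtain ⟨a, ha⟩ := conj_comm H.ht hw gt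
  obtain ⟨b, hb⟩ := conj_comm H.ht (hw.conj a) ht
  refine ⟨b⁻¹, ?_⟩
  have h2 := (Commute.conj_iff b⁻¹).2 hb
  have e : b⁻¹ * (b * (a * w * a⁻¹) * b⁻¹) * b⁻¹⁻¹ = a * w * a⁻¹ := by group
  rw [e] at h2
  have h3 := H.cent_le (hw.conj a) (by rwa [ix_conj]) hl hlt hg ha (memC.2 h2)
  exact (memC.1 h3).symm

lemma FH.same [Finite G] {t n p q l m i j : ℕ} (H : FH G t n p q) {g h : G} (hl : l.Prime) (hm : m.Prime)
    (hg : PE l g) (hh : PE m h) (g1 : ix g ≠ 1) (h1 : ix h ≠ 1) (ig : ix g = p ^ i) (ih : ix h = q ^ j) :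
    l = m := by
  obtain ⟨u, hu⟩ := H.comm hl hm hg hh g1 h1 (ig ▸ ppow H.ht H.hp H.htp) (ih ▸ ppow H.ht H.hq H.htq)
  rcases lemB hl hm H.hp H.hq H.hpq hg (hh.conj u) ig (by rw [ix_conj, ih]) (exp_pos ig g1) (exp_pos ih h1) hu
    with ⟨m, hm, m1, m2, m3⟩ | h | h
  · exact (H.nomix hm m3 m1 m2).elim
  · exact h.1.trans h.2.1.symm
  · exact h.1.trans h.2.1.symm

lemma FH.fin [Finite G] {t n p q : ℕ} (H : FH G t n p q) {g h : G}
    (hg : PE p g) (hh : PE p h) (ig : ix g = p ^ 1) (ih : ix h = q ^ 1) (N : Subgroup G)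
    (hN : N.Normal) (hNc : Nat.card N ∣ p ^ 1) (hc : ∀ u : G, (u * h * u⁻¹) * h⁻¹ ∈ N) : False := by
  have hnorm := cent_normal H.hp hN (by simpa using hNc) (ih ▸ ppow H.hp H.hq H.hpq) hc
  have g1 : ix g ≠ 1 := by rw [ig, pow_one]; exact H.hp.one_lt.ne'
  have h1 : ix h ≠ 1 := by rw [ih, pow_one]; exact H.hq.one_lt.ne'
  obtain ⟨v, hv, hvh⟩ := exists_PE_notMem H.hq (H := Subgroup.centralizer {h}) (by
    change q ∣ ix h
    rw [ih, pow_one])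
  have v1 : ix v ≠ 1 := fun e => hvh (memC.2 (ix_one_iff.1 e h).symm)
  have vn : ix v = n := by
    by_contra hne
    obtain ⟨c, e | e⟩ := H.pp _ (ix_mem v) (fun hd => hne (H.un _ (ix_mem v) hd))
    · exact H.hpq (H.same H.hq H.hp hv hh v1 h1 e ih).symm
    · exact H.hpq (H.same H.hp H.hq hg hv g1 v1 ig e)
  obtain ⟨w, hw, w1⟩ := H.exw
  have wn := H.tel hw w1
  -- a noncentral t-element commuting with v
  obtain ⟨w', hw', w1', hcw⟩ : ∃ w' : G, PE t w' ∧ ix w' ≠ 1 ∧ Commute w' v := by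
    by_contra! hcon
    have := Fact.mk H.ht
    obtain ⟨S⟩ : Nonempty (Sylow t (Subgroup.centralizer {v} : Subgroup G)) := inferInstance
    obtain ⟨Q⟩ : Nonempty (Sylow t (Subgroup.centralizer {w} : Subgroup G)) := inferInstance
    have hcardeq : Nat.card (Subgroup.centralizer {v} : Subgroup G) =
        Nat.card (Subgroup.centralizer {w} : Subgroup G) := by
      have a1 := Subgroup.card_mul_index (Subgroup.centralizer {v} : Subgroup G)
      have a2 := Subgroup.card_mul_index (Subgroup.centralizer {w} : Subgroup G)
      change _ * ix v = _ at a1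
      change _ * ix w = _ at a2
      rw [vn] at a1; rw [wn] at a2
      refine Nat.eq_of_mul_eq_mul_right (m := n) ?_ (a1.trans a2.symm)
      rw [← wn]; exact ix_pos w
    have hSQ : Nat.card S = Nat.card Q := by
      rw [S.card_eq_multiplicity, Q.card_eq_multiplicity, hcardeq]
    -- w lies in a Sylow of its centralizer
    have hScen : ∀ s : (Subgroup.centralizer {v} : Subgroup G), s ∈ S → ∀ u, u * (s : G) = s * u := by
      intro s hs
      rw [← ix_one_iff]
      by_contra hne
      obtain ⟨k, hk⟩ := S.2 ⟨s, hs⟩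
      have hk : (s : G) ^ t ^ k = 1 := by
        have := congrArg (fun x : S => ((x : (Subgroup.centralizer {v} : Subgroup G)) : G)) hk
        simpa using this
      exact hcon s ⟨k, hk⟩ hne (memC.1 s.2)
    let T : Subgroup G := (S : Subgroup (Subgroup.centralizer {v} : Subgroup G)).map
      (Subgroup.subtype _)
    have hTcard : Nat.card T = Nat.card S := Subgroup.card_map_of_injective (Subgroup.subtype_injective _)
    have hTcen : ∀ s ∈ T, ∀ u, u * s = s * u := by
      rintro _ ⟨s, hs, rfl⟩
      exact hScen s hs
    have hTp : IsPGroup t T := S.2.map _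
    have hTw : T ≤ Subgroup.centralizer {w} := fun s hs => memC.2 (hTcen s hs w).symm
    let T' : Subgroup (Subgroup.centralizer {w} : Subgroup G) := T.subgroupOf _
    have hT'p : IsPGroup t T' := by
      rintro ⟨s, hs⟩
      obtain ⟨k, hk⟩ := hTp ⟨s, hs⟩
      refine ⟨k, ?_⟩
      have hk : (s : G) ^ t ^ k = 1 := by simpa [Subtype.ext_iff] using hk
      apply Subtype.ext
      apply Subtype.ext
      simpa using hk
    have hT'card : Nat.card T' = Nat.card T := Nat.card_congr (Subgroup.subgroupOfEquivOfLe hTw).toEquiv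
    have hT'n : T'.Normal := by
      refine ⟨fun s hs u => ?_⟩
      have : u * s * u⁻¹ = s := by
        have := hTcen s hs u
        apply Subtype.ext
        simp [this]
      rwa [this]
    let W : Subgroup (Subgroup.centralizer {w} : Subgroup G) := Subgroup.zpowers ⟨w, memC.2 rfl⟩
    have hWp : IsPGroup t W := by
      obtain ⟨k, hk⟩ := hw
      rintro ⟨x, hx⟩
      obtain ⟨m, rfl⟩ := Subgroup.mem_zpowers_iff.1 hx
      refine ⟨k, ?_⟩
      apply Subtype.ext
      apply Subtype.ext
      change (w ^ m) ^ (t ^ k) = 1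
      rw [← zpow_natCast, ← zpow_mul, mul_comm, zpow_mul, zpow_natCast, hk, one_zpow]
    have hsup : IsPGroup t (T' ⊔ W : Subgroup _) := hT'p.to_sup_of_normal_left hWp
    obtain ⟨Q', hQ'⟩ := hsup.exists_le_sylow
    have hle : T' ≤ Q' := le_sup_left.trans hQ'
    have hcQ : Nat.card Q' = Nat.card Q := by
      rw [Q'.card_eq_multiplicity, Q.card_eq_multiplicity]
    have heq : T' = Q' := by
      apply Subgroup.eq_of_le_of_card_ge hle
      exact (hcQ.trans (hSQ.symm.trans (hTcard.symm.trans hT'card.symm))).le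
    have hwT : w ∈ T := by
      have h2 : (⟨w, memC.2 rfl⟩ : (Subgroup.centralizer {w} : Subgroup G)) ∈ T' := by
        rw [heq]
        exact hQ' (le_sup_right (a := T') (Subgroup.mem_zpowers _))
      exact h2
    exact w1 (ix_one_iff.2 (hTcen w hwT))
  have hwh : Commute h w' := by
    obtain ⟨u, hu⟩ := conj_comm (g := h) H.ht hw' (ih ▸ ppow H.ht H.hq H.htq)
    have := hnorm.conj_mem _ (memC.2 hu.symm) u⁻¹
    have e : u⁻¹ * (u * w' * u⁻¹) * u⁻¹⁻¹ = w' := by group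
    rw [e] at this
    exact (memC.1 this).symm
  exact hvh (H.cent_le hw' w1' H.hp H.htp.symm hh hwh (memC.2 hcw.symm))

lemma FH.false [Finite G] {t n p q : ℕ} (H : FH G t n p q) : False := by
  obtain ⟨l, g, hl, hg, ig⟩ := prim_of_prime H.hp H.pmem
  obtain ⟨m, h, hm, hh, ih⟩ := prim_of_prime H.hq H.qmem
  have g1 : ix g ≠ 1 := by rw [ig, pow_one]; exact H.hp.one_lt.ne'
  have h1 : ix h ≠ 1 := by rw [ih, pow_one]; exact H.hq.one_lt.ne'
  obtain ⟨u, hu⟩ := H.comm hl hm hg hh g1 h1 (ig ▸ ppow H.ht H.hp H.htp) (ih ▸ ppow H.ht H.hq H.htq)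
  have ih' : ix (u * h * u⁻¹) = q ^ 1 := by rw [ix_conj, ih]
  rcases lemB hl hm H.hp H.hq H.hpq hg (hh.conj u) ig ih' le_rfl le_rfl hu
    with ⟨m, hm, m1, m2, m3⟩ | ⟨rfl, rfl, N, n1, n2, n3⟩ | ⟨rfl, rfl, N, n1, n2, n3⟩
  · exact H.nomix hm m3 m1 m2
  · exact H.fin hg (hh.conj u) ig ih' N n1 n2 n3
  · exact H.symm.fin (hh.conj u) hg ih' ig N n1 n2 n3

lemma central_of_cover [Finite G] {w : G} (h : ∀ g : G, ∃ u : G, Commute g (u * w * u⁻¹)) : ix w = 1 := by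
  classical
  have := Fintype.ofFinite G
  let C : Subgroup G := Subgroup.centralizer {w}
  have := Fintype.ofFinite (G ⧸ C)
  have := Fintype.ofFinite (MulAction.orbitRel.Quotient G (G ⧸ C))
  have hB := MulAction.sum_card_fixedBy_eq_card_orbits_mul_card_group G (G ⧸ C)
  have h1 : Fintype.card (MulAction.orbitRel.Quotient G (G ⧸ C)) = 1 := by
    have : Subsingleton (MulAction.orbitRel.Quotient G (G ⧸ C)) := by
      have := (MulAction.pretransitive_iff_subsingleton_quotient G (G ⧸ C)).1 inferInstance
      exact this
    exact le_antisymm (Fintype.card_le_one_iff_subsingleton.2 this)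
      (Fintype.card_pos_iff.2 ⟨Quotient.mk'' ((1 : G) : G ⧸ C)⟩)
  rw [h1, one_mul] at hB
  have hpos : ∀ g : G, 1 ≤ Fintype.card (MulAction.fixedBy (G ⧸ C) g) := by
    intro g
    obtain ⟨u, hu⟩ := h g
    refine Fintype.card_pos_iff.2 ⟨⟨((u : G) : G ⧸ C), ?_⟩⟩
    rw [MulAction.mem_fixedBy]
    change ((g * u : G) : G ⧸ C) = (u : G ⧸ C)
    rw [eq_comm, QuotientGroup.eq]
    apply memC.2
    have h2 := (Commute.conj_iff u⁻¹).2 hu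
    have e : u⁻¹ * (u * w * u⁻¹) * u⁻¹⁻¹ = w := by group
    rw [e] at h2
    have e : u⁻¹ * g * u⁻¹⁻¹ = u⁻¹ * (g * u) := by group
    rw [e] at h2
    exact h2
  have hsum : ∑ g : G, (1 : ℕ) = ∑ g : G, Fintype.card (MulAction.fixedBy (G ⧸ C) g) := by
    rw [hB]; simp
  have h2 := (Finset.sum_eq_sum_iff_of_le (fun g _ => hpos g)).1 hsum 1 (Finset.mem_univ _)
  have h3 : MulAction.fixedBy (G ⧸ C) (1 : G) = Set.univ := by
    ext x; simp
  have h4 : Fintype.card (MulAction.fixedBy (G ⧸ C) (1 : G)) = Fintype.card (G ⧸ C) := by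
    rw [← Nat.card_eq_fintype_card, ← Nat.card_eq_fintype_card, h3, Nat.card_coe_set_eq, Set.ncard_univ]
  change Nat.card (G ⧸ C) = 1
  rw [Nat.card_eq_fintype_card, ← h4, ← h2]

lemma decomp [Finite G] {p q : ℕ} (hp : p.Prime) (hq : q.Prime)
    (H : ∀ m ∈ csSet G, ∀ r : ℕ, r.Prime → r ∣ m → r = p ∨ r = q) :
    ∃ K A : Subgroup G,
        (∀ r : ℕ, r.Prime → r ∣ Nat.card K → r = p ∨ r = q) ∧
        (∀ x ∈ A, ∀ y ∈ A, x * y = y * x) ∧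
        ∃ e : (↥K × ↥A) ≃* G, ∀ (x : K) (y : A), e (x, y) = (x : G) * y := by
  have hcen : ∀ r : ℕ, r.Prime → r ≠ p → r ≠ q → ∀ w : G, PE r w → ∀ u, u * w = w * u := by
    intro r hr h1 h2 w hw
    rw [← ix_one_iff]
    apply central_of_cover
    intro g
    apply conj_comm hr hw
    intro hd
    rcases H _ (ix_mem g) r hr hd with h | h
    · exact h1 h
    · exact h2 h
  let A : Subgroup G :=
    { carrier := {x | (∀ u, u * x = x * u) ∧ Nat.Coprime (orderOf x) (p * q)}
      one_mem' := by simp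
      mul_mem' := by
        rintro x y ⟨hx, hx2⟩ ⟨hy, hy2⟩
        refine ⟨fun u => ?_, ?_⟩
        · rw [← mul_assoc, hx, mul_assoc, hy, mul_assoc]
        · have : Commute x y := hy x
          exact Nat.Coprime.of_dvd_left this.orderOf_mul_dvd_mul_orderOf (hx2.mul_left hy2)
      inv_mem' := by
        rintro x ⟨hx, hx2⟩
        refine ⟨fun u => ?_, by rwa [orderOf_inv]⟩
        have : Commute u x := hx u
        exact this.inv_right }
  have hA : ∀ x, x ∈ A ↔ (∀ u, u * x = x * u) ∧ Nat.Coprime (orderOf x) (p * q) := fun x => Iff.rfl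
  have hAn : A.Normal := by
    refine ⟨fun x hx u => ?_⟩
    rwa [((hA x).1 hx).1 u, mul_inv_cancel_right]
  have hind : ∀ r : ℕ, r.Prime → r ∣ A.index → r = p ∨ r = q := by
    intro r hr hd
    by_contra! hne
    obtain ⟨v, hv, hvA⟩ := exists_PE_notMem hr hd
    apply hvA
    rw [hA]
    refine ⟨hcen r hr hne.1 hne.2 v hv, ?_⟩
    obtain ⟨k, hk⟩ := hv.orderOf
    refine Nat.Coprime.of_dvd_left hk (Nat.Coprime.pow_left _ ?_)
    exact ((Nat.coprime_primes hr hp).2 hne.1).mul_right ((Nat.coprime_primes hr hq).2 hne.2)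
  have hAcard : ∀ r : ℕ, r.Prime → r ∣ Nat.card A → ¬ (r = p ∨ r = q) := by
    intro r hr hd hor
    have := Fact.mk hr
    obtain ⟨x, hx⟩ := exists_prime_orderOf_dvd_card' r hd
    have h1 := ((hA x).1 x.2).2
    rw [Subgroup.orderOf_coe, hx] at h1
    have h2 : r ∣ p * q := by
      rcases hor with rfl | rfl
      · exact dvd_mul_right _ _
      · exact dvd_mul_left _ _
    exact hr.one_lt.ne' (Nat.eq_one_of_dvd_coprimes h1 dvd_rfl h2)
  have hco : Nat.Coprime (Nat.card A) A.index := by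
    apply Nat.coprime_of_dvd
    intro r hr h1 h2
    exact hAcard r hr h1 (hind r hr h2)
  obtain ⟨K, hK⟩ := Subgroup.exists_right_complement'_of_coprime hco
  refine ⟨K, A, ?_, ?_, ?_⟩
  · intro r hr hd
    rw [← hK.symm.index_eq_card] at hd
    exact hind r hr hd
  · intro x _ y hy
    exact ((hA y).1 hy).1 x
  · let f : (↥K × ↥A) →* G :=
      { toFun := fun z => (z.1 : G) * z.2
        map_one' := by simp
        map_mul' := by
          rintro ⟨a, b⟩ ⟨c, d⟩
          have := ((hA b).1 b.2).1 c
          simp only [Prod.mk_mul_mk, Subgroup.coe_mul]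
          calc (a : G) * c * (b * d) = a * (c * b) * d := by group
            _ = _ := by rw [this]; group }
    have hf : Function.Bijective f := hK.symm
    exact ⟨MulEquiv.ofBijective f hf, fun x y => rfl⟩

end Stmt11

/-- If `|cs(G)| = 5` and exactly two members of `cs(G)` are composite, one of which is
`p^a` with `p` prime and `a ≥ 2`, then `cs(G) = {1, p, q, p^a, n}` for a prime `q ≠ p`,
where `n` is the other composite class size and every prime divisor of `n` lies in
`{p, q}`; moreover `G` is an internal direct product `G = K × A` with `K` a `{p,q}`-group
and `A` abelian. -/
theorem stmt_11 (G : Type*) [Group G] [Finite G] (p a : ℕ)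
    (hp : p.Prime) (ha : 2 ≤ a)
    (hcard : (csSet G).ncard = 5)
    (hcomp : {x ∈ csSet G | IsCompositeNat x}.ncard = 2)
    (hpa : p ^ a ∈ csSet G) :
    ∃ q n : ℕ, q.Prime ∧ q ≠ p ∧
      n ∈ csSet G ∧ IsCompositeNat n ∧ n ≠ p ^ a ∧
      csSet G = {1, p, q, p ^ a, n} ∧
      (∀ r : ℕ, r.Prime → r ∣ n → r = p ∨ r = q) ∧
      ∃ K A : Subgroup G,
        (∀ r : ℕ, r.Prime → r ∣ Nat.card K → r = p ∨ r = q) ∧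
        (∀ x ∈ A, ∀ y ∈ A, x * y = y * x) ∧
        ∃ e : (↥K × ↥A) ≃* G, ∀ (x : K) (y : A), e (x, y) = (x : G) * y := by
  obtain ⟨n, hnp, hC⟩ : ∃ n, n ≠ p ^ a ∧ {x ∈ csSet G | IsCompositeNat x} = {p ^ a, n} := by
    obtain ⟨x, y, hxy, hC⟩ := Set.ncard_eq_two.1 hcomp
    have hpc : p ^ a ∈ {x ∈ csSet G | IsCompositeNat x} :=
      ⟨hpa, Nat.one_lt_pow (by omega) hp.one_lt, Nat.Prime.not_prime_pow ha⟩
    rw [hC] at hpc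
    rcases hpc with h | h
    · exact ⟨y, by rw [h]; exact hxy.symm, by rw [h]; exact hC⟩
    · have h : p ^ a = y := h
      exact ⟨x, by rw [h]; exact hxy, by rw [h, hC, Set.pair_comm]⟩
  have hn : n ∈ csSet G ∧ IsCompositeNat n := by
    have : n ∈ ({p ^ a, n} : Set ℕ) := by simp
    rw [← hC] at this
    exact this
  have hpac : IsCompositeNat (p ^ a) := ⟨Nat.one_lt_pow (by omega) hp.one_lt, Nat.Prime.not_prime_pow ha⟩
  have h1 : 1 ∈ csSet G := ⟨1, (Stmt11.ix_one_iff (g := (1 : G)).2 (by simp)).symm⟩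
  have hfin : (csSet G).Finite := Set.finite_of_ncard_ne_zero (by omega)
  have hsub : ({1, p ^ a, n} : Set ℕ) ⊆ csSet G := by
    rintro x (rfl | rfl | rfl)
    · exact h1
    · exact hpa
    · exact hn.1
  have h3 : ({1, p ^ a, n} : Set ℕ).ncard = 3 := by
    rw [Set.ncard_eq_three]
    exact ⟨1, p ^ a, n, hpac.1.ne, hn.2.1.ne, hnp.symm, rfl⟩
  have hD : (csSet G \ {1, p ^ a, n}).ncard = 2 := by
    rw [Set.ncard_diff hsub (Set.toFinite _), hcard, h3]
  obtain ⟨r, s, hrs, hDe⟩ := Set.ncard_eq_two.1 hD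
  have hcs : csSet G = {1, r, s, p ^ a, n} := by
    rw [← Set.diff_union_of_subset hsub, hDe]
    ext x; simp only [Set.mem_union, Set.mem_insert_iff, Set.mem_singleton_iff]; tauto
  have hprime : ∀ x ∈ csSet G \ {1, p ^ a, n}, x.Prime := by
    rintro x ⟨hx, hx2⟩
    simp only [Set.mem_insert_iff, Set.mem_singleton_iff, not_or] at hx2
    by_contra hnp
    have hx0 : 0 < x := by
      obtain ⟨g, rfl⟩ := hx
      exact Stmt11.ix_pos g
    have : x ∈ {x ∈ csSet G | IsCompositeNat x} := ⟨hx, by omega, hnp⟩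
    rw [hC] at this
    rcases this with h | h
    · exact hx2.2.1 h
    · exact hx2.2.2 h
  have hr : r.Prime := hprime r (by rw [hDe]; simp)
  have hs : s.Prime := hprime s (by rw [hDe]; simp)
  have hrm : r ∈ csSet G := by rw [hcs]; simp
  have hsm : s ∈ csSet G := by rw [hcs]; simp
  have hmixed : ∀ m ∈ csSet G, ∀ x y : ℕ, x.Prime → y.Prime → x ≠ y → x ∣ m → y ∣ m → m = n := by
    intro m hm x y hx hy hxy hxm hym
    rw [hcs] at hm
    rcases hm with rfl | rfl | rfl | rfl | h
    · exact absurd (Nat.dvd_one.1 hxm) hx.one_lt.ne'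
    · exact absurd (((Nat.prime_dvd_prime_iff_eq hx hr).1 hxm).trans ((Nat.prime_dvd_prime_iff_eq hy hr).1 hym).symm) hxy
    · exact absurd (((Nat.prime_dvd_prime_iff_eq hx hs).1 hxm).trans ((Nat.prime_dvd_prime_iff_eq hy hs).1 hym).symm) hxy
    · exact absurd (((Nat.prime_dvd_prime_iff_eq hx hp).1 (hx.dvd_of_dvd_pow hxm)).trans
        ((Nat.prime_dvd_prime_iff_eq hy hp).1 (hy.dvd_of_dvd_pow hym)).symm) hxy
    · exact h
  have hOM : Stmt11.OneMixed G := by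
    intro m hm m' hm' x y x' y' hx hy hxy hx' hy' hxy' d1 d2 d3 d4
    rw [hmixed m hm x y hx hy hxy d1 d2, hmixed m' hm' x' y' hx' hy' hxy' d3 d4]
  have hprs : p = r ∨ p = s := by
    by_contra! hne
    obtain ⟨l1, g1, hl1, hg1, e1⟩ := Stmt11.prim_of_prime hr hrm
    obtain ⟨l2, g2, hl2, hg2, e2⟩ := Stmt11.prim_of_prime hs hsm
    obtain ⟨z, hz⟩ := hpa
    have hz : Stmt11.ix z = p ^ a := hz.symm
    obtain ⟨l3, g3, hl3, hg3, e3, e4⟩ := Stmt11.exists_primary (g := z) (by rw [hz]; exact hpac.1.ne')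
    rw [hz] at e4
    obtain ⟨c, _, hc⟩ := (Nat.dvd_prime_pow hp).1 e4
    exact Stmt11.lemE hOM hr hs hp hl1 hl2 hl3 hrs hne.1.symm hne.2.symm hg1 hg2 hg3 e1 e2 hc le_rfl le_rfl
      (Stmt11.exp_pos hc e3)
  obtain ⟨q, hq, hqp, hcs'⟩ : ∃ q : ℕ, q.Prime ∧ q ≠ p ∧ csSet G = {1, p, q, p ^ a, n} := by
    rcases hprs with rfl | rfl
    · exact ⟨s, hs, hrs.symm, hcs⟩
    · refine ⟨r, hr, hrs, ?_⟩
      rw [hcs]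
      ext x; simp only [Set.mem_insert_iff, Set.mem_singleton_iff]; tauto
  have hpm : p ∈ csSet G := by rw [hcs']; simp
  have hqm : q ∈ csSet G := by rw [hcs']; simp
  have hnd : ∀ t : ℕ, t.Prime → t ∣ n → t = p ∨ t = q := by
    intro t ht htn
    by_contra! hne
    have H : Stmt11.FH G t n p q := by
      refine ⟨ht, hp, hq, hne.1, hne.2, hqp.symm, hpm, hqm, hn.1, htn, ?_, ?_⟩
      · intro m hm hd
        rw [hcs'] at hm
        rcases hm with rfl | rfl | rfl | rfl | h
        · exact absurd (Nat.dvd_one.1 hd) ht.one_lt.ne'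
        · exact absurd ((Nat.prime_dvd_prime_iff_eq ht hp).1 hd) hne.1
        · exact absurd ((Nat.prime_dvd_prime_iff_eq ht hq).1 hd) hne.2
        · exact absurd hd (Stmt11.ppow ht hp hne.1)
        · exact h
      · intro m hm hd
        rw [hcs'] at hm
        rcases hm with rfl | rfl | rfl | rfl | h
        · exact ⟨0, Or.inl rfl⟩
        · exact ⟨1, Or.inl (pow_one _).symm⟩
        · exact ⟨1, Or.inr (pow_one _).symm⟩
        · exact ⟨a, Or.inl rfl⟩
        · have h : m = n := h
          exact absurd (h ▸ htn) hd
    exact H.false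
  refine ⟨q, n, hq, hqp, hn.1, hn.2, hnp, hcs', hnd, Stmt11.decomp hp hq ?_⟩
  intro m hm t ht hd
  rw [hcs'] at hm
  rcases hm with rfl | rfl | rfl | rfl | h
  · exact absurd (Nat.dvd_one.1 hd) ht.one_lt.ne'
  · exact Or.inl ((Nat.prime_dvd_prime_iff_eq ht hp).1 hd)
  · exact Or.inr ((Nat.prime_dvd_prime_iff_eq ht hq).1 hd)
  · exact Or.inl ((Nat.prime_dvd_prime_iff_eq ht hp).1 (ht.dvd_of_dvd_pow hd))
  · exact hnd t ht ((show m = n from h) ▸ hd)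
end
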